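/- Let n ≥ 1, let 0 < p < q < ∞ with α := n(1/p − 1/q) < 1, and let g be a holomorphic function on B_n. Then J_g is compact from H^p to H^q (meaning ‖J_g f_k‖_{H^q} → 0 for every sequence (f_k) in H^p with sup_k ‖f_k‖_{H^p} < ∞ converging to 0 uniformly on compact subsets of B_n) if and only if g ∈ λ(α), i.e. (1−|z|²)^{1−α}|Rg(z)| → 0 as |z| → 1⁻. -/

import Mathlib

open MeasureTheory Metric Set Filter
open scoped ENNReal NNReal Topology

noncomputable section

/-- ℂⁿ with its Euclidean (Hermitian) structure. -/
abbrev En (n : ℕ) := EuclideanSpace ℂ (Fin n)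

instance (n : ℕ) : MeasurableSpace (En n) := borel _
instance (n : ℕ) : BorelSpace (En n) := ⟨rfl⟩

/-- The open unit ball `B_n` of ℂⁿ. -/
def Bn (n : ℕ) : Set (En n) := Metric.ball 0 1

/-- The unit sphere `S_n = ∂B_n`. -/
def Sn (n : ℕ) : Set (En n) := Metric.sphere 0 1

/-- The Hermitian inner product `⟨z,w⟩ = ∑ z_k * conj (w_k)`. -/
def herm {n : ℕ} (z w : En n) : ℂ := ∑ k, z k * (starRingEnd ℂ) (w k)

/-- The surface measure on the unit sphere, normalized so that `σ(S_n) = 1`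
(the `(2n-1)`-dimensional Hausdorff measure restricted to the sphere, normalized). -/
def sigmaS (n : ℕ) : Measure (En n) :=
  ((μH[(2 * n - 1 : ℝ)] (Sn n))⁻¹) • (μH[(2 * n - 1 : ℝ)]).restrict (Sn n)

/-- Lebesgue measure on the unit ball, normalized so that `v(B_n) = 1`. -/
def volN (n : ℕ) : Measure (En n) :=
  ((volume (Bn n))⁻¹) • volume.restrict (Bn n)

/-- The radial derivative `Rg(z) = ∑ z_k ∂g/∂z_k (z) = (Dg)(z)[z]`. -/
def radD {n : ℕ} (g : En n → ℂ) (z : En n) : ℂ := fderiv ℂ g z z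

/-- The Volterra-type integration operator `J_g f(z) = ∫₀¹ f(tz) Rg(tz) dt/t`. -/
def J {n : ℕ} (g f : En n → ℂ) (z : En n) : ℂ :=
  ∫ t in Set.Ioo (0 : ℝ) 1, f (t • z) * radD g (t • z) / (t : ℂ)

/-- The Hardy space quasinorm `‖f‖_{H^p}`, with values in `ℝ≥0∞`:
`‖f‖_{H^p}^p = sup_{0<r<1} ∫_{S_n} |f(rζ)|^p dσ(ζ)`. -/
def hNorm (n : ℕ) (p : ℝ) (f : En n → ℂ) : ℝ≥0∞ :=
  (⨆ r ∈ Set.Ioo (0 : ℝ) 1,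
    ∫⁻ ζ, (‖f (r • ζ)‖₊ : ℝ≥0∞) ^ p ∂(sigmaS n)) ^ (1 / p)

/-- Membership in the Hardy space `H^p(B_n)`. -/
def MemHp (n : ℕ) (p : ℝ) (f : En n → ℂ) : Prop :=
  DifferentiableOn ℂ f (Bn n) ∧ hNorm n p f < ⊤

/-- The Carleson box `B_δ(ζ) = {z ∈ B_n : |1 - ⟨z,ζ⟩| < δ}`. -/
def cBox {n : ℕ} (ζ : En n) (δ : ℝ) : Set (En n) :=
  {z ∈ Bn n | ‖(1 : ℂ) - herm z ζ‖ < δ}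

/-- The measure `dμ_g(z) = |Rg(z)|²(1-|z|²) dv(z)`. -/
def muJ (n : ℕ) (g : En n → ℂ) : Measure (En n) :=
  (volN n).withDensity
    (fun z => (‖radD g z‖₊ : ℝ≥0∞) ^ 2 * ENNReal.ofReal (1 - ‖z‖ ^ 2))

/-- The admissible approach region `Γ_α(ζ) = {z ∈ B_n : |1-⟨z,ζ⟩| < (α/2)(1-|z|²)}`. -/
def Gam {n : ℕ} (α : ℝ) (ζ : En n) : Set (En n) :=
  {z ∈ Bn n | ‖(1 : ℂ) - herm z ζ‖ < α / 2 * (1 - ‖z‖ ^ 2)}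

open Classical in
/-- The involutive automorphism `φ_a` of the unit ball interchanging `0` and `a`:
`φ_a(z) = (a - P_a z - √(1-|a|²) (z - P_a z)) / (1 - ⟨z,a⟩)`, where `P_a` is the
orthogonal projection onto `ℂa`. -/
def mob {n : ℕ} (a z : En n) : En n :=
  if a = 0 then -z
  else ((1 : ℂ) - herm z a)⁻¹ •
    ((a - (herm z a / herm a a) • a) -
      ((Real.sqrt (1 - ‖a‖ ^ 2) : ℂ)) • (z - (herm z a / herm a a) • a))

/-- The norm of the invariant (real) gradient `∇̃f(z) = ∇(f ∘ φ_z)(0)`. -/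
def invGrad {n : ℕ} {F : Type*} [NormedAddCommGroup F] [NormedSpace ℝ F]
    (f : En n → F) (z : En n) : ℝ :=
  ‖fderiv ℝ (fun w => f (mob z w)) 0‖

/-- The invariant measure `dλ_n(z) = (1-|z|²)^{-(n+1)} dv(z)`. -/
def lamN (n : ℕ) : Measure (En n) :=
  (volN n).withDensity (fun z => ENNReal.ofReal ((1 - ‖z‖ ^ 2) ^ (-(n + 1 : ℝ))))

/-- The invariant Poisson integral `u_φ(z) = ∫_{S_n} φ(ζ) (1-|z|²)ⁿ/|1-⟨z,ζ⟩|^{2n} dσ(ζ)`. -/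
def poisson (n : ℕ) (φ : En n → ℝ) (z : En n) : ℝ :=
  ∫ ζ, φ ζ * ((1 - ‖z‖ ^ 2) ^ n / ‖(1 : ℂ) - herm z ζ‖ ^ (2 * n)) ∂(sigmaS n)

/-- The function `μ̃(ζ) = ∫_{Γ_α(ζ)} (1-|z|²)^{-n} dμ(z)`. -/
def tildeMu (n : ℕ) (α : ℝ) (μ : Measure (En n)) (ζ : En n) : ℝ≥0∞ :=
  ∫⁻ z in Gam α ζ, ENNReal.ofReal ((1 - ‖z‖ ^ 2) ^ (-(n : ℝ))) ∂μ

/-- The `L^{p/(p-s)}(S_n)`-norm of `μ̃`. -/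
def tildeMuNorm (n : ℕ) (α p s : ℝ) (μ : Measure (En n)) : ℝ≥0∞ :=
  (∫⁻ ζ, tildeMu n α μ ζ ^ (p / (p - s)) ∂(sigmaS n)) ^ ((p - s) / p)

/-- Zeros of a holomorphic function that is not identically zero are finite in smaller
closed balls. -/
theorem finite_zeros_closedBall {f : ℂ → ℂ} {R ρ : ℝ} (hf : DifferentiableOn ℂ f (ball 0 R))
    (hρR : ρ < R) {a : ℂ} (ha : a ∈ ball (0 : ℂ) R) (hfa : f a ≠ 0) :
    (closedBall (0 : ℂ) ρ ∩ f ⁻¹' {0}).Finite := by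
  have hA : AnalyticOnNhd ℂ f (ball 0 R) := hf.analyticOnNhd isOpen_ball
  have hsub : closedBall (0 : ℂ) ρ ⊆ ball 0 R := closedBall_subset_ball hρR
  by_contra hinf
  obtain ⟨z, hz, hacc⟩ := Set.Infinite.exists_accPt_of_subset_isCompact (K := closedBall (0 : ℂ) ρ)
    hinf (isCompact_closedBall _ _) inter_subset_left
  have hfr : ∃ᶠ w in 𝓝[≠] z, f w = 0 :=
    (accPt_iff_frequently_nhdsNE.mp hacc).mono fun w hw => hw.2
  have := hA.eqOn_zero_of_preconnected_of_frequently_eq_zero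
    (convex_ball (0 : ℂ) R).isPreconnected (hsub hz) hfr ha
  exact hfa this

/-- Removal of one zero without decreasing the modulus inside the disc. -/
theorem exists_remove_zero {f : ℂ → ℂ} {R ρ : ℝ} (hρ : 0 < ρ) (hρR : ρ < R)
    (hf : DifferentiableOn ℂ f (ball 0 R))
    {u : ℂ} (hu : ‖u‖ < ρ) (hfu : f u = 0) {a : ℂ} (ha : a ∈ ball (0 : ℂ) R) (hfa : f a ≠ 0) :
    ∃ F : ℂ → ℂ, DifferentiableOn ℂ F (ball 0 R) ∧
      (∀ z, ‖z‖ = ρ → ‖F z‖ = ‖f z‖) ∧ (∀ z, ‖z‖ ≤ ρ → ‖f z‖ ≤ ‖F z‖) ∧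
      (∀ z, ‖z‖ ≤ ρ → F z = 0 → f z = 0 ∧ z ≠ u) := by
  have hA : AnalyticOnNhd ℂ f (ball 0 R) := hf.analyticOnNhd isOpen_ball
  have huR : u ∈ ball (0 : ℂ) R := by simpa using hu.trans hρR
  have hne : ¬ ∀ᶠ z in 𝓝 u, f z = 0 := fun h =>
    hfa (hA.eqOn_zero_of_preconnected_of_eventuallyEq_zero
      (convex_ball (0 : ℂ) R).isPreconnected huR h ha)
  obtain ⟨n, g, hg, hgu, hfg⟩ := ((hA u huR).exists_eventuallyEq_pow_smul_nonzero_iff).2 hne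
  have hn : n ≠ 0 := by
    rintro rfl
    have := hfg.self_of_nhds
    simp [hfu] at this
    exact hgu this.symm
  classical
  let h : ℂ → ℂ := fun z => if z = u then g u else f z / (z - u) ^ n
  have hfh : ∀ z, f z = (z - u) ^ n * h z := by
    intro z
    by_cases hz : z = u
    · simp [hz, hfu, hn]
    · have : z - u ≠ 0 := sub_ne_zero.2 hz
      simp only [h, hz, if_false]
      field_simp
  have hh : DifferentiableOn ℂ h (ball 0 R) := by
    intro z hz
    apply DifferentiableAt.differentiableWithinAt
    by_cases hzu : z = u
    · subst hzu
      refine hg.differentiableAt.congr_of_eventuallyEq ?_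
      filter_upwards [hfg] with w hw
      by_cases hwz : w = z
      · simp [h, hwz]
      · have : w - z ≠ 0 := sub_ne_zero.2 hwz
        simp only [h, hwz, if_false]
        rw [hw, smul_eq_mul]
        field_simp
    · have h1 : DifferentiableAt ℂ (fun w => f w / (w - u) ^ n) z := by
        apply DifferentiableAt.div
        · exact (hf z hz).differentiableAt (isOpen_ball.mem_nhds hz)
        · fun_prop
        · exact pow_ne_zero _ (sub_ne_zero.2 hzu)
      refine h1.congr_of_eventuallyEq ?_
      filter_upwards [isOpen_ne.mem_nhds hzu] with w hw
      simp only [h]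
      rw [if_neg hw]
  let b : ℂ → ℂ := fun z => (ρ ^ 2 - (starRingEnd ℂ) u * z) / ρ
  have key : ∀ z : ℂ, ‖b z‖ ^ 2 * ρ ^ 2 = ‖z - u‖ ^ 2 * ρ ^ 2 +
      (ρ ^ 2 - ‖z‖ ^ 2) * (ρ ^ 2 - ‖u‖ ^ 2) := by
    intro z
    have h1 : ‖b z‖ ^ 2 * ρ ^ 2 = ‖(ρ ^ 2 - (starRingEnd ℂ) u * z : ℂ)‖ ^ 2 := by
      simp only [b, norm_div, div_pow]
      rw [Complex.norm_real, Real.norm_eq_abs, sq_abs]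
      field_simp
    rw [h1]
    have h2 : ((ρ : ℂ) ^ 2).re = ρ ^ 2 := by rw [← Complex.ofReal_pow, Complex.ofReal_re]
    have h3 : ((ρ : ℂ) ^ 2).im = 0 := by rw [← Complex.ofReal_pow, Complex.ofReal_im]
    simp only [← Complex.normSq_eq_norm_sq, Complex.normSq_apply, Complex.sub_re, Complex.sub_im,
      Complex.mul_re, Complex.mul_im, Complex.conj_re, Complex.conj_im, h2, h3]
    ring
  have hb1 : ∀ z, ‖z‖ = ρ → ‖b z‖ = ‖z - u‖ := by
    intro z hz
    have := key z
    rw [hz] at this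
    have h2 : ‖b z‖ ^ 2 = ‖z - u‖ ^ 2 := by
      have : (‖b z‖ ^ 2 - ‖z - u‖ ^ 2) * ρ ^ 2 = 0 := by linarith
      rcases mul_eq_zero.1 this with h | h
      · linarith
      · exact absurd h (by positivity)
    exact (pow_left_inj₀ (norm_nonneg _) (norm_nonneg _) two_ne_zero).1 h2
  have hb2 : ∀ z, ‖z‖ ≤ ρ → ‖z - u‖ ≤ ‖b z‖ := by
    intro z hz
    have := key z
    have h3 : 0 ≤ (ρ ^ 2 - ‖z‖ ^ 2) * (ρ ^ 2 - ‖u‖ ^ 2) := by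
      apply mul_nonneg <;> rw [sub_nonneg] <;> gcongr
    have h2 : ‖z - u‖ ^ 2 * ρ ^ 2 ≤ ‖b z‖ ^ 2 * ρ ^ 2 := by linarith
    have h4 : ‖z - u‖ ^ 2 ≤ ‖b z‖ ^ 2 := le_of_mul_le_mul_right h2 (by positivity)
    exact (pow_le_pow_iff_left₀ (norm_nonneg _) (norm_nonneg _) two_ne_zero).1 h4
  have hb3 : ∀ z, ‖z‖ ≤ ρ → b z ≠ 0 := by
    intro z hz h0
    have h1 := hb2 z hz
    rw [h0, norm_zero] at h1
    have h2 : z = u := sub_eq_zero.1 (norm_le_zero_iff.1 h1)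
    have := key z
    rw [h0, h2] at this
    simp at this
    nlinarith [norm_nonneg u]
  refine ⟨fun z => b z ^ n * h z, ?_, ?_, ?_, ?_⟩
  · apply DifferentiableOn.mul _ hh
    simp only [b]
    fun_prop
  · intro z hz
    rw [hfh z]; simp [hb1 z hz]
  · intro z hz
    rw [hfh z]; simp only [norm_mul, norm_pow]
    have := hb2 z hz
    gcongr
  · intro z hz h0
    have h1 : h z = 0 := by
      rcases mul_eq_zero.1 h0 with h | h
      · exact absurd h (pow_ne_zero _ (hb3 z hz))
      · exact h
    refine ⟨by rw [hfh z, h1, mul_zero], ?_⟩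
    rintro rfl
    simp [h] at h1
    exact hgu h1

/-- Removal of all zeros in a disc. -/
theorem exists_zero_free {R ρ : ℝ} (hρ : 0 < ρ) (hρR : ρ < R) (N : ℕ) :
    ∀ f : ℂ → ℂ, DifferentiableOn ℂ f (ball 0 R) → (∀ z, ‖z‖ = ρ → f z ≠ 0) →
      (closedBall (0 : ℂ) ρ ∩ f ⁻¹' {0}).ncard = N →
      (closedBall (0 : ℂ) ρ ∩ f ⁻¹' {0}).Finite →
    ∃ F : ℂ → ℂ, DifferentiableOn ℂ F (ball 0 R) ∧
      (∀ z, ‖z‖ = ρ → ‖F z‖ = ‖f z‖) ∧ (∀ z, ‖z‖ ≤ ρ → ‖f z‖ ≤ ‖F z‖) ∧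
      (∀ z, ‖z‖ ≤ ρ → F z ≠ 0) := by
  induction N using Nat.strong_induction_on with
  | _ N ih =>
    intro f hf hc hN hfin
    by_cases hz : ∃ u, ‖u‖ ≤ ρ ∧ f u = 0
    · obtain ⟨u, hu, hfu⟩ := hz
      have hu' : ‖u‖ < ρ := lt_of_le_of_ne hu fun h => hc u h hfu
      have hρn : ‖(ρ : ℂ)‖ = ρ := by simp [hρ.le]
      obtain ⟨F, hF, h1, h2, h3⟩ := exists_remove_zero hρ hρR hf hu' hfu
        (a := (ρ : ℂ)) (by simpa [abs_of_pos hρ] using hρR) (hc _ hρn)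
      have hss : closedBall (0 : ℂ) ρ ∩ F ⁻¹' {0} ⊂ closedBall (0 : ℂ) ρ ∩ f ⁻¹' {0} := by
        refine ⟨fun z hz => ⟨hz.1, (h3 z (by simpa using hz.1) hz.2).1⟩, fun h => ?_⟩
        have := h (show u ∈ _ from ⟨by simpa using hu, hfu⟩)
        exact (h3 u hu this.2).2 rfl
      have hlt := Set.ncard_lt_ncard hss hfin
      rw [hN] at hlt
      obtain ⟨G, hG, g1, g2, g3⟩ := ih _ hlt F hF
        (fun z hz h0 => hc z hz (h3 z hz.le h0).1) rfl (hfin.subset hss.subset)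
      exact ⟨G, hG, fun z hz => (g1 z hz).trans (h1 z hz),
        fun z hz => (h2 z hz).trans (g2 z hz), g3⟩
    · push Not at hz
      exact ⟨f, hf, fun _ _ => rfl, fun _ _ => le_rfl, hz⟩

theorem poissonKernel_nonneg_of_lt {a z : ℂ} (h : ‖a‖ ≤ ‖z‖) : 0 ≤ poissonKernel 0 a z := by
  rw [poissonKernel_def]
  simp only [sub_zero]
  have : ‖a‖ ^ 2 ≤ ‖z‖ ^ 2 := by gcongr
  apply div_nonneg (by linarith) (by positivity)

theorem continuousOn_poissonKernel (a : ℂ) : ContinuousOn (poissonKernel 0 a) {z | z ≠ a} := by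
  have : poissonKernel 0 a = fun z => (‖z‖ ^ 2 - ‖a‖ ^ 2) / ‖z - a‖ ^ 2 := by
    ext z; rw [poissonKernel_def]; simp
  rw [this]
  apply ContinuousOn.div (by fun_prop) (by fun_prop)
  intro z hz
  have : z - a ≠ 0 := sub_ne_zero.2 hz
  positivity

/-- Poisson sub-mean value property for a zero-free function. -/
theorem submean_of_ne_zero {f : ℂ → ℂ} {R ρ s : ℝ} (hρ : 0 < ρ) (hρR : ρ < R)
    (hf : DifferentiableOn ℂ f (ball 0 R)) (h0 : ∀ z, ‖z‖ ≤ ρ → f z ≠ 0) {a : ℂ} (ha : ‖a‖ < ρ) :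
    ‖f a‖ ^ s ≤ Real.circleAverage (fun z => poissonKernel 0 a z * ‖f z‖ ^ s) 0 ρ := by
  obtain ⟨δ, hδ, hδs⟩ := (isCompact_closedBall (0 : ℂ) ρ).exists_thickening_subset_open
    (t := ball (0 : ℂ) R ∩ f ⁻¹' {0}ᶜ)
    (hf.continuousOn.isOpen_inter_preimage isOpen_ball isOpen_compl_singleton)
    (fun z hz => ⟨closedBall_subset_ball hρR hz, h0 z (by simpa using hz)⟩)
  rw [thickening_closedBall hδ hρ.le] at hδs
  set R' := δ + ρ with hR'
  have hR'ρ : ρ < R' := by linarith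
  have hf' : DifferentiableOn ℂ f (ball 0 R') := hf.mono fun z hz => (hδs hz).1
  have hne : ∀ z ∈ ball (0 : ℂ) R', f z ≠ 0 := fun z hz => (hδs hz).2
  have hdf : DifferentiableOn ℂ (fun z => deriv f z / f z) (ball 0 R') :=
    (hf'.deriv isOpen_ball).div hf' hne
  obtain ⟨L, hL⟩ := hdf.isExactOn_ball
  have hLd : DifferentiableOn ℂ L (ball 0 R') := fun z hz =>
    (hL z hz).differentiableAt.differentiableWithinAt
  have h0R : (0 : ℂ) ∈ ball (0 : ℂ) R' := by simp; linarith
  have hconst : ∀ z ∈ ball (0 : ℂ) R', f z * Complex.exp (-L z) = f 0 * Complex.exp (-L 0) := by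
    intro z hz
    refine (convex_ball (0 : ℂ) R').is_const_of_fderivWithin_eq_zero (𝕜 := ℂ)
      (f := fun z => f z * Complex.exp (-L z)) ?_ ?_ hz h0R
    · exact hf'.mul (hLd.neg.cexp)
    · intro w hw
      rw [fderivWithin_of_isOpen isOpen_ball hw]
      have h1 : HasDerivAt f (deriv f w) w :=
        ((hf' w hw).differentiableAt (isOpen_ball.mem_nhds hw)).hasDerivAt
      have h2 := h1.mul ((hL w hw).neg.cexp)
      have hz0 : deriv f w * Complex.exp ((-L) w) +
          f w * (Complex.exp ((-L) w) * -(fun z => deriv f z / f z) w) = 0 := by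
        have := hne w hw
        field_simp
        ring
      have h3 : HasDerivAt (fun z => f z * Complex.exp (-L z)) 0 w := by
        rw [← hz0]; exact h2
      have := h3.hasFDerivAt.fderiv
      rw [this]; ext; simp
  obtain ⟨c, hc⟩ : ∃ c, Complex.exp c = f 0 * Complex.exp (-L 0) :=
    ⟨_, Complex.exp_log (mul_ne_zero (hne 0 h0R) (Complex.exp_ne_zero _))⟩
  let G : ℂ → ℂ := fun z => Complex.exp (s * (L z + c))
  have hG : ∀ z ∈ ball (0 : ℂ) R', ‖G z‖ = ‖f z‖ ^ s := by
    intro z hz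
    have h1 : f z = Complex.exp (L z + c) := by
      rw [Complex.exp_add, hc, ← hconst z hz, mul_comm (f z), ← mul_assoc, ← Complex.exp_add]
      simp
    rw [h1]
    simp only [G, Complex.norm_exp]
    rw [← Real.exp_mul]
    congr 1
    simp
    ring
  have hGd : DifferentiableOn ℂ G (ball 0 R') := by
    apply DifferentiableOn.cexp
    exact (hLd.add_const c).const_mul _
  have hGc : DiffContOnCl ℂ G (ball 0 ρ) := by
    apply DifferentiableOn.diffContOnCl
    rw [closure_ball _ hρ.ne']
    exact hGd.mono (closedBall_subset_ball hR'ρ)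
  have hP := hGc.circleAverage_poissonKernel_smul (w := a) (by simpa using ha)
  rw [← hG a (by simpa using ha.trans hR'ρ), ← hP]
  have hsph : ∀ θ, circleMap 0 ρ θ ∈ ball (0 : ℂ) R' := by
    intro θ; simp [abs_of_pos hρ, hR'ρ]
  have hsn : ∀ θ, ‖circleMap 0 ρ θ‖ = ρ := by
    intro θ; simp [abs_of_pos hρ]
  rw [Real.circleAverage_def, Real.circleAverage_def, norm_smul, smul_eq_mul, Real.norm_eq_abs,
    abs_of_pos (by positivity)]
  gcongr
  refine (intervalIntegral.norm_integral_le_integral_norm Real.two_pi_pos.le).trans_eq ?_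
  refine intervalIntegral.integral_congr fun θ _ => ?_
  simp only [Pi.smul_apply', norm_smul]
  rw [hG _ (hsph θ), Real.norm_eq_abs,
    abs_of_nonneg (poissonKernel_nonneg_of_lt (by rw [hsn]; exact ha.le))]

/-- Poisson sub-mean value property of `|f|^s`. -/
theorem submean {f : ℂ → ℂ} {R ρ s : ℝ} (hs : 0 < s) (hρR : ρ < R)
    (hf : DifferentiableOn ℂ f (ball 0 R)) {a : ℂ} (ha : ‖a‖ < ρ) :
    ‖f a‖ ^ s ≤ Real.circleAverage (fun z => poissonKernel 0 a z * ‖f z‖ ^ s) 0 ρ := by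
  have hρ : 0 < ρ := (norm_nonneg a).trans_lt ha
  by_cases hfa : f a = 0
  · rw [hfa, norm_zero, Real.zero_rpow hs.ne']
    apply Real.circleAverage_nonneg_of_nonneg
    intro z hz
    have hz' : ‖z‖ = ρ := by simpa [abs_of_pos hρ] using hz
    exact mul_nonneg (poissonKernel_nonneg_of_lt (by rw [hz']; exact ha.le)) (by positivity)
  have haR : a ∈ ball (0 : ℂ) R := by simpa using ha.trans hρR
  have hgood : ∀ r, ρ < r → r < R → (∀ z, ‖z‖ = r → f z ≠ 0) →
      ‖f a‖ ^ s ≤ Real.circleAverage (fun z => poissonKernel 0 a z * ‖f z‖ ^ s) 0 r := by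
    intro r hr hrR hne
    have hr0 : 0 < r := hρ.trans hr
    obtain ⟨F, hF, h1, h2, h3⟩ := exists_zero_free hr0 hrR _ f hf hne rfl
      (finite_zeros_closedBall hf hrR haR hfa)
    have har : ‖a‖ < r := ha.trans hr
    calc ‖f a‖ ^ s ≤ ‖F a‖ ^ s := by
          have := h2 a har.le
          gcongr
      _ ≤ _ := submean_of_ne_zero hr0 hrR hF h3 har
      _ = _ := by
          apply Real.circleAverage_congr_sphere
          intro z hz
          have hz' : ‖z‖ = r := by simpa [abs_of_pos hr0] using hz
          simp only [h1 z hz']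
  have hcont : ContinuousOn (fun r => Real.circleAverage
      (fun z => poissonKernel 0 a z * ‖f z‖ ^ s) 0 r) (Ioo ‖a‖ R) := by
    apply Real.ContinuousOn.circleAverage (s := Ioo ‖a‖ R)
    · apply ContinuousOn.mul
      · refine (continuousOn_poissonKernel a).mono ?_
        rintro z hz rfl
        simp at hz
      · apply ContinuousOn.rpow_const _ (fun _ _ => Or.inr hs.le)
        apply ContinuousOn.norm
        exact hf.continuousOn.mono fun z hz => by simpa using hz.2
    · intro r hr; exact (norm_nonneg a).trans hr.1.le
  have hT : Tendsto (fun r => Real.circleAverage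
      (fun z => poissonKernel 0 a z * ‖f z‖ ^ s) 0 r) (𝓝[>] ρ)
      (𝓝 (Real.circleAverage (fun z => poissonKernel 0 a z * ‖f z‖ ^ s) 0 ρ)) :=
    ((hcont.continuousAt (Ioo_mem_nhds ha hρR)).tendsto).mono_left nhdsWithin_le_nhds
  refine ge_of_tendsto hT ?_
  obtain ⟨r', hr'1, hr'2⟩ := exists_between hρR
  have hfin := finite_zeros_closedBall hf hr'2 haR hfa
  have hfin2 : ((fun z : ℂ => ‖z‖) '' (closedBall (0 : ℂ) r' ∩ f ⁻¹' {0}) \ {ρ}).Finite :=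
    (hfin.image _).subset sdiff_subset
  have hn : ((fun z : ℂ => ‖z‖) '' (closedBall (0 : ℂ) r' ∩ f ⁻¹' {0}) \ {ρ})ᶜ ∈ 𝓝[>] ρ :=
    nhdsWithin_le_nhds (hfin2.isClosed.isOpen_compl.mem_nhds (by simp))
  filter_upwards [hn, Ioo_mem_nhdsGT hr'1] with r hr hrr
  refine hgood r hrr.1 (hrr.2.trans hr'2) fun z hz hfz => hr ⟨⟨z, ⟨?_, hfz⟩, hz⟩, hrr.1.ne'⟩
  simp [hz, hrr.2.le]

instance factTwoPiPos : Fact (0 < 2 * Real.pi) := ⟨Real.two_pi_pos⟩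

/-- The circle group. -/
abbrev TT := AddCircle (2 * Real.pi)

/-- Normalized Haar measure on the circle group. -/
abbrev muT : Measure TT := AddCircle.haarAddCircle

/-- The character `x ↦ e^{ix}`. -/
def eT (x : TT) : ℂ := (AddCircle.toCircle x : ℂ)

theorem norm_eT (x : TT) : ‖eT x‖ = 1 := Circle.norm_coe _

theorem continuous_eT : Continuous eT := by
  unfold eT
  exact continuous_subtype_val.comp AddCircle.continuous_toCircle

theorem eT_add (x y : TT) : eT (x + y) = eT x * eT y := by simp [eT, AddCircle.toCircle_add]

theorem eT_neg (x : TT) : eT (-x) = (starRingEnd ℂ) (eT x) := by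
  simp only [eT, AddCircle.toCircle_neg]
  exact Circle.coe_inv_eq_conj _

theorem eT_coe (θ : ℝ) : eT (θ : TT) = Complex.exp (θ * Complex.I) := by
  simp [eT, AddCircle.toCircle_apply_mk, Circle.coe_exp]

theorem integral_muT_eq {E : Type*} [NormedAddCommGroup E] [NormedSpace ℝ E]
    (f : ℂ → E) (ρ : ℝ) : ∫ x, f (ρ * eT x) ∂muT = Real.circleAverage f 0 ρ := by
  rw [AddCircle.integral_haarAddCircle, Real.circleAverage_def]
  congr 1
  rw [← AddCircle.intervalIntegral_preimage (2 * Real.pi) 0, zero_add]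
  refine intervalIntegral.integral_congr fun θ _ => ?_
  simp only [eT_coe, circleMap, zero_add]

/-- The Poisson kernel on the circle group. -/
def kr (t : ℝ) (x : TT) : ℝ := (1 - t ^ 2) / ‖eT x - t‖ ^ 2

/-- The Poisson kernel on the circle group with values in `ℝ≥0∞`. -/
def kT (t : ℝ) (x : TT) : ℝ≥0∞ := ENNReal.ofReal (kr t x)

theorem le_norm_eT_sub {t : ℝ} (ht : 0 ≤ t) (x : TT) : 1 - t ≤ ‖eT x - t‖ := by
  have := norm_sub_norm_le (eT x) (t : ℂ)
  rw [norm_eT, Complex.norm_real, Real.norm_of_nonneg ht] at this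
  exact this

theorem kr_nonneg {t : ℝ} (ht : 0 ≤ t) (ht1 : t < 1) (x : TT) : 0 ≤ kr t x := by
  unfold kr
  have : 0 ≤ 1 - t ^ 2 := by nlinarith
  positivity

theorem continuous_kr {t : ℝ} (ht : 0 ≤ t) (ht1 : t < 1) : Continuous (kr t) := by
  unfold kr
  apply Continuous.div (by fun_prop)
  · exact ((continuous_eT.sub continuous_const).norm.pow 2)
  · intro x
    have := le_norm_eT_sub ht x
    have : 0 < ‖eT x - t‖ := by linarith
    positivity

theorem continuous_kT {t : ℝ} (ht : 0 ≤ t) (ht1 : t < 1) : Continuous (kT t) :=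
  ENNReal.continuous_ofReal.comp (continuous_kr ht ht1)

theorem kr_neg (t : ℝ) (x : TT) : kr t (-x) = kr t x := by
  unfold kr
  congr 2
  rw [eT_neg, ← Complex.norm_conj]
  simp

theorem kT_neg (t : ℝ) (x : TT) : kT t (-x) = kT t x := by
  unfold kT; rw [kr_neg]

theorem kr_eq_poissonKernel (t : ℝ) (x : TT) : kr t x = poissonKernel 0 (t : ℂ) (eT x) := by
  rw [poissonKernel_def, kr]
  simp [norm_eT]

/-- The Poisson kernels form a semigroup under convolution. -/
theorem integral_kr_mul_kr {s t : ℝ} (hs : 0 ≤ s) (hs1 : s < 1) (ht : 0 ≤ t) (ht1 : t < 1)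
    (x : TT) : ∫ y, kr t (x - y) * kr s y ∂muT = kr (t * s) x := by
  set c : ℂ := (starRingEnd ℂ) (eT x) with hc
  have hcn : ‖c‖ = 1 := by rw [hc, Complex.norm_conj, norm_eT]
  have hden : ∀ z : ℂ, ‖z‖ ≤ 1 → 1 - t * c * z ≠ 0 := by
    intro z hz h0
    have h1 : t * c * z = 1 := (sub_eq_zero.1 h0).symm
    have h2 : ‖(t : ℂ) * c * z‖ = 1 := by rw [h1]; simp
    rw [norm_mul, norm_mul, hcn, Complex.norm_real, Real.norm_of_nonneg ht] at h2
    nlinarith [norm_nonneg z]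
  let h : ℂ → ℂ := fun z => (1 + t * c * z) / (1 - t * c * z)
  have hd : DiffContOnCl ℂ h (ball 0 1) := by
    apply DifferentiableOn.diffContOnCl
    rw [closure_ball _ one_ne_zero]
    intro z hz
    have := hden z (by simpa using hz)
    apply DifferentiableAt.differentiableWithinAt
    simp only [h]
    fun_prop (disch := assumption)
  have hre : ∀ (r : ℝ) (w : ℂ), ‖w‖ = r → 
      (h w).re = (1 - (t * r) ^ 2) / ‖1 - t * c * w‖ ^ 2 := by
    intro r w hw
    have h3 : ((1 + t * c * w) * (starRingEnd ℂ) (1 - t * c * w)).re = 1 - ‖t * c * w‖ ^ 2 := by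
      rw [← Complex.normSq_eq_norm_sq, Complex.normSq_apply]
      simp only [Complex.mul_re, Complex.conj_re, Complex.conj_im, Complex.add_re, Complex.add_im,
        Complex.sub_re, Complex.sub_im, Complex.one_re, Complex.one_im]
      ring
    have h4 : (h w).re = ((1 + t * c * w) * (starRingEnd ℂ) (1 - t * c * w)).re /
        ‖1 - t * c * w‖ ^ 2 := by
      simp only [h]
      rw [div_eq_mul_inv, Complex.inv_def, ← mul_assoc, Complex.re_mul_ofReal,
        Complex.normSq_eq_norm_sq, div_eq_mul_inv]
    rw [h4, h3, norm_mul, norm_mul, hcn, hw, Complex.norm_real, Real.norm_of_nonneg ht]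
    ring
  have hP := hd.circleAverage_poissonKernel_smul (w := (s : ℂ))
      (by simpa [abs_of_nonneg hs] using hs1)
  rw [← integral_muT_eq] at hP
  have hP2 := congrArg Complex.re hP
  have hxc : eT x * c = 1 := by
    rw [hc, Complex.mul_conj, Complex.normSq_eq_norm_sq, norm_eT]; simp
  have hnorm : ∀ w : ℂ, ‖1 - t * c * w‖ = ‖eT x - t * w‖ := by
    intro w
    have : 1 - t * c * w = c * (eT x - t * w) := by
      rw [mul_sub, mul_comm c, hxc]; ring
    rw [this, norm_mul, hcn, one_mul]
  have hint : Integrable (fun y => (poissonKernel 0 (s : ℂ) • h) ((1 : ℝ) * eT y)) muT := by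
    apply Continuous.integrable_of_hasCompactSupport _ (HasCompactSupport.of_compactSpace _)
    have : (fun y => (poissonKernel 0 (s : ℂ) • h) ((1 : ℝ) * eT y)) =
        fun y => kr s y • h (eT y) := by
      ext y; simp [kr_eq_poissonKernel]
    rw [this]
    apply (continuous_kr hs hs1).smul
    simp only [h]
    apply Continuous.div
    · exact continuous_const.add (continuous_const.mul continuous_eT)
    · exact continuous_const.sub (continuous_const.mul continuous_eT)
    · intro y; exact hden _ (norm_eT y).le
  have h5 : (∫ y, (poissonKernel 0 (s : ℂ) • h) ((1 : ℝ) * eT y) ∂muT).re =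
      ∫ y, ((poissonKernel 0 (s : ℂ) • h) ((1 : ℝ) * eT y)).re ∂muT := (integral_re hint).symm
  rw [h5, hre s _ (by simp [abs_of_nonneg hs]), hnorm] at hP2
  rw [show kr (t * s) x = (1 - (t * s) ^ 2) / ‖eT x - t * s‖ ^ 2 by simp [kr], ← hP2]
  refine integral_congr_ae (Eventually.of_forall fun y => ?_)
  simp only [Complex.ofReal_one, one_mul, Pi.smul_apply', Complex.real_smul, Complex.re_ofReal_mul]
  rw [hre 1 _ (norm_eT y), hnorm, ← kr_eq_poissonKernel, mul_comm, mul_one]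
  congr 1
  unfold kr
  congr 2
  have : eT x - t * eT y = eT y * (eT (x - y) - t) := by
    rw [mul_sub, ← eT_add]
    congr 1
    · congr 1; abel
    · ring
  rw [this, norm_mul, norm_eT, one_mul]

theorem lintegral_kT_mul_kT {s t : ℝ} (hs : 0 ≤ s) (hs1 : s < 1) (ht : 0 ≤ t) (ht1 : t < 1)
    (x : TT) : ∫⁻ y, kT t (x - y) * kT s y ∂muT = kT (t * s) x := by
  unfold kT
  rw [← integral_kr_mul_kr hs hs1 ht ht1, ofReal_integral_eq_lintegral_ofReal]
  · refine lintegral_congr fun y => ?_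
    rw [ENNReal.ofReal_mul (kr_nonneg ht ht1 _)]
  · apply Continuous.integrable_of_hasCompactSupport _ (HasCompactSupport.of_compactSpace _)
    exact ((continuous_kr ht ht1).comp (continuous_const.sub continuous_id)).mul
      (continuous_kr hs hs1)
  · exact Eventually.of_forall fun y => mul_nonneg (kr_nonneg ht ht1 _) (kr_nonneg hs hs1 _)

theorem kr_mul_le {m u : ℝ} (hm0 : 0 ≤ m) (hm : m < 1) (h1 : u ≤ m) (h2 : m ^ 2 ≤ u) (x : TT) :
    kr u x ≤ 8 * kr m x := by
  unfold kr
  have hu0 : 0 ≤ u := (sq_nonneg m).trans h2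
  have hu1 : 1 - u ≤ ‖eT x - u‖ := le_norm_eT_sub hu0 x
  have hm1 : 1 - m ≤ ‖eT x - m‖ := le_norm_eT_sub hm0 x
  have h3 : ‖eT x - m‖ ≤ 2 * ‖eT x - u‖ := by
    have : eT x - m = (eT x - u) + ((u - m : ℝ) : ℂ) := by push_cast; ring
    have h4 : ‖eT x - m‖ ≤ ‖eT x - u‖ + |u - m| := by
      rw [this]; refine (norm_add_le _ _).trans ?_
      rw [Complex.norm_real, Real.norm_eq_abs]
    have h5 : |u - m| ≤ 1 - u := by
      rw [abs_of_nonpos (by linarith)]; nlinarith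
    linarith
  have h6 : 1 - u ^ 2 ≤ 2 * (1 - m ^ 2) := by nlinarith [mul_self_nonneg m]
  have p1 : 0 < ‖eT x - m‖ := by linarith
  have p2 : 0 < ‖eT x - u‖ := by linarith
  have h7 : ‖eT x - m‖ ^ 2 ≤ 4 * ‖eT x - u‖ ^ 2 := by nlinarith
  rw [← mul_div_assoc, div_le_div_iff₀ (by positivity) (by positivity)]
  have h8 : 0 ≤ 1 - m ^ 2 := by nlinarith
  calc (1 - u ^ 2) * ‖eT x - m‖ ^ 2 ≤ (2 * (1 - m ^ 2)) * (4 * ‖eT x - u‖ ^ 2) := by gcongr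
    _ = _ := by ring

theorem kT_mul_le {s t : ℝ} (hs : 0 ≤ s) (hs1 : s < 1) (ht : 0 ≤ t) (ht1 : t < 1) (x : TT) :
    kT (t * s) x ≤ 8 * (kT s x + kT t x) := by
  have h8 : (8 : ℝ≥0∞) = ENNReal.ofReal 8 := by simp
  rw [h8]
  unfold kT
  rw [← ENNReal.ofReal_add (kr_nonneg hs hs1 _) (kr_nonneg ht ht1 _),
    ← ENNReal.ofReal_mul (by norm_num)]
  apply ENNReal.ofReal_le_ofReal
  have a1 := kr_nonneg hs hs1 x
  have a2 := kr_nonneg ht ht1 x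
  rcases le_total s t with h | h
  · have := kr_mul_le (m := s) (u := t * s) hs hs1 (by nlinarith) (by nlinarith) x
    linarith
  · have := kr_mul_le (m := t) (u := t * s) ht ht1 (by nlinarith) (by nlinarith) x
    linarith

/-- Poisson sub-mean value property on the circle group. -/
theorem enorm_rpow_le_lintegral_kT {φ : ℂ → ℂ} {R ρ s t : ℝ} (hs : 0 < s) (hρ : 0 < ρ)
    (hρR : ρ < R) (hφ : DifferentiableOn ℂ φ (ball 0 R)) (ht : 0 ≤ t) (ht1 : t < 1) :
    ‖φ (ρ * t)‖ₑ ^ s ≤ ∫⁻ x, kT t x * ‖φ (ρ * eT x)‖ₑ ^ s ∂muT := by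
  have h1 := submean (a := (ρ * t : ℂ)) hs hρR hφ (by
    rw [norm_mul, Complex.norm_real, Complex.norm_real, Real.norm_of_nonneg hρ.le,
      Real.norm_of_nonneg ht]; nlinarith)
  rw [← integral_muT_eq] at h1
  have hk : ∀ x, poissonKernel 0 (ρ * t : ℂ) (ρ * eT x) = kr t x := by
    intro x
    rw [poissonKernel_def, kr]
    simp only [sub_zero, ← mul_sub, norm_mul, norm_eT, Complex.norm_real, Real.norm_of_nonneg hρ.le,
      Real.norm_of_nonneg ht]
    have := le_norm_eT_sub ht x
    have : 0 < ‖eT x - t‖ := by linarith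
    field_simp
  simp only [hk] at h1
  have hcont : Continuous fun x => kr t x * ‖φ (ρ * eT x)‖ ^ s := by
    apply (continuous_kr ht ht1).mul
    apply Continuous.rpow_const _ (fun _ => Or.inr hs.le)
    apply Continuous.norm
    apply hφ.continuousOn.comp_continuous (continuous_const.mul continuous_eT)
    intro x
    simp [norm_eT, abs_of_pos hρ, hρR]
  have h2 := ENNReal.ofReal_le_ofReal h1
  rw [ofReal_integral_eq_lintegral_ofReal (hcont.integrable_of_hasCompactSupport
    (HasCompactSupport.of_compactSpace _)) (Eventually.of_forall fun x =>
      mul_nonneg (kr_nonneg ht ht1 x) (by positivity))] at h2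
  rw [← ENNReal.ofReal_rpow_of_nonneg (norm_nonneg _) hs.le, ofReal_norm] at h2
  refine h2.trans_eq (lintegral_congr fun x => ?_)
  rw [ENNReal.ofReal_mul (kr_nonneg ht ht1 x),
    ← ENNReal.ofReal_rpow_of_nonneg (norm_nonneg _) hs.le, ofReal_norm]
  rfl

theorem kT_zero (x : TT) : kT 0 x = 1 := by simp [kT, kr, norm_eT]

theorem norm_normalize_sub_le {E : Type*} [NormedAddCommGroup E] [NormedSpace ℝ E] {a b : E}
    (ha : 1 ≤ ‖a‖) (hb : 1 ≤ ‖b‖) : ‖‖a‖⁻¹ • a - ‖b‖⁻¹ • b‖ ≤ 2 * ‖a - b‖ := by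
  have ha0 : ‖a‖ ≠ 0 := by linarith
  have hb0 : ‖b‖ ≠ 0 := by linarith
  have h1 : ‖a‖⁻¹ • a - ‖b‖⁻¹ • b = ‖a‖⁻¹ • (a - b) + (‖a‖⁻¹ - ‖b‖⁻¹) • b := by
    rw [smul_sub, sub_smul]; abel
  have h2 : |‖a‖⁻¹ - ‖b‖⁻¹| * ‖b‖ ≤ ‖a - b‖ := by
    have : ‖a‖⁻¹ - ‖b‖⁻¹ = (‖b‖ - ‖a‖) * (‖a‖⁻¹ * ‖b‖⁻¹) := by field_simp
    rw [this, abs_mul, abs_of_nonneg (a := ‖a‖⁻¹ * ‖b‖⁻¹) (by positivity)]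
    have h3 : |‖b‖ - ‖a‖| ≤ ‖a - b‖ := by
      rw [abs_sub_comm]; exact abs_norm_sub_norm_le a b
    calc |‖b‖ - ‖a‖| * (‖a‖⁻¹ * ‖b‖⁻¹) * ‖b‖ = |‖b‖ - ‖a‖| * ‖a‖⁻¹ := by field_simp
      _ ≤ |‖b‖ - ‖a‖| * 1 := by
          gcongr; exact inv_le_one_of_one_le₀ ha
      _ ≤ _ := by linarith
  have h4 : ‖a‖⁻¹ * ‖a - b‖ ≤ ‖a - b‖ := by
    have : ‖a‖⁻¹ ≤ 1 := inv_le_one_of_one_le₀ ha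
    nlinarith [norm_nonneg (a - b)]
  rw [h1]
  refine (norm_add_le _ _).trans ?_
  rw [norm_smul, norm_smul, norm_inv, norm_norm, Real.norm_eq_abs]
  linarith

section Sphere

variable {E : Type*} [NormedAddCommGroup E] [InnerProductSpace ℝ E]

open Module Submodule

theorem normalize_orth {x z : E} (hx : ‖x‖ = 1) (hz : ‖z‖ = 1)
    (hc : 1 / 2 < inner ℝ x z) : ∃ v : (ℝ ∙ x)ᗮ, ‖v‖ < 2 ∧ ‖x + (v : E)‖⁻¹ • (x + (v : E)) = z := by
  set c : ℝ := inner ℝ x z with hcdef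
  have hc0 : 0 < c := by linarith
  have hmem : c⁻¹ • z - x ∈ (ℝ ∙ x)ᗮ := by
    rw [mem_orthogonal_singleton_iff_inner_right, inner_sub_right, inner_smul_right, ← hcdef,
      real_inner_self_eq_norm_sq, hx]
    field_simp
    norm_num
  have hxy : x + (c⁻¹ • z - x) = c⁻¹ • z := by abel
  refine ⟨⟨_, hmem⟩, ?_, ?_⟩
  · have h1 : ‖c⁻¹ • z‖ ^ 2 = ‖x‖ ^ 2 + ‖c⁻¹ • z - x‖ ^ 2 := by
      have h := norm_add_sq_eq_norm_sq_add_norm_sq_of_inner_eq_zero x (c⁻¹ • z - x)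
        ((mem_orthogonal_singleton_iff_inner_right).1 hmem)
      rw [hxy] at h
      nlinarith
    rw [norm_smul, hz, hx, norm_inv, Real.norm_of_nonneg hc0.le, mul_one] at h1
    have h2 : c⁻¹ < 2 := by
      rw [inv_lt_comm₀ hc0 (by norm_num)]; linarith
    have h3 : 0 < c⁻¹ := by positivity
    rw [Submodule.coe_norm]
    simp only
    nlinarith [norm_nonneg (c⁻¹ • z - x)]
  · simp only [hxy]
    rw [norm_smul, hz, norm_inv, Real.norm_of_nonneg hc0.le, mul_one, inv_inv, smul_smul,
      mul_inv_cancel₀ hc0.ne', one_smul]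

theorem one_le_norm_add_orth {x : E} (hx : ‖x‖ = 1) (v : (ℝ ∙ x)ᗮ) : 1 ≤ ‖x + (v : E)‖ := by
  have h := norm_add_sq_eq_norm_sq_add_norm_sq_of_inner_eq_zero x (v : E)
    ((mem_orthogonal_singleton_iff_inner_right).1 v.2)
  rw [hx] at h
  nlinarith [norm_nonneg (x + (v : E)), norm_nonneg (v : E)]

variable [FiniteDimensional ℝ E] [MeasurableSpace E] [BorelSpace E]

theorem hausdorffMeasure_sphere_lt_top {d : ℕ} (hd : finrank ℝ E = d + 1) :
    μH[(d : ℝ)] (sphere (0 : E) 1) < ⊤ := by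
  apply (isCompact_sphere (0 : E) 1).measure_lt_top_of_nhdsWithin
  intro x hx
  have hx1 : ‖x‖ = 1 := by simpa using hx
  have hx0 : x ≠ 0 := by rintro rfl; simp at hx1
  have hfr : finrank ℝ (ℝ ∙ x)ᗮ = d := by
    have : Fact (finrank ℝ E = d + 1) := ⟨hd⟩
    exact finrank_orthogonal_span_singleton hx0
  let ψ : (ℝ ∙ x)ᗮ → E := fun v => ‖x + (v : E)‖⁻¹ • (x + (v : E))
  have hψ : LipschitzWith 2 ψ := by
    apply LipschitzWith.of_dist_le_mul
    intro v w
    rw [dist_eq_norm, dist_eq_norm]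
    have := norm_normalize_sub_le (one_le_norm_add_orth hx1 v) (one_le_norm_add_orth hx1 w)
    refine this.trans_eq ?_
    simp
  refine ⟨ψ '' ball 0 2, ?_, ?_⟩
  · have ho : IsOpen {z : E | 1 / 2 < inner ℝ x z} :=
      isOpen_lt continuous_const (by fun_prop)
    have hxm : x ∈ {z : E | 1 / 2 < inner ℝ x z} := by
      simp [hx1]; norm_num
    filter_upwards [self_mem_nhdsWithin, mem_nhdsWithin_of_mem_nhds (ho.mem_nhds hxm)] with z hz hz2
    obtain ⟨v, hv, hvz⟩ := normalize_orth hx1 (by simpa using hz) hz2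
    exact ⟨v, by simpa using hv, hvz⟩
  · refine (hψ.hausdorffMeasure_image_le (by positivity) _).trans_lt ?_
    apply ENNReal.mul_lt_top
    · apply ENNReal.rpow_lt_top_of_nonneg (by positivity) (by simp)
    · have : (μH[(d : ℝ)] : Measure (ℝ ∙ x)ᗮ).IsAddHaarMeasure := by
        rw [← hfr]; infer_instance
      exact measure_ball_lt_top

theorem hausdorffMeasure_sphere_pos {d : ℕ} (hd : finrank ℝ E = d + 1) :
    0 < μH[(d : ℝ)] (sphere (0 : E) 1) := by
  have : Nontrivial E := nontrivial_of_finrank_pos (R := ℝ) (by omega)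
  obtain ⟨x, hx1⟩ := exists_norm_eq E (zero_le_one)
  have hx0 : x ≠ 0 := by rintro rfl; simp at hx1
  have hfr : finrank ℝ (ℝ ∙ x)ᗮ = d := by
    have : Fact (finrank ℝ E = d + 1) := ⟨hd⟩
    exact finrank_orthogonal_span_singleton hx0
  have : (μH[(d : ℝ)] : Measure (ℝ ∙ x)ᗮ).IsAddHaarMeasure := by
    rw [← hfr]; infer_instance
  have h1 : 0 < μH[(d : ℝ)] (ball (0 : (ℝ ∙ x)ᗮ) 1) := measure_ball_pos _ _ one_pos
  have hL : LipschitzWith 1 ((ℝ ∙ x)ᗮ.orthogonalProjectionOnto) := by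
    have := ((ℝ ∙ x)ᗮ.orthogonalProjectionOnto).lipschitz
    refine this.weaken ?_
    have := (ℝ ∙ x)ᗮ.orthogonalProjectionOnto_norm_le
    exact_mod_cast this
  have h2 : ball (0 : (ℝ ∙ x)ᗮ) 1 ⊆ (ℝ ∙ x)ᗮ.orthogonalProjectionOnto '' sphere (0 : E) 1 := by
    intro v hv
    have hv1 : ‖v‖ < 1 := by simpa using hv
    have hort : inner ℝ x (v : E) = 0 := (mem_orthogonal_singleton_iff_inner_right).1 v.2
    refine ⟨Real.sqrt (1 - ‖v‖ ^ 2) • x + v, ?_, ?_⟩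
    · have h := norm_add_sq_eq_norm_sq_add_norm_sq_of_inner_eq_zero
        (Real.sqrt (1 - ‖v‖ ^ 2) • x) (v : E) (by rw [real_inner_smul_left, hort, mul_zero])
      rw [norm_smul, hx1, mul_one, Real.norm_of_nonneg (Real.sqrt_nonneg _),
        Real.mul_self_sqrt (by nlinarith [norm_nonneg v])] at h
      have e : ‖(v : E)‖ = ‖v‖ := rfl
      rw [e] at h
      simp only [mem_sphere_iff_norm, sub_zero]
      nlinarith [norm_nonneg (Real.sqrt (1 - ‖v‖ ^ 2) • x + (v : E))]
    · rw [map_add, map_smul]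
      rw [orthogonalProjectionOnto_orthogonalComplement_singleton_eq_zero]
      simp
  refine h1.trans_le ((measure_mono h2).trans ?_)
  have := hL.hausdorffMeasure_image_le (d := d) (by positivity) (sphere (0 : E) 1)
  simpa using this

end Sphere

theorem finrank_En (n : ℕ) : Module.finrank ℝ (En n) = 2 * n := by
  rw [finrank_real_of_complex]; simp

theorem hausdorff_Sn {n : ℕ} (hn : 1 ≤ n) :
    0 < μH[(2 * n - 1 : ℝ)] (Sn n) ∧ μH[(2 * n - 1 : ℝ)] (Sn n) < ⊤ := by
  have h : (2 * n - 1 : ℝ) = ((2 * n - 1 : ℕ) : ℝ) := by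
    rw [Nat.cast_sub (by omega)]; simp
  have hd : Module.finrank ℝ (En n) = (2 * n - 1) + 1 := by rw [finrank_En]; omega
  rw [h]
  exact ⟨hausdorffMeasure_sphere_pos hd, hausdorffMeasure_sphere_lt_top hd⟩

theorem measurableSet_Sn (n : ℕ) : MeasurableSet (Sn n) := isClosed_sphere.measurableSet

theorem isProbabilityMeasure_sigmaS {n : ℕ} (hn : 1 ≤ n) : IsProbabilityMeasure (sigmaS n) := by
  constructor
  unfold sigmaS
  rw [Measure.smul_apply, Measure.restrict_apply_univ, smul_eq_mul]
  exact ENNReal.inv_mul_cancel (hausdorff_Sn hn).1.ne' (hausdorff_Sn hn).2.ne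

theorem sigmaS_ae_mem (n : ℕ) : ∀ᵐ ζ ∂(sigmaS n), ζ ∈ Sn n := by
  unfold sigmaS
  apply Measure.ae_smul_measure
  exact ae_restrict_mem (measurableSet_Sn n)

theorem measurePreserving_sigmaS {n : ℕ} (U : En n ≃ₗᵢ[ℂ] En n) :
    MeasurePreserving U (sigmaS n) (sigmaS n) := by
  unfold sigmaS
  have h1 := U.toIsometryEquiv.measurePreserving_hausdorffMeasure (2 * n - 1 : ℝ)
  have h2 := h1.restrict_preimage (measurableSet_Sn n)
  have h3 : U.toIsometryEquiv ⁻¹' (Sn n) = Sn n := by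
    ext z; simp [Sn]
  rw [h3] at h2
  exact h2.smul_measure _

theorem exists_unitary {n : ℕ} {ζ η : En n} (hζ : ‖ζ‖ = 1) (hη : ‖η‖ = 1) :
    ∃ U : En n ≃ₗᵢ[ℂ] En n, U ζ = η := by
  have hn : 0 < n := by
    rcases Nat.eq_zero_or_pos n with rfl | h
    · rw [Subsingleton.elim ζ 0] at hζ; simp at hζ
    · exact h
  let i0 : Fin n := ⟨0, hn⟩
  have key : ∀ ξ : En n, ‖ξ‖ = 1 → ∃ b : OrthonormalBasis (Fin n) ℂ (En n), b i0 = ξ := by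
    intro ξ hξ
    obtain ⟨b, hb⟩ := Orthonormal.exists_orthonormalBasis_extension_of_card_eq (𝕜 := ℂ) (E := En n)
      (ι := Fin n) (by simp) (v := fun _ => ξ) (s := {i0}) (by
        constructor
        · intro i; simpa using hξ
        · intro i j hij; exact absurd (Subsingleton.elim i j) hij)
    exact ⟨b, hb i0 rfl⟩
  obtain ⟨b, hb⟩ := key ζ hζ
  obtain ⟨b', hbη⟩ := key η hη
  refine ⟨b.equiv b' (Equiv.refl _), ?_⟩
  rw [← hb, OrthonormalBasis.equiv_apply_basis]
  simpa using hbη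

/-- Two finite unitarily invariant measures concentrated on the sphere are proportional. -/
theorem rnDeriv_const_of_invariant {n : ℕ} (μ ν : Measure (En n)) [IsFiniteMeasure μ]
    [IsFiniteMeasure ν] (hμν : μ ≪ ν) (hν : ∀ᵐ x ∂ν, x ∈ Sn n)
    (hμi : ∀ U : En n ≃ₗᵢ[ℂ] En n, MeasurePreserving U μ μ)
    (hνi : ∀ U : En n ≃ₗᵢ[ℂ] En n, MeasurePreserving U ν ν) : ∃ c : ℝ≥0∞, μ = c • ν := by
  rcases eq_or_ne ν 0 with rfl | hν0
  · exact ⟨0, by simpa using Measure.absolutelyContinuous_zero_iff.1 hμν⟩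
  have hT := Besicovitch.ae_tendsto_rnDeriv μ ν
  have : (ae ν).NeBot := ae_neBot.2 hν0
  obtain ⟨x, hx, hxS⟩ := (hT.and hν).exists
  have hball : ∀ (m : Measure (En n)), (∀ U : En n ≃ₗᵢ[ℂ] En n, MeasurePreserving U m m) →
      ∀ y ∈ Sn n, ∀ r, m (closedBall y r) = m (closedBall x r) := by
    intro m hm y hy r
    obtain ⟨U, hU⟩ := exists_unitary (ζ := x) (η := y) (by simpa [Sn] using hxS)
      (by simpa [Sn] using hy)
    rw [← (hm U).measure_preimage (isClosed_closedBall.measurableSet.nullMeasurableSet)]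
    congr 1
    rw [← hU]
    exact U.toIsometryEquiv.preimage_closedBall _ _ |>.trans (by simp)
  refine ⟨μ.rnDeriv ν x, ?_⟩
  have hae : μ.rnDeriv ν =ᵐ[ν] fun _ => μ.rnDeriv ν x := by
    filter_upwards [hT, hν] with y hy hyS
    refine tendsto_nhds_unique hy (hx.congr fun r => ?_)
    rw [hball μ hμi y hyS, hball ν hνi y hyS]
  have hdec : μ.HaveLebesgueDecomposition ν :=
    Measure.haveLebesgueDecomposition_of_sigmaFinite μ ν
  calc μ = ν.withDensity (μ.rnDeriv ν) := (Measure.withDensity_rnDeriv_eq μ ν hμν).symm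
    _ = _ := by rw [withDensity_congr_ae hae, withDensity_const]

theorem eq_smul_sigmaS {n : ℕ} (hn : 1 ≤ n) (τ : Measure (En n)) [IsFiniteMeasure τ]
    (hτ : ∀ᵐ x ∂τ, x ∈ Sn n) (hτi : ∀ U : En n ≃ₗᵢ[ℂ] En n, MeasurePreserving U τ τ) :
    τ = τ univ • sigmaS n := by
  have := isProbabilityMeasure_sigmaS hn
  have hsi : ∀ U : En n ≃ₗᵢ[ℂ] En n, MeasurePreserving U (τ + sigmaS n) (τ + sigmaS n) := by
    intro U
    refine ⟨U.continuous.measurable, ?_⟩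
    rw [Measure.map_add _ _ U.continuous.measurable, (hτi U).map_eq,
      (measurePreserving_sigmaS U).map_eq]
  have hS : ∀ᵐ x ∂(τ + sigmaS n), x ∈ Sn n := ae_add_measure_iff.2 ⟨hτ, sigmaS_ae_mem n⟩
  obtain ⟨a, ha⟩ := rnDeriv_const_of_invariant τ (τ + sigmaS n)
    (Measure.AbsolutelyContinuous.rfl.add_right _) hS hτi hsi
  obtain ⟨b, hb⟩ := rnDeriv_const_of_invariant (sigmaS n) (τ + sigmaS n)
    (by rw [add_comm]; exact Measure.AbsolutelyContinuous.rfl.add_right _) hS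
    measurePreserving_sigmaS hsi
  set ρ := τ + sigmaS n with hρ
  have hb1 : b * ρ univ = 1 := by
    have := congrArg (fun m : Measure (En n) => m univ) hb
    simpa using this.symm
  have hρt : ρ univ ≠ ⊤ := measure_ne_top _ _
  have hb0 : ρ = ρ univ • sigmaS n := by
    conv_rhs => rw [hb]
    rw [smul_smul, mul_comm, hb1, one_smul]
  have ha1 : τ univ = a * ρ univ := by
    have := congrArg (fun m : Measure (En n) => m univ) ha
    simpa using this
  rw [ha1]
  conv_lhs => rw [ha, hb0]
  rw [smul_smul]

/-- Lebesgue measure on `ℂⁿ`, transported from the product measure. -/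
def mE (n : ℕ) : Measure (En n) :=
  Measure.map (EuclideanSpace.equiv (Fin n) ℂ).symm volume

instance isAddHaarMeasure_mE (n : ℕ) : (mE n).IsAddHaarMeasure :=
  ContinuousLinearEquiv.isAddHaarMeasure_map (EuclideanSpace.equiv (Fin n) ℂ).symm volume

theorem measurePreserving_mE {n : ℕ} (U : En n ≃ₗᵢ[ℂ] En n) :
    MeasurePreserving U (mE n) (mE n) := by
  refine ⟨U.continuous.measurable, ?_⟩
  have hH : (Measure.map U (mE n)).IsAddHaarMeasure :=
    ContinuousLinearEquiv.isAddHaarMeasure_map U.toContinuousLinearEquiv (mE n)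
  have h := Measure.isAddLeftInvariant_eq_smul (Measure.map U (mE n)) (mE n)
  have hb : Measure.map U (mE n) (ball 0 1) = mE n (ball 0 1) := by
    rw [Measure.map_apply U.continuous.measurable isOpen_ball.measurableSet]
    congr 1
    exact (U.toIsometryEquiv.preimage_ball _ _).trans (by simp)
  have h0 : mE n (ball 0 1) ≠ 0 := (measure_ball_pos _ _ one_pos).ne'
  have ht : mE n (ball 0 1) ≠ ⊤ := measure_ball_lt_top.ne
  set c := (Measure.map U (mE n)).addHaarScalarFactor (mE n)
  have hc : (c : ℝ≥0∞) * mE n (ball 0 1) = 1 * mE n (ball 0 1) := by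
    rw [one_mul]
    nth_rw 2 [← hb]
    rw [h]
    rfl
  have hc1 : c = 1 := by
    exact_mod_cast (ENNReal.mul_left_inj h0 ht).1 hc
  rw [h, hc1, one_smul]

open scoped Pointwise in
theorem map_toSphere_eq {n : ℕ} (hn : 1 ≤ n) :
    ∃ c : ℝ≥0∞, c ≠ 0 ∧ c ≠ ⊤ ∧ Measure.map Subtype.val (mE n).toSphere = c • sigmaS n := by
  set τ := Measure.map (Subtype.val : sphere (0 : En n) 1 → En n) (mE n).toSphere with hτ
  have hme : Measurable (Subtype.val : sphere (0 : En n) 1 → En n) := measurable_subtype_coe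
  have hfin : IsFiniteMeasure τ := by
    rw [hτ]
    infer_instance
  have hS : ∀ᵐ x ∂τ, x ∈ Sn n := by
    rw [hτ, ae_map_iff hme.aemeasurable (p := fun x => x ∈ Sn n) (measurableSet_Sn n)]
    exact Eventually.of_forall fun x => x.2
  have hinv : ∀ U : En n ≃ₗᵢ[ℂ] En n, MeasurePreserving U τ τ := by
    intro U
    refine ⟨U.continuous.measurable, Measure.ext fun s hs => ?_⟩
    rw [Measure.map_apply U.continuous.measurable hs, hτ, Measure.map_apply hme
      (U.continuous.measurable hs), Measure.map_apply hme hs,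
      Measure.toSphere_apply' _ (hme (U.continuous.measurable hs)),
      Measure.toSphere_apply' _ (hme hs)]
    congr 1
    rw [← (measurePreserving_mE U).measure_preimage_emb U.toHomeomorph.measurableEmbedding
      (Ioo (0 : ℝ) 1 • (Subtype.val '' (Subtype.val ⁻¹' s : Set (sphere (0 : En n) 1))))]
    congr 1
    ext x
    simp only [mem_preimage, Set.mem_smul, mem_image, Subtype.exists, exists_and_left,
      exists_prop, mem_sphere_zero_iff_norm]
    constructor
    · rintro ⟨r, hr, y, ⟨z, hz, hz1, rfl⟩, rfl⟩
      exact ⟨r, hr, U z, ⟨U z, hz, by simpa using hz1, rfl⟩, by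
        exact ((U.toLinearEquiv.toLinearMap.restrictScalars ℝ).map_smul r z).symm⟩
    · rintro ⟨r, hr, y, ⟨z, hz, hz1, rfl⟩, hx⟩
      refine ⟨r, hr, U.symm z, ⟨U.symm z, by simpa using hz, by simpa using hz1, rfl⟩, ?_⟩
      rw [← U.symm_apply_apply x, ← hx]
      exact ((U.symm.toLinearEquiv.toLinearMap.restrictScalars ℝ).map_smul r z).symm
  refine ⟨τ univ, ?_, measure_ne_top _ _, eq_smul_sigmaS hn τ hS hinv⟩
  rw [hτ, Measure.map_apply hme MeasurableSet.univ, preimage_univ, Measure.toSphere_apply_univ,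
    finrank_En]
  have h0 : mE n (ball 0 1) ≠ 0 := (measure_ball_pos _ _ one_pos).ne'
  simp only [ne_eq, mul_eq_zero, h0, or_false]
  norm_cast
  omega

/-- Integration in polar coordinates. -/
theorem exists_polar {n : ℕ} (hn : 1 ≤ n) : ∃ c : ℝ≥0∞, c ≠ 0 ∧ c ≠ ⊤ ∧
    ∀ G : En n → ℝ≥0∞, Measurable G → ∫⁻ z, G z ∂(mE n) =
      c * ∫⁻ r in Ioi (0 : ℝ), ENNReal.ofReal (r ^ (2 * n - 1)) *
        ∫⁻ ζ, G (r • ζ) ∂(sigmaS n) := by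
  obtain ⟨c, hc0, hct, hc⟩ := map_toSphere_eq hn
  refine ⟨c, hc0, hct, fun G hG => ?_⟩
  have := isProbabilityMeasure_sigmaS hn
  have hme : Measurable (Subtype.val : sphere (0 : En n) 1 → En n) := measurable_subtype_coe
  have hnt : Nontrivial (En n) := by
    apply Module.nontrivial_of_finrank_pos (R := ℝ)
    rw [finrank_En]
    omega
  have hjm : Measurable fun x : En n × ℝ => G (x.2 • x.1) := hG.comp (by fun_prop)
  have h1 : ∫⁻ z, G z ∂(mE n) = ∫⁻ z : ({(0 : En n)}ᶜ : Set (En n)), G z ∂((mE n).comap (↑)) := by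
    rw [lintegral_subtype_comap (measurableSet_singleton _).compl, restrict_compl_singleton]
  have h2 : ∫⁻ z : ({(0 : En n)}ᶜ : Set (En n)), G z ∂((mE n).comap (↑)) =
      ∫⁻ x : sphere (0 : En n) 1 × Ioi (0 : ℝ), G ((x.2 : ℝ) • (x.1 : En n))
        ∂((mE n).toSphere.prod (Measure.volumeIoiPow (2 * n - 1))) := by
    have hm := (mE n).measurePreserving_homeomorphUnitSphereProd
    rw [finrank_En] at hm
    rw [← hm.lintegral_comp (f := fun x => G ((x.2 : ℝ) • (x.1 : En n)))
      (hG.comp (by fun_prop))]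
    refine lintegral_congr fun z => ?_
    rw [← homeomorphUnitSphereProd_symm_apply_coe, Homeomorph.symm_apply_apply]
  have hjm' : Measurable fun x : sphere (0 : En n) 1 × Ioi (0 : ℝ) =>
      G ((x.2 : ℝ) • (x.1 : En n)) := hG.comp (by fun_prop)
  rw [h1, h2, lintegral_prod_symm _ hjm'.aemeasurable]
  have h3 : ∀ r : ℝ, ∫⁻ x : sphere (0 : En n) 1, G (r • (x : En n)) ∂(mE n).toSphere =
      c * ∫⁻ ζ, G (r • ζ) ∂(sigmaS n) := by
    intro r
    rw [← lintegral_map (f := fun ζ => G (r • ζ)) (hG.comp (by fun_prop)) hme, hc,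
      lintegral_smul_measure, smul_eq_mul]
  simp_rw [h3]
  have hmσ : Measurable fun r : ℝ => ∫⁻ ζ, G (r • ζ) ∂(sigmaS n) :=
    Measurable.lintegral_prod_left' (f := fun x : En n × ℝ => G (x.2 • x.1)) hjm
  rw [Measure.volumeIoiPow, lintegral_withDensity_eq_lintegral_mul _ (by fun_prop) (by fun_prop)]
  simp only [Pi.mul_apply]
  rw [lintegral_subtype_comap measurableSet_Ioi fun r : ℝ => ENNReal.ofReal (r ^ (2 * n - 1)) *
    (c * ∫⁻ ζ, G (r • ζ) ∂(sigmaS n))]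
  rw [← lintegral_const_mul _ (by fun_prop)]
  refine lintegral_congr fun r => ?_
  ring

/-- Multiplication by a unimodular scalar, as a unitary map. -/
def rotE (n : ℕ) (x : TT) : En n ≃ₗᵢ[ℂ] En n where
  toLinearEquiv := LinearEquiv.smulOfNeZero ℂ (En n) (eT x) (by
    intro h
    have := norm_eT x
    simp [h] at this)
  norm_map' z := by
    simp [norm_smul, norm_eT]

theorem measurePreserving_smul_eT {n : ℕ} (x : TT) :
    MeasurePreserving (fun z : En n => eT x • z) (sigmaS n) (sigmaS n) :=
  measurePreserving_sigmaS (rotE n x)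

/-- The Poisson average of a function over the circle orbits. -/
def kop {n : ℕ} (t : ℝ) (u : En n → ℝ≥0∞) (ζ : En n) : ℝ≥0∞ :=
  ∫⁻ x, kT t x * u (eT x • ζ) ∂muT

theorem measurable_smul_eT {n : ℕ} : Measurable fun y : En n × TT => eT y.2 • y.1 := by
  have := continuous_eT
  fun_prop

section
variable {n : ℕ} {s t : ℝ} {u v : En n → ℝ≥0∞}

theorem measurable_kop (ht : 0 ≤ t) (ht1 : t < 1) (hu : Measurable u) :
    Measurable (kop t u) := by
  have hk := (continuous_kT ht ht1).measurable
  refine Measurable.lintegral_prod_right' (f := fun y : En n × TT => kT t y.2 * u (eT y.2 • y.1)) ?_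
  exact (hk.comp measurable_snd).mul (hu.comp measurable_smul_eT)

theorem kop_mono (h : u ≤ v) : kop t u ≤ kop t v := fun ζ =>
  lintegral_mono fun x => by
    gcongr
    exact h _

theorem lintegral_mul_kop (hn : 1 ≤ n) (ht : 0 ≤ t) (ht1 : t < 1) (hu : Measurable u)
    (hv : Measurable v) :
    ∫⁻ ζ, u ζ * kop t v ζ ∂sigmaS n = ∫⁻ ζ, v ζ * kop t u ζ ∂sigmaS n := by
  have := isProbabilityMeasure_sigmaS hn
  have hk := (continuous_kT ht ht1).measurable
  have key : ∀ (u v : En n → ℝ≥0∞), Measurable u → Measurable v →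
      ∫⁻ ζ, u ζ * kop t v ζ ∂sigmaS n =
        ∫⁻ x, kT t x * ∫⁻ ζ, u ζ * v (eT x • ζ) ∂sigmaS n ∂muT := by
    intro u v hu hv
    have h1 : ∀ ζ, u ζ * kop t v ζ = ∫⁻ x, kT t x * (u ζ * v (eT x • ζ)) ∂muT := by
      intro ζ
      have hc : Measurable fun x : TT => kT t x * v (eT x • ζ) :=
        hk.mul (hv.comp (measurable_smul_eT.comp (by fun_prop : Measurable fun x : TT => (ζ, x))))
      rw [kop, ← lintegral_const_mul _ hc]
      exact lintegral_congr fun x => by ring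
    simp_rw [h1]
    rw [lintegral_lintegral_swap]
    · refine lintegral_congr fun x => ?_
      rw [lintegral_const_mul]
      exact hu.mul (hv.comp (by fun_prop))
    · exact ((hk.comp measurable_snd).mul
        ((hu.comp measurable_fst).mul (hv.comp measurable_smul_eT))).aemeasurable
  rw [key u v hu hv, key v u hv hu, ← lintegral_neg_eq_self]
  refine lintegral_congr fun x => ?_
  rw [kT_neg]
  congr 1
  rw [← (measurePreserving_smul_eT x).lintegral_comp
    (f := fun ζ => u ζ * v (eT (-x) • ζ)) (hu.mul (hv.comp (by fun_prop)))]
  refine lintegral_congr fun ζ => ?_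
  rw [smul_smul, ← eT_add, neg_add_cancel, mul_comm]
  simp [eT]

theorem kop_kop (hs : 0 ≤ s) (hs1 : s < 1) (ht : 0 ≤ t) (ht1 : t < 1) (hu : Measurable u) :
    kop t (kop s u) = kop (t * s) u := by
  funext ζ
  have hk := (continuous_kT ht ht1).measurable
  have hk' := (continuous_kT hs hs1).measurable
  have huζ : Measurable fun x : TT => u (eT x • ζ) :=
    hu.comp (measurable_smul_eT.comp (by fun_prop : Measurable fun x : TT => (ζ, x)))
  have h1 : ∀ x, kT t x * kop s u (eT x • ζ) =
      ∫⁻ y, kT t x * kT s (y - x) * u (eT y • ζ) ∂muT := by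
    intro x
    rw [kop, ← lintegral_sub_right_eq_self _ x, ← lintegral_const_mul]
    · refine lintegral_congr fun y => ?_
      rw [smul_smul, ← eT_add, sub_add_cancel, mul_assoc]
    · simp_rw [smul_smul, ← eT_add, sub_add_cancel]
      exact (hk'.comp (measurable_id.sub_const x)).mul huζ
  rw [kop]
  simp_rw [h1]
  rw [lintegral_lintegral_swap]
  · refine lintegral_congr fun y => ?_
    have hm : Measurable fun x : TT => kT t x * kT s (y - x) :=
      hk.mul (hk'.comp (measurable_id.const_sub y))
    rw [lintegral_mul_const _ hm, ← lintegral_kT_mul_kT hs hs1 ht ht1]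
    congr 1
    rw [← lintegral_sub_left_eq_self _ y]
    simp
  · exact ((hk.comp measurable_fst).mul (hk'.comp (measurable_snd.sub measurable_fst))).mul
      (huζ.comp measurable_snd) |>.aemeasurable

theorem kop_mul_le (hs : 0 ≤ s) (hs1 : s < 1) (ht : 0 ≤ t) (ht1 : t < 1) (hu : Measurable u)
    (ζ : En n) : kop (t * s) u ζ ≤ 8 * (kop s u ζ + kop t u ζ) := by
  have hk := (continuous_kT ht ht1).measurable
  have hk' := (continuous_kT hs hs1).measurable
  have huζ : Measurable fun x : TT => u (eT x • ζ) :=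
    hu.comp (measurable_smul_eT.comp (by fun_prop : Measurable fun x : TT => (ζ, x)))
  have hm : Measurable fun x : TT => kT s x * u (eT x • ζ) := hk'.mul huζ
  rw [kop, kop, kop, ← lintegral_add_left hm, ← lintegral_const_mul _ (hm.fun_add (hk.fun_mul huζ))]
  refine lintegral_mono fun x => ?_
  calc kT (t * s) x * u (eT x • ζ) ≤ (8 * (kT s x + kT t x)) * u (eT x • ζ) := by
        gcongr
        exact kT_mul_le hs hs1 ht ht1 x
    _ = _ := by ring

end

theorem lintegral_mul_sq_le {X : Type*} [MeasurableSpace X] (μ : Measure X) {f g : X → ℝ≥0∞}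
    (hf : Measurable f) (hg : Measurable g) :
    (∫⁻ x, f x * g x ∂μ) ^ 2 ≤ (∫⁻ x, f x ^ 2 ∂μ) * ∫⁻ x, g x ^ 2 ∂μ := by
  have h := ENNReal.lintegral_mul_le_Lp_mul_Lq μ Real.HolderConjugate.two_two hf.aemeasurable
    hg.aemeasurable
  simp only [Pi.mul_apply, ENNReal.rpow_two] at h
  calc (∫⁻ x, f x * g x ∂μ) ^ 2 ≤
        ((∫⁻ x, f x ^ 2 ∂μ) ^ (1 / 2 : ℝ) * (∫⁻ x, g x ^ 2 ∂μ) ^ (1 / 2 : ℝ)) ^ 2 := by gcongr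
    _ = _ := by
        rw [mul_pow, ← ENNReal.rpow_two, ← ENNReal.rpow_two, ← ENNReal.rpow_mul,
          ← ENNReal.rpow_mul]
        norm_num

section
variable {n : ℕ} {t : ℝ} {u v : En n → ℝ≥0∞}

theorem exists_lintegral_kop_sq_le (hn : 1 ≤ n) (ht : 0 ≤ t) (ht1 : t < 1) :
    ∃ B : ℝ≥0, ∀ u : En n → ℝ≥0∞, Measurable u →
      ∫⁻ ζ, kop t u ζ ^ 2 ∂sigmaS n ≤ B * ∫⁻ ζ, u ζ ^ 2 ∂sigmaS n := by
  have := isProbabilityMeasure_sigmaS hn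
  obtain ⟨M, hM⟩ : ∃ M : ℝ≥0, ∀ x, kT t x ≤ M := by
    obtain ⟨b, hb⟩ := (isCompact_range (continuous_kr ht ht1)).bddAbove
    exact ⟨b.toNNReal, fun x => ENNReal.ofReal_le_ofReal (hb (mem_range_self x))⟩
  refine ⟨M ^ 2, fun u hu => ?_⟩
  have h1 : ∀ ζ, kop t u ζ ^ 2 ≤ (M : ℝ≥0∞) ^ 2 * ∫⁻ x, u (eT x • ζ) ^ 2 ∂muT := by
    intro ζ
    have huζ : Measurable fun x : TT => u (eT x • ζ) :=
      hu.comp (measurable_smul_eT.comp (by fun_prop : Measurable fun x : TT => (ζ, x)))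
    have := lintegral_mul_sq_le muT huζ (measurable_const (a := (M : ℝ≥0∞)))
    rw [lintegral_const, measure_univ, mul_one, mul_comm _ ((M : ℝ≥0∞) ^ 2)] at this
    refine le_trans ?_ this
    unfold kop
    refine pow_le_pow_left' (lintegral_mono fun x => ?_) 2
    rw [mul_comm]
    gcongr
    exact hM x
  have hm : Measurable fun y : En n × TT => u (eT y.2 • y.1) ^ 2 :=
    (hu.comp measurable_smul_eT).pow_const 2
  calc ∫⁻ ζ, kop t u ζ ^ 2 ∂sigmaS n
      ≤ ∫⁻ ζ, (M : ℝ≥0∞) ^ 2 * ∫⁻ x, u (eT x • ζ) ^ 2 ∂muT ∂sigmaS n := lintegral_mono h1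
    _ = (M : ℝ≥0∞) ^ 2 * ∫⁻ x, ∫⁻ ζ, u (eT x • ζ) ^ 2 ∂sigmaS n ∂muT := by
        rw [lintegral_const_mul _ hm.lintegral_prod_right',
          lintegral_lintegral_swap hm.aemeasurable]
    _ = _ := by
        have : ∀ x : TT, ∫⁻ ζ, u (eT x • ζ) ^ 2 ∂sigmaS n = ∫⁻ ζ, u ζ ^ 2 ∂sigmaS n := fun x =>
          (measurePreserving_smul_eT x).lintegral_comp (hu.pow_const 2)
        simp [this]

/-- A finite linearization of the maximal operator. -/
def lop {n : ℕ} (T : Finset ℝ) (φ : ℝ → En n → ℝ≥0∞) (u : En n → ℝ≥0∞) (ζ : En n) : ℝ≥0∞ :=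
  ∑ t ∈ T, φ t ζ * kop t u ζ

/-- The formal adjoint of `lop`. -/
def lopAdj {n : ℕ} (T : Finset ℝ) (φ : ℝ → En n → ℝ≥0∞) (v : En n → ℝ≥0∞) (ζ : En n) : ℝ≥0∞ :=
  ∑ t ∈ T, kop t (fun z => φ t z * v z) ζ

variable {T : Finset ℝ} {φ : ℝ → En n → ℝ≥0∞}

theorem measurable_lop (hT : ∀ t ∈ T, 0 ≤ t ∧ t < 1) (hφ : ∀ t, Measurable (φ t))
    (hu : Measurable u) : Measurable (lop T φ u) :=
  Finset.measurable_fun_sum _ fun t ht =>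
    (hφ t).mul (measurable_kop (hT t ht).1 (hT t ht).2 hu)

theorem measurable_lopAdj (hT : ∀ t ∈ T, 0 ≤ t ∧ t < 1) (hφ : ∀ t, Measurable (φ t))
    (hu : Measurable u) : Measurable (lopAdj T φ u) :=
  Finset.measurable_fun_sum _ fun t ht =>
    measurable_kop (hT t ht).1 (hT t ht).2 ((hφ t).mul hu)

theorem lintegral_mul_lop (hn : 1 ≤ n) (hT : ∀ t ∈ T, 0 ≤ t ∧ t < 1) (hφ : ∀ t, Measurable (φ t))
    (hu : Measurable u) (hv : Measurable v) :
    ∫⁻ ζ, v ζ * lop T φ u ζ ∂sigmaS n = ∫⁻ ζ, u ζ * lopAdj T φ v ζ ∂sigmaS n := by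
  simp only [lop, lopAdj, Finset.mul_sum]
  rw [lintegral_finsetSum _ fun t ht =>
      hv.fun_mul ((hφ t).fun_mul (measurable_kop (hT t ht).1 (hT t ht).2 hu)),
    lintegral_finsetSum _ fun t ht =>
      hu.fun_mul (measurable_kop (hT t ht).1 (hT t ht).2 ((hφ t).fun_mul hv))]
  refine Finset.sum_congr rfl fun t ht => ?_
  rw [lintegral_mul_kop hn (hT t ht).1 (hT t ht).2 hu ((hφ t).fun_mul hv)]
  exact lintegral_congr fun ζ => by ring

theorem kop_sum {ι : Type*} (s : Finset ι) (ht : 0 ≤ t) (ht1 : t < 1) {w : ι → En n → ℝ≥0∞}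
    (hw : ∀ i, Measurable (w i)) (ζ : En n) :
    kop t (fun z => ∑ i ∈ s, w i z) ζ = ∑ i ∈ s, kop t (w i) ζ := by
  have hk := (continuous_kT ht ht1).measurable
  simp only [kop, Finset.mul_sum]
  exact lintegral_finsetSum _ fun i _ => hk.mul ((hw i).comp
    (measurable_smul_eT.comp (by fun_prop : Measurable fun x : TT => (ζ, x))))

theorem lop_lopAdj_le (hT : ∀ t ∈ T, 0 ≤ t ∧ t < 1) (hφ : ∀ t, Measurable (φ t))
    (hφ1 : ∀ ζ, ∑ t ∈ T, φ t ζ ≤ 1) (hv : Measurable v) (ζ : En n) :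
    lop T φ (lopAdj T φ v) ζ ≤ 8 * (lop T φ v ζ + lopAdj T φ v ζ) := by
  have hmv : ∀ t, Measurable fun z => φ t z * v z := fun t => (hφ t).mul hv
  calc lop T φ (lopAdj T φ v) ζ
      = ∑ s ∈ T, φ s ζ * ∑ t ∈ T, kop (s * t) (fun z => φ t z * v z) ζ := by
        refine Finset.sum_congr rfl fun s hs => ?_
        congr 1
        have : kop s (lopAdj T φ v) ζ = ∑ t ∈ T.attach, kop s (kop t (fun z => φ t z * v z)) ζ := by
          rw [← kop_sum (w := fun t : T => kop t.1 (fun z => φ t z * v z)) _ (hT s hs).1 (hT s hs).2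
            fun t => measurable_kop (hT t t.2).1 (hT t t.2).2 (hmv t)]
          congr 1
          funext z
          exact (Finset.sum_attach T fun t => kop t (fun z => φ t z * v z) z).symm
        rw [this, Finset.sum_attach T fun t => kop s (kop t (fun z => φ t z * v z)) ζ]
        refine Finset.sum_congr rfl fun t ht => ?_
        rw [kop_kop (hT t ht).1 (hT t ht).2 (hT s hs).1 (hT s hs).2 (hmv t)]
    _ ≤ ∑ s ∈ T, φ s ζ * ∑ t ∈ T, 8 * (kop s (fun z => φ t z * v z) ζ +
          kop t (fun z => φ t z * v z) ζ) := by
        gcongr with s hs t ht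
        rw [add_comm]
        exact kop_mul_le (hT t ht).1 (hT t ht).2 (hT s hs).1 (hT s hs).2 (hmv t) ζ
    _ = 8 * (∑ s ∈ T, φ s ζ * ∑ t ∈ T, kop s (fun z => φ t z * v z) ζ +
          (∑ s ∈ T, φ s ζ) * lopAdj T φ v ζ) := by
        rw [Finset.sum_mul, ← Finset.sum_add_distrib, Finset.mul_sum]
        refine Finset.sum_congr rfl fun s hs => ?_
        rw [← Finset.mul_sum, Finset.sum_add_distrib, lopAdj]
        ring
    _ ≤ 8 * (lop T φ v ζ + 1 * lopAdj T φ v ζ) := by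
        gcongr
        · unfold lop
          gcongr with s hs
          rw [← kop_sum _ (hT s hs).1 (hT s hs).2 hmv]
          refine kop_mono (fun z => ?_) ζ
          rw [← Finset.sum_mul]
          exact (mul_le_mul_left (hφ1 z) _).trans_eq (one_mul _)
        · exact hφ1 ζ
    _ = _ := by rw [one_mul]

theorem lintegral_lopAdj_sq_le (hn : 1 ≤ n) (hT : ∀ t ∈ T, 0 ≤ t ∧ t < 1)
    (hφ : ∀ t, Measurable (φ t)) (hφ1 : ∀ ζ, ∑ t ∈ T, φ t ζ ≤ 1) (hv : Measurable v) :
    (∫⁻ ζ, lopAdj T φ v ζ ^ 2 ∂sigmaS n) ^ 2 ≤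
      256 * ((∫⁻ ζ, v ζ ^ 2 ∂sigmaS n) * ∫⁻ ζ, lop T φ v ζ ^ 2 ∂sigmaS n) := by
  have hA := measurable_lopAdj hT hφ hv
  have hL := measurable_lop hT hφ hv
  have h : ∫⁻ ζ, lopAdj T φ v ζ ^ 2 ∂sigmaS n ≤ 16 * ∫⁻ ζ, v ζ * lop T φ v ζ ∂sigmaS n := by
    calc ∫⁻ ζ, lopAdj T φ v ζ ^ 2 ∂sigmaS n = ∫⁻ ζ, v ζ * lop T φ (lopAdj T φ v) ζ ∂sigmaS n := by
          rw [lintegral_mul_lop hn hT hφ hA hv]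
          exact lintegral_congr fun ζ => sq _
      _ ≤ ∫⁻ ζ, 8 * (v ζ * lop T φ v ζ + v ζ * lopAdj T φ v ζ) ∂sigmaS n := by
          refine lintegral_mono fun ζ => ?_
          calc _ ≤ v ζ * (8 * (lop T φ v ζ + lopAdj T φ v ζ)) := by
                gcongr
                exact lop_lopAdj_le hT hφ hφ1 hv ζ
            _ = _ := by ring
      _ = _ := by
          rw [lintegral_const_mul _ ((hv.fun_mul hL).fun_add (hv.fun_mul hA)),
            lintegral_add_left (hv.fun_mul hL),
            ← lintegral_mul_lop hn hT hφ hv hv]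
          ring
  calc _ ≤ (16 * ∫⁻ ζ, v ζ * lop T φ v ζ ∂sigmaS n) ^ 2 := by gcongr
    _ = 256 * (∫⁻ ζ, v ζ * lop T φ v ζ ∂sigmaS n) ^ 2 := by rw [mul_pow]; norm_num
    _ ≤ _ := by
        gcongr
        exact lintegral_mul_sq_le _ hv hL

theorem exists_lintegral_lop_sq_le (hn : 1 ≤ n) (hT : ∀ t ∈ T, 0 ≤ t ∧ t < 1)
    (hφ1 : ∀ ζ, ∑ t ∈ T, φ t ζ ≤ 1) :
    ∃ B : ℝ≥0, ∀ u : En n → ℝ≥0∞, Measurable u →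
      ∫⁻ ζ, lop T φ u ζ ^ 2 ∂sigmaS n ≤ B * ∫⁻ ζ, u ζ ^ 2 ∂sigmaS n := by
  have hB : ∀ t, ∃ B : ℝ≥0, t ∈ T → ∀ u : En n → ℝ≥0∞, Measurable u →
      ∫⁻ ζ, kop t u ζ ^ 2 ∂sigmaS n ≤ B * ∫⁻ ζ, u ζ ^ 2 ∂sigmaS n := by
    intro t
    by_cases ht : t ∈ T
    · obtain ⟨B, hB⟩ := exists_lintegral_kop_sq_le hn (hT t ht).1 (hT t ht).2
      exact ⟨B, fun _ => hB⟩
    · exact ⟨0, fun h => absurd h ht⟩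
  choose B hB using hB
  refine ⟨∑ t ∈ T, B t, fun u hu => ?_⟩
  have hpt : ∀ ζ, lop T φ u ζ ^ 2 ≤ ∑ t ∈ T, kop t u ζ ^ 2 := by
    intro ζ
    obtain rfl | hne := T.eq_empty_or_nonempty
    · simp [lop]
    obtain ⟨t, ht, hmax⟩ := T.exists_max_image (fun t => kop t u ζ) hne
    calc lop T φ u ζ ^ 2 ≤ (∑ s ∈ T, φ s ζ * kop t u ζ) ^ 2 := by
          unfold lop
          gcongr with s hs
          exact hmax s hs
      _ ≤ (1 * kop t u ζ) ^ 2 := by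
          rw [← Finset.sum_mul]
          gcongr
          exact hφ1 ζ
      _ ≤ _ := by
          rw [one_mul]
          exact Finset.single_le_sum (f := fun t => kop t u ζ ^ 2) (fun _ _ => zero_le) ht
  calc _ ≤ ∫⁻ ζ, ∑ t ∈ T, kop t u ζ ^ 2 ∂sigmaS n := lintegral_mono hpt
    _ = ∑ t ∈ T, ∫⁻ ζ, kop t u ζ ^ 2 ∂sigmaS n := lintegral_finsetSum _ fun t ht =>
        (measurable_kop (hT t ht).1 (hT t ht).2 hu).pow_const 2
    _ ≤ ∑ t ∈ T, B t * ∫⁻ ζ, u ζ ^ 2 ∂sigmaS n := by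
        gcongr with t ht
        exact hB t ht u hu
    _ = _ := by rw [← Finset.sum_mul]; norm_cast

theorem lintegral_lop_sq_le_improve (hn : 1 ≤ n) (hT : ∀ t ∈ T, 0 ≤ t ∧ t < 1)
    (hφ : ∀ t, Measurable (φ t)) (hφ1 : ∀ ζ, ∑ t ∈ T, φ t ζ ≤ 1) {B : ℝ≥0}
    (hB : ∀ u : En n → ℝ≥0∞, Measurable u →
      ∫⁻ ζ, lop T φ u ζ ^ 2 ∂sigmaS n ≤ B * ∫⁻ ζ, u ζ ^ 2 ∂sigmaS n)
    (u : En n → ℝ≥0∞) (hu : Measurable u) :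
    ∫⁻ ζ, lop T φ u ζ ^ 2 ∂sigmaS n ≤ (16 * NNReal.sqrt B : ℝ≥0) * ∫⁻ ζ, u ζ ^ 2 ∂sigmaS n := by
  have hL := measurable_lop hT hφ hu
  have hA := measurable_lopAdj hT hφ hL
  set N := ∫⁻ ζ, u ζ ^ 2 ∂sigmaS n with hN
  set A := ∫⁻ ζ, lop T φ u ζ ^ 2 ∂sigmaS n with hAdef
  set D := ∫⁻ ζ, lopAdj T φ (lop T φ u) ζ ^ 2 ∂sigmaS n with hD
  have h1 : A ^ 2 ≤ N * D := by
    have : A = ∫⁻ ζ, u ζ * lopAdj T φ (lop T φ u) ζ ∂sigmaS n := by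
      rw [← lintegral_mul_lop hn hT hφ hu hL]
      exact lintegral_congr fun ζ => sq _
    rw [this]
    exact lintegral_mul_sq_le _ hu hA
  have h2 : D ^ 2 ≤ 256 * (A * (B * A)) := by
    refine (lintegral_lopAdj_sq_le hn hT hφ hφ1 hL).trans ?_
    gcongr
    exact hB _ hL
  rcases eq_or_ne A 0 with hA0 | hA0
  · rw [hA0]; exact zero_le
  have hAN : A ≤ B * N := hB u hu
  rcases eq_or_ne N ⊤ with hNt | hNt
  · rcases eq_or_ne B 0 with rfl | hB0
    · simp at hAN; exact absurd hAN hA0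
    rw [hNt, ENNReal.mul_top]
    · exact le_top
    · simpa using hB0
  have hAt : A ≠ ⊤ := ne_top_of_le_ne_top (ENNReal.mul_ne_top ENNReal.coe_ne_top hNt) hAN
  have h3 : A ^ 2 * A ^ 2 ≤ ((16 * NNReal.sqrt B : ℝ≥0) * N) ^ 2 * A ^ 2 := by
    calc A ^ 2 * A ^ 2 ≤ (N * D) * (N * D) := by gcongr
      _ = N ^ 2 * D ^ 2 := by ring
      _ ≤ N ^ 2 * (256 * (A * (B * A))) := by gcongr
      _ = _ := by
          have : ((16 * NNReal.sqrt B : ℝ≥0) : ℝ≥0∞) ^ 2 = 256 * B := by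
            norm_cast
            rw [mul_pow, NNReal.sq_sqrt]
            norm_num
          rw [mul_pow, this]
          ring
  have h4 := (ENNReal.mul_le_mul_iff_left (by positivity) (ENNReal.pow_ne_top hAt)).1 h3
  exact (ENNReal.pow_le_pow_left_iff two_ne_zero).1 h4

theorem lintegral_lop_sq_le (hn : 1 ≤ n) (hT : ∀ t ∈ T, 0 ≤ t ∧ t < 1)
    (hφ : ∀ t, Measurable (φ t)) (hφ1 : ∀ ζ, ∑ t ∈ T, φ t ζ ≤ 1) (hu : Measurable u) :
    ∫⁻ ζ, lop T φ u ζ ^ 2 ∂sigmaS n ≤ 257 * ∫⁻ ζ, u ζ ^ 2 ∂sigmaS n := by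
  set V : Set ℝ≥0 := {B | ∀ u : En n → ℝ≥0∞, Measurable u →
      ∫⁻ ζ, lop T φ u ζ ^ 2 ∂sigmaS n ≤ B * ∫⁻ ζ, u ζ ^ 2 ∂sigmaS n} with hV
  have hne : V.Nonempty := exists_lintegral_lop_sq_le hn hT hφ1
  have hstep : ∀ B ∈ V, 16 * NNReal.sqrt B ∈ V := fun B hB =>
    lintegral_lop_sq_le_improve hn hT hφ hφ1 hB
  have h1 : ∀ B ∈ V, (sInf V) ^ 2 / 256 ≤ B := by
    intro B hB
    have : sInf V ≤ 16 * NNReal.sqrt B := csInf_le (OrderBot.bddBelow _) (hstep B hB)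
    rw [div_le_iff₀ (by norm_num)]
    calc (sInf V) ^ 2 ≤ (16 * NNReal.sqrt B) ^ 2 := by gcongr
      _ = _ := by rw [mul_pow, NNReal.sq_sqrt]; ring
  have h2 : (sInf V) ^ 2 / 256 ≤ sInf V := le_csInf hne h1
  have h3 : sInf V < 257 := by
    by_contra! h
    rw [div_le_iff₀ (by norm_num), sq] at h2
    have h5 := le_of_mul_le_mul_left h2 (lt_of_lt_of_le (by norm_num) h)
    exact absurd (h.trans h5) (by norm_num)
  obtain ⟨B, hB, hB1⟩ := exists_lt_of_csInf_lt hne h3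
  refine (hB u hu).trans ?_
  gcongr
  exact_mod_cast hB1.le

end

theorem exists_weights_sup_le {X : Type*} [MeasurableSpace X] (h : ℝ → X → ℝ≥0∞) (T : Finset ℝ)
    (hh : ∀ t ∈ T, Measurable (h t)) :
    ∃ φ : ℝ → X → ℝ≥0∞, (∀ t, Measurable (φ t)) ∧ (∀ x, ∑ t ∈ T, φ t x ≤ 1) ∧
      ∀ x, ∀ t ∈ T, h t x ≤ ∑ s ∈ T, φ s x * h s x := by
  classical
  induction T using Finset.induction_on with
  | empty => exact ⟨fun _ _ => 0, fun _ => measurable_const, by simp, by simp⟩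
  | insert a T ha ih =>
    obtain ⟨φ, hφ, hφ1, hφ2⟩ := ih fun t ht => hh t (Finset.mem_insert_of_mem ht)
    have hS : Measurable fun x => ∑ s ∈ T, φ s x * h s x :=
      Finset.measurable_fun_sum _ fun s hs => (hφ s).mul (hh s (Finset.mem_insert_of_mem hs))
    have hA : MeasurableSet {x | ∑ s ∈ T, φ s x * h s x ≤ h a x} :=
      measurableSet_le hS (hh a (Finset.mem_insert_self _ _))
    set A := {x | ∑ s ∈ T, φ s x * h s x ≤ h a x} with hAdef
    have hne : ∀ s ∈ T, s ≠ a := fun s hs h => ha (h ▸ hs)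
    refine ⟨fun t x => if t = a then A.indicator 1 x else Aᶜ.indicator (φ t) x, ?_, ?_, ?_⟩
    · intro t
      by_cases hta : t = a
      · simpa [hta] using measurable_one.indicator hA
      · simpa [hta] using (hφ t).indicator hA.compl
    · intro x
      rw [Finset.sum_insert ha, Finset.sum_congr rfl fun s hs => if_neg (hne s hs)]
      by_cases hx : x ∈ A
      · simp [hx]
      · simpa [hx] using hφ1 x
    · intro x t ht
      have hsum : ∑ s ∈ T, (if s = a then A.indicator 1 x else Aᶜ.indicator (φ s) x) * h s x =
          ∑ s ∈ T, Aᶜ.indicator (φ s) x * h s x :=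
        Finset.sum_congr rfl fun s hs => by rw [if_neg (hne s hs)]
      rw [Finset.sum_insert ha, hsum]
      by_cases hx : x ∈ A
      · have hxa : ∑ s ∈ T, φ s x * h s x ≤ h a x := hx
        rcases Finset.mem_insert.1 ht with rfl | ht
        · simp [hx]
        · simpa [hx] using (hφ2 x t ht).trans hxa
      · have hxa : h a x ≤ ∑ s ∈ T, φ s x * h s x := (not_le.1 hx).le
        rcases Finset.mem_insert.1 ht with rfl | ht
        · simpa [hx] using hxa
        · simpa [hx] using hφ2 x t ht

theorem lintegral_iSup_kop_sq_le {n : ℕ} (hn : 1 ≤ n) {u : En n → ℝ≥0∞} (hu : Measurable u)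
    (d : ℕ → ℝ) (hd : ∀ i, 0 ≤ d i ∧ d i < 1) :
    ∫⁻ ζ, (⨆ i, kop (d i) u ζ) ^ 2 ∂sigmaS n ≤ 257 * ∫⁻ ζ, u ζ ^ 2 ∂sigmaS n := by
  classical
  set S : ℕ → En n → ℝ≥0∞ := fun N ζ => ((Finset.range N).sup fun i => kop (d i) u ζ) ^ 2 with hS
  have hkm : ∀ i, Measurable (kop (d i) u) := fun i => measurable_kop (hd i).1 (hd i).2 hu
  have h1 : ∀ ζ, (⨆ i, kop (d i) u ζ) ^ 2 = ⨆ N, S N ζ := by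
    intro ζ
    rw [hS, ← ENNReal.iSup_pow]
    congr 1
    refine le_antisymm (iSup_le fun i => ?_) (iSup_le fun N => ?_)
    · exact le_iSup_of_le (i + 1) (Finset.le_sup (f := fun i => kop (d i) u ζ) (by simp))
    · exact Finset.sup_le fun i _ => le_iSup (fun i => kop (d i) u ζ) i
  have hSm : ∀ N, Measurable (S N) := fun N =>
    Measurable.pow_const (by
      simp only [Finset.sup_eq_iSup]
      exact Measurable.iSup fun i => Measurable.iSup fun _ => hkm i) 2
  simp_rw [h1]
  rw [lintegral_iSup hSm]
  · refine iSup_le fun N => ?_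
    have hT : ∀ t ∈ (Finset.range N).image d, 0 ≤ t ∧ t < 1 := by
      simp only [Finset.mem_image]
      rintro t ⟨i, -, rfl⟩
      exact hd i
    obtain ⟨φ, hφ, hφ1, hφ2⟩ := exists_weights_sup_le (fun t => kop t u)
      ((Finset.range N).image d) fun t ht => measurable_kop (hT t ht).1 (hT t ht).2 hu
    refine le_trans (lintegral_mono fun ζ => ?_) (lintegral_lop_sq_le hn hT hφ hφ1 hu)
    exact pow_le_pow_left' (Finset.sup_le fun i hi => hφ2 ζ _ (Finset.mem_image_of_mem d hi)) 2
  · intro N M hNM ζ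
    exact pow_le_pow_left' (Finset.sup_mono (Finset.range_subset_range.2 hNM)) 2

/-- The `p`-th power of the Hardy quasinorm. -/
def hPow (n : ℕ) (p : ℝ) (f : En n → ℂ) : ℝ≥0∞ :=
  ⨆ r ∈ Ioo (0 : ℝ) 1, ∫⁻ ζ, ‖f (r • ζ)‖ₑ ^ p ∂(sigmaS n)

theorem lintegral_le_hPow {n : ℕ} {p r : ℝ} (hr : r ∈ Ioo (0 : ℝ) 1) (f : En n → ℂ) :
    ∫⁻ ζ, ‖f (r • ζ)‖ₑ ^ p ∂(sigmaS n) ≤ hPow n p f :=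
  le_iSup₂ (f := fun r (_ : r ∈ Ioo (0 : ℝ) 1) => ∫⁻ ζ, ‖f (r • ζ)‖ₑ ^ p ∂(sigmaS n)) r hr

theorem hNorm_eq (n : ℕ) (p : ℝ) (f : En n → ℂ) : hNorm n p f = hPow n p f ^ (1 / p) := rfl

theorem hPow_eq {n : ℕ} {p : ℝ} (hp : 0 < p) (f : En n → ℂ) : hPow n p f = hNorm n p f ^ p := by
  rw [hNorm_eq, ← ENNReal.rpow_mul, one_div_mul_cancel hp.ne', ENNReal.rpow_one]

theorem slice_differentiableOn {n : ℕ} {f : En n → ℂ} (hf : DifferentiableOn ℂ f (Bn n))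
    {ζ : En n} (hζ : ‖ζ‖ = 1) : DifferentiableOn ℂ (fun l : ℂ => f (l • ζ)) (ball 0 1) := by
  refine hf.comp (by fun_prop) fun l hl => ?_
  simpa [Bn, norm_smul, hζ] using hl

theorem lintegral_iSup_dilate_le {n : ℕ} (hn : 1 ≤ n) {p : ℝ} (hp : 0 < p) {f : En n → ℂ}
    (hf : DifferentiableOn ℂ f (Bn n)) (hfm : Measurable f) {ρ : ℝ} (hρ : ρ ∈ Ioo (0 : ℝ) 1)
    (d : ℕ → ℝ) (hd : ∀ i, 0 ≤ d i ∧ d i < 1) :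
    ∫⁻ ζ, (⨆ i, ‖f ((ρ * d i) • ζ)‖ₑ ^ p) ∂sigmaS n ≤ 257 * hPow n p f := by
  set u : En n → ℝ≥0∞ := fun ζ => ‖f (ρ • ζ)‖ₑ ^ (p / 2) with hudef
  have hu : Measurable u := (hfm.comp (by fun_prop)).enorm.pow_const _
  have husq : ∀ z : ℂ, (‖z‖ₑ ^ (p / 2)) ^ 2 = ‖z‖ₑ ^ p := by
    intro z
    rw [← ENNReal.rpow_two, ← ENNReal.rpow_mul]
    norm_num
  calc ∫⁻ ζ, (⨆ i, ‖f ((ρ * d i) • ζ)‖ₑ ^ p) ∂sigmaS n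
      ≤ ∫⁻ ζ, (⨆ i, kop (d i) u ζ) ^ 2 ∂sigmaS n := by
        refine lintegral_mono_ae ?_
        filter_upwards [sigmaS_ae_mem n] with ζ hζ
        have hζ1 : ‖ζ‖ = 1 := by simpa [Sn] using hζ
        refine iSup_le fun i => ?_
        rw [← husq]
        refine pow_le_pow_left' (le_iSup_of_le i ?_) 2
        have := enorm_rpow_le_lintegral_kT (s := p / 2) (by positivity) hρ.1 hρ.2
          (slice_differentiableOn hf hζ1) (hd i).1 (hd i).2
        refine le_trans (le_of_eq ?_) (this.trans (le_of_eq ?_))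
        · congr 3
          rw [← Complex.ofReal_mul]
          exact (Complex.coe_smul _ _).symm
        · refine lintegral_congr fun x => ?_
          simp only [hudef]
          rw [mul_smul]
          rfl
    _ ≤ 257 * ∫⁻ ζ, u ζ ^ 2 ∂sigmaS n := lintegral_iSup_kop_sq_le hn hu d hd
    _ ≤ _ := by
        gcongr
        simp only [hudef, husq]
        exact lintegral_le_hPow hρ f

/-- The radial maximal function. -/
def radMax {n : ℕ} (f : En n → ℂ) (ζ : En n) : ℝ≥0∞ := ⨆ t ∈ Ioo (0 : ℝ) 1, ‖f (t • ζ)‖ₑ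

/-- The Hardy-Littlewood radial maximal theorem. -/
theorem lintegral_radMax_le {n : ℕ} (hn : 1 ≤ n) {p : ℝ} (hp : 0 < p) {f : En n → ℂ}
    (hf : DifferentiableOn ℂ f (Bn n)) (hfm : Measurable f) :
    ∫⁻ ζ, radMax f ζ ^ p ∂sigmaS n ≤ 257 * hPow n p f := by
  have : Nonempty (Ioo (0 : ℝ) 1) := ⟨⟨1 / 2, by norm_num, by norm_num⟩⟩
  obtain ⟨d, hd⟩ := TopologicalSpace.exists_dense_seq (Ioo (0 : ℝ) 1)
  set ρ : ℕ → ℝ := fun k => 1 - 1 / ((k : ℝ) + 2) with hρdef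
  have hρ : ∀ k, ρ k ∈ Ioo (0 : ℝ) 1 := by
    intro k
    have h2 : (0 : ℝ) < k + 2 := by positivity
    constructor
    · have : 1 / ((k : ℝ) + 2) < 1 := by
        rw [div_lt_one h2]
        have : (0 : ℝ) ≤ k := k.cast_nonneg
        linarith
      simp only [hρdef]
      linarith
    · have : 0 < 1 / ((k : ℝ) + 2) := by positivity
      simp only [hρdef]
      linarith
  have hρt : Tendsto ρ atTop (𝓝 1) := by
    have h := (tendsto_one_div_add_atTop_nhds_zero_nat (𝕜 := ℝ)).comp (tendsto_add_atTop_nat 1)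
    have h2 := h.const_sub 1
    simp only [sub_zero] at h2
    refine h2.congr fun k => ?_
    simp only [Function.comp, hρdef]
    push_cast
    ring_nf
  set b : ℕ → En n → ℝ≥0∞ := fun k ζ => ⨆ i, ‖f ((ρ k * d i) • ζ)‖ₑ ^ p with hb
  have hbm : ∀ k, Measurable (b k) := fun k =>
    Measurable.iSup fun i => (hfm.comp (by fun_prop)).enorm.pow_const _
  have key : ∀ ζ ∈ Sn n, radMax f ζ ^ p ≤ liminf (fun k => b k ζ) atTop := by
    intro ζ hζ
    have hζ1 : ‖ζ‖ = 1 := by simpa [Sn] using hζ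
    have hcont : ContinuousOn (fun t : ℝ => ‖f (t • ζ)‖ₑ ^ p) (Ioo 0 1) := by
      have h1 : ContinuousOn (fun t : ℝ => f (t • ζ)) (Ioo 0 1) :=
        hf.continuousOn.comp (by fun_prop) fun t ht => by
          simpa [Bn, norm_smul, hζ1, abs_of_pos ht.1] using ht.2
      exact (ENNReal.continuous_rpow_const (y := p)).comp_continuousOn h1.enorm
    have hpt : ∀ t ∈ Ioo (0 : ℝ) 1, ‖f (t • ζ)‖ₑ ^ p ≤ liminf (fun k => b k ζ) atTop := by
      intro t ht
      refine le_of_forall_lt fun c hc => ?_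
      obtain ⟨c', hcc, hc'⟩ := exists_between hc
      refine hcc.trans_le (le_liminf_of_le (by isBoundedDefault) ?_)
      have hU : IsOpen {s : ℝ | s ∈ Ioo (0 : ℝ) 1 ∧ c' < ‖f (s • ζ)‖ₑ ^ p} :=
        hcont.isOpen_inter_preimage isOpen_Ioo isOpen_Ioi
      have htend : Tendsto (fun k => (ρ k)⁻¹ * t) atTop (𝓝 t) := by
        simpa using (hρt.inv₀ one_ne_zero).mul_const t
      filter_upwards [htend.eventually (isOpen_Ioo.mem_nhds ht)] with k hk
      have hV : IsOpen {s : Ioo (0 : ℝ) 1 | ρ k * (s : ℝ) ∈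
          {s : ℝ | s ∈ Ioo (0 : ℝ) 1 ∧ c' < ‖f (s • ζ)‖ₑ ^ p}} :=
        hU.preimage (by fun_prop)
      obtain ⟨i, hi⟩ := hd.exists_mem_open hV ⟨⟨_, hk⟩, by
        simp only [mem_ofPred_eq, mul_inv_cancel_left₀ (hρ k).1.ne']
        exact ⟨ht, hc'⟩⟩
      exact hi.2.le.trans (le_iSup (fun i => ‖f ((ρ k * d i) • ζ)‖ₑ ^ p) i)
    rw [radMax, ← ENNReal.rpow_le_rpow_iff (z := p⁻¹) (by positivity), ← ENNReal.rpow_mul,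
      mul_inv_cancel₀ hp.ne', ENNReal.rpow_one]
    refine iSup₂_le fun t ht => ?_
    rw [← ENNReal.rpow_le_rpow_iff hp, ← ENNReal.rpow_mul, inv_mul_cancel₀ hp.ne',
      ENNReal.rpow_one]
    exact hpt t ht
  calc ∫⁻ ζ, radMax f ζ ^ p ∂sigmaS n ≤ ∫⁻ ζ, liminf (fun k => b k ζ) atTop ∂sigmaS n :=
        lintegral_mono_ae ((sigmaS_ae_mem n).mono key)
    _ ≤ liminf (fun k => ∫⁻ ζ, b k ζ ∂sigmaS n) atTop := lintegral_liminf_le hbm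
    _ ≤ 257 * hPow n p f := by
        refine liminf_le_of_le (by isBoundedDefault) fun c hc => ?_
        obtain ⟨k, hk⟩ := hc.exists
        exact hk.trans (lintegral_iSup_dilate_le hn hp hf hfm (hρ k) (fun i => (d i : ℝ))
          fun i => ⟨(d i).2.1.le, (d i).2.2⟩)

/-- The anisotropic polydisc of size `c₀ δ` in the `i`-th direction and `√(c₁ δ)` in the others. -/
def aPoly {n : ℕ} (i : Fin n) (c₀ c₁ δ : ℝ) : Set (En n) :=
  {w | ‖w i‖ < c₀ * δ ∧ ∀ j, j ≠ i → ‖w j‖ ^ 2 < c₁ * δ}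

theorem mE_aPoly {n : ℕ} (i : Fin n) {c₀ c₁ δ : ℝ} (h0 : 0 ≤ c₀) (h1 : 0 ≤ c₁) (hδ : 0 ≤ δ) :
    mE n (aPoly i c₀ c₁ δ) =
      ENNReal.ofReal (Real.pi ^ n * (c₀ ^ 2 * c₁ ^ (n - 1)) * δ ^ (n + 1)) := by
  classical
  set R : Fin n → ℝ := fun j => if j = i then c₀ * δ else √(c₁ * δ) with hR
  have hset : (EuclideanSpace.equiv (Fin n) ℂ).symm ⁻¹' (aPoly i c₀ c₁ δ) =
      univ.pi fun j => ball (0 : ℂ) (R j) := by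
    ext w
    simp only [aPoly, mem_preimage, mem_ofPred_eq, mem_univ_pi, mem_ball_zero_iff]
    constructor
    · rintro ⟨h, h'⟩ j
      by_cases hj : j = i
      · subst hj; simpa [hR] using h
      · simp only [hR, hj, if_false]
        exact Real.lt_sqrt_of_sq_lt (h' j hj)
    · intro h
      refine ⟨by simpa [hR] using h i, fun j hj => ?_⟩
      have := h j
      simp only [hR, hj, if_false] at this
      exact (Real.lt_sqrt (norm_nonneg _)).1 this
  have hmeas : MeasurableSet (aPoly i c₀ c₁ δ) := by
    have : aPoly i c₀ c₁ δ = {w | ‖w i‖ < c₀ * δ} ∩ ⋂ j, {w | j ≠ i → ‖w j‖ ^ 2 < c₁ * δ} := by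
      ext w; simp [aPoly]
    rw [this]
    refine (measurableSet_lt (by fun_prop) (by fun_prop)).inter (MeasurableSet.iInter fun j => ?_)
    by_cases hj : j = i
    · simp [hj]
    · simp only [ne_eq, hj, not_false_eq_true, forall_const]
      exact measurableSet_lt (by fun_prop) (by fun_prop)
  rw [mE, Measure.map_apply (EuclideanSpace.equiv (Fin n) ℂ).symm.continuous.measurable hmeas,
    hset, volume_pi_pi]
  have hterm : ∀ j, volume (ball (0 : ℂ) (R j)) = ENNReal.ofReal (R j ^ 2 * Real.pi) := by
    intro j
    have hRj : 0 ≤ R j := by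
      simp only [hR]
      split_ifs <;> positivity
    rw [Complex.volume_ball, ENNReal.ofReal_mul (by positivity), ENNReal.ofReal_pow hRj]
    congr 1
    exact (ENNReal.ofReal_eq_coe_nnreal Real.pi_pos.le).symm
  simp_rw [hterm]
  rw [← ENNReal.ofReal_prod_of_nonneg (fun j _ => by positivity)]
  congr 1
  rw [Finset.prod_mul_distrib, Finset.prod_const, Finset.card_univ, Fintype.card_fin,
    ← Finset.mul_prod_erase _ _ (Finset.mem_univ i)]
  have : ∏ j ∈ Finset.univ.erase i, R j ^ 2 = (c₁ * δ) ^ (n - 1) := by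
    rw [Finset.prod_congr rfl (g := fun _ => c₁ * δ), Finset.prod_const, Finset.card_erase_of_mem
      (Finset.mem_univ i), Finset.card_univ, Fintype.card_fin]
    intro j hj
    simp only [hR, (Finset.ne_of_mem_erase hj), if_false]
    exact Real.sq_sqrt (by positivity)
  rw [this]
  have hn : 1 ≤ n := i.pos
  obtain ⟨m, rfl⟩ : ∃ m, n = m + 1 := ⟨n - 1, by omega⟩
  simp only [hR, if_true, Nat.add_sub_cancel]
  ring

theorem norm_sq_eq_add {n : ℕ} (i : Fin n) (w : En n) :
    ‖w‖ ^ 2 = ‖w i‖ ^ 2 + ∑ j ∈ Finset.univ.erase i, ‖w j‖ ^ 2 := by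
  classical
  rw [EuclideanSpace.norm_sq_eq, Finset.add_sum_erase _ (fun j => ‖w j‖ ^ 2) (Finset.mem_univ i)]

theorem norm_sq_le_of_mem_aPoly {n : ℕ} (i : Fin n) {c₀ c₁ δ ρ : ℝ} (hρ : 0 ≤ ρ)
    (hc : 0 ≤ c₁) (hδ : 0 ≤ δ) {w : En n} (hw : w ∈ aPoly i c₀ c₁ δ) :
    ‖(EuclideanSpace.single i (ρ : ℂ) + w)‖ ^ 2 ≤ (ρ + c₀ * δ) ^ 2 + n * (c₁ * δ) := by
  classical
  rw [norm_sq_eq_add i]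
  refine add_le_add ?_ ?_
  · have h : ‖(EuclideanSpace.single i (ρ : ℂ) + w) i‖ ≤ ρ + c₀ * δ := by
      simp only [PiLp.add_apply, PiLp.single_apply, if_true]
      refine (norm_add_le _ _).trans ?_
      rw [Complex.norm_real, Real.norm_of_nonneg hρ]
      have := hw.1
      linarith
    gcongr
  · calc ∑ j ∈ Finset.univ.erase i, ‖(EuclideanSpace.single i (ρ : ℂ) + w) j‖ ^ 2
        ≤ ∑ j ∈ Finset.univ.erase i, c₁ * δ := by
          refine Finset.sum_le_sum fun j hj => ?_
          have hj' := Finset.ne_of_mem_erase hj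
          simpa [PiLp.single_apply, hj'] using (hw.2 j hj').le
      _ ≤ ∑ j : Fin n, c₁ * δ :=
          Finset.sum_le_sum_of_subset_of_nonneg (Finset.erase_subset _ _)
            fun _ _ _ => by positivity
      _ = _ := by simp

theorem smul_mem_aPoly {n : ℕ} {i : Fin n} {c₀ c₁ δ d₀ d₁ : ℝ} (hδ : 0 < δ) {w : En n} {l : ℂ}
    (hw : w ∈ aPoly i c₀ c₁ δ) (h0 : ‖l‖ * c₀ ≤ d₀) (h1 : ‖l‖ ^ 2 * c₁ ≤ d₁) (hl : l ≠ 0) :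
    l • w ∈ aPoly i d₀ d₁ δ := by
  have hl' : 0 < ‖l‖ := norm_pos_iff.2 hl
  refine ⟨?_, fun j hj => ?_⟩
  · rw [PiLp.smul_apply, norm_smul]
    calc ‖l‖ * ‖w i‖ < ‖l‖ * (c₀ * δ) := by gcongr; exact hw.1
      _ = (‖l‖ * c₀) * δ := by ring
      _ ≤ d₀ * δ := by gcongr
  · rw [PiLp.smul_apply, norm_smul, mul_pow]
    calc ‖l‖ ^ 2 * ‖w j‖ ^ 2 < ‖l‖ ^ 2 * (c₁ * δ) := by gcongr; exact hw.2 j hj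
      _ = (‖l‖ ^ 2 * c₁) * δ := by ring
      _ ≤ d₁ * δ := by gcongr

/-- Holomorphy of `F` along every complex line in the ball. -/
def LineHol {n : ℕ} (F : En n → ℂ) : Prop :=
  ∀ a w : En n, DifferentiableOn ℂ (fun l : ℂ => F (a + l • w)) {l | a + l • w ∈ Bn n}

theorem lineHol_of_differentiableOn {n : ℕ} {F : En n → ℂ} (hF : DifferentiableOn ℂ F (Bn n)) :
    LineHol F := fun a w => hF.comp (by fun_prop) fun _ hl => hl

theorem LineHol.comp {n : ℕ} {F : En n → ℂ} (hF : LineHol F) (U : En n ≃ₗᵢ[ℂ] En n) :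
    LineHol (F ∘ U) := by
  intro a w
  have h := hF (U a) (U w)
  refine (h.mono ?_).congr ?_
  · intro l hl
    have h2 : ‖U a + l • U w‖ = ‖a + l • w‖ := by rw [← map_smul, ← map_add, U.norm_map]
    have h3 : ‖a + l • w‖ < 1 := mem_ball_zero_iff.1 hl
    exact mem_ball_zero_iff.2 (h2.trans_lt h3)
  · intro l _
    simp

theorem hPow_comp {n : ℕ} {p : ℝ} {F : En n → ℂ} (hF : Measurable F) (U : En n ≃ₗᵢ[ℂ] En n) :
    hPow n p (F ∘ U) = hPow n p F := by
  unfold hPow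
  refine iSup_congr fun r => iSup_congr fun _ => ?_
  have hm : Measurable fun ζ : En n => ‖F (r • ζ)‖ₑ ^ p :=
    (hF.comp (by fun_prop)).enorm.pow_const _
  rw [← (measurePreserving_sigmaS U).lintegral_comp hm]
  refine lintegral_congr fun ζ => ?_
  have h : U (r • ζ) = r • U ζ := (U.toLinearEquiv.toLinearMap.restrictScalars ℝ).map_smul r ζ
  simp only [Function.comp, h]

/-- Integrals over thin shells are controlled by the Hardy quasinorm. -/
theorem exists_setLIntegral_shell_le {n : ℕ} (hn : 1 ≤ n) : ∃ C : ℝ≥0, ∀ (p : ℝ) (F : En n → ℂ),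
    Measurable F → ∀ δ : ℝ, 0 < δ → ∀ A : Set (En n), MeasurableSet A →
      (∀ z ∈ A, 1 - δ < ‖z‖ ∧ ‖z‖ < 1) →
      ∫⁻ z in A, ‖F z‖ₑ ^ p ∂mE n ≤ C * ENNReal.ofReal δ * hPow n p F := by
  obtain ⟨c, -, hct, hc⟩ := exists_polar hn
  lift c to ℝ≥0 using hct
  refine ⟨c, fun p F hF δ hδ A hA hAδ => ?_⟩
  have hm : Measurable (A.indicator fun z => ‖F z‖ₑ ^ p) := (hF.enorm.pow_const p).indicator hA
  rw [← lintegral_indicator hA, hc _ hm, mul_assoc]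
  refine mul_le_mul_right ?_ _
  calc ∫⁻ r in Ioi (0 : ℝ), ENNReal.ofReal (r ^ (2 * n - 1)) *
        ∫⁻ ζ, A.indicator (fun z => ‖F z‖ₑ ^ p) (r • ζ) ∂sigmaS n
      ≤ ∫⁻ r in Ioi (0 : ℝ), (Ioo (1 - δ) 1).indicator (fun _ => hPow n p F) r := by
        refine setLIntegral_mono_ae' measurableSet_Ioi (Eventually.of_forall fun r hr => ?_)
        have hr0 : (0 : ℝ) < r := hr
        by_cases hrδ : r ∈ Ioo (1 - δ) 1
        · rw [indicator_of_mem hrδ]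
          calc _ ≤ 1 * ∫⁻ ζ, ‖F (r • ζ)‖ₑ ^ p ∂sigmaS n := by
                gcongr
                · rw [ENNReal.ofReal_le_one]
                  exact pow_le_one₀ hr0.le hrδ.2.le
                · exact indicator_le_self A (fun z => ‖F z‖ₑ ^ p) _
            _ ≤ _ := by
                rw [one_mul]
                exact lintegral_le_hPow ⟨hr0, hrδ.2⟩ F
        · have : ∫⁻ ζ, A.indicator (fun z => ‖F z‖ₑ ^ p) (r • ζ) ∂sigmaS n = 0 := by
            rw [← lintegral_zero (μ := sigmaS n)]
            refine lintegral_congr_ae ((sigmaS_ae_mem n).mono fun ζ hζ => ?_)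
            have hζ1 : ‖ζ‖ = 1 := by simpa [Sn] using hζ
            refine indicator_of_notMem (fun h => hrδ ?_) _
            have := hAδ _ h
            rwa [norm_smul, hζ1, mul_one, Real.norm_of_nonneg hr0.le] at this
          rw [this, mul_zero]
          exact zero_le
    _ ≤ ∫⁻ r, (Ioo (1 - δ) 1).indicator (fun _ => hPow n p F) r := setLIntegral_le_lintegral _ _
    _ = _ := by
        rw [lintegral_indicator measurableSet_Ioo, lintegral_const, Measure.restrict_apply_univ,
          Real.volume_Ioo, mul_comm]
        congr 2
        ring

theorem measurableSet_aPoly {n : ℕ} (i : Fin n) (c₀ c₁ δ : ℝ) :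
    MeasurableSet (aPoly i c₀ c₁ δ) := by
  have : aPoly i c₀ c₁ δ = {w | ‖w i‖ < c₀ * δ} ∩ ⋂ j, {w | j ≠ i → ‖w j‖ ^ 2 < c₁ * δ} := by
    ext w; simp [aPoly]
  rw [this]
  refine (measurableSet_lt (by fun_prop) (by fun_prop)).inter (MeasurableSet.iInter fun j => ?_)
  by_cases hj : j = i
  · simp [hj]
  · simp only [ne_eq, hj, not_false_eq_true, forall_const]
    exact measurableSet_lt (by fun_prop) (by fun_prop)

/-- The mean value inequality over a balanced set. -/
theorem enorm_rpow_mul_le_setLIntegral {n : ℕ} {p : ℝ} (hp : 0 < p) {F : En n → ℂ}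
    (hF : LineHol F) (hFm : Measurable F) (a : En n) {W : Set (En n)} (hWm : MeasurableSet W)
    (hrot : ∀ x : TT, (fun w : En n => eT x • w) ⁻¹' W = W) {R : ℝ} (hR : 1 < R)
    (hW : ∀ w ∈ W, ∀ l ∈ ball (0 : ℂ) R, a + l • w ∈ Bn n) :
    ‖F a‖ₑ ^ p * mE n W ≤ ∫⁻ w in W, ‖F (a + w)‖ₑ ^ p ∂mE n := by
  have hm : Measurable fun w => ‖F (a + w)‖ₑ ^ p := (hFm.comp (by fun_prop)).enorm.pow_const _
  have hm2 : Measurable fun y : En n × TT => ‖F (a + eT y.2 • y.1)‖ₑ ^ p :=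
    hm.comp measurable_smul_eT
  calc ‖F a‖ₑ ^ p * mE n W = ∫⁻ _ in W, ‖F a‖ₑ ^ p ∂mE n := by rw [setLIntegral_const]
    _ ≤ ∫⁻ w in W, ∫⁻ x, ‖F (a + eT x • w)‖ₑ ^ p ∂muT ∂mE n := by
        refine setLIntegral_mono_ae' hWm (Eventually.of_forall fun w hw => ?_)
        have h := enorm_rpow_le_lintegral_kT (φ := fun l => F (a + l • w)) (t := 0) hp one_pos hR
          ((hF a w).mono fun l hl => hW w hw l hl) le_rfl one_pos
        simpa [kT_zero] using h
    _ = ∫⁻ x, ∫⁻ w in W, ‖F (a + eT x • w)‖ₑ ^ p ∂mE n ∂muT :=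
        lintegral_lintegral_swap hm2.aemeasurable
    _ = ∫⁻ x : TT, ∫⁻ w in W, ‖F (a + w)‖ₑ ^ p ∂mE n ∂muT := by
        refine lintegral_congr fun x => ?_
        have h := (measurePreserving_mE (rotE n x)).setLIntegral_comp_preimage hWm hm
        rw [← h]
        have h2 : (rotE n x) ⁻¹' W = W := hrot x
        rw [h2]
        rfl
    _ = _ := by simp

theorem aPoly_rot {n : ℕ} (i : Fin n) (c₀ c₁ δ : ℝ) (x : TT) :
    (fun w : En n => eT x • w) ⁻¹' aPoly i c₀ c₁ δ = aPoly i c₀ c₁ δ := by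
  ext w
  simp [aPoly, norm_eT]

/-- Pointwise growth of Hardy functions. -/
theorem exists_growth {n : ℕ} (hn : 1 ≤ n) : ∃ C : ℝ≥0, ∀ (p : ℝ), 0 < p → ∀ F : En n → ℂ,
    LineHol F → Measurable F → ∀ a ∈ Bn n,
      ‖F a‖ₑ ^ p * ENNReal.ofReal ((1 - ‖a‖) ^ n) ≤ C * hPow n p F := by
  obtain ⟨C, hC⟩ := exists_setLIntegral_shell_le hn
  have hn0 : (0 : ℝ) < n := by exact_mod_cast hn
  set i : Fin n := ⟨0, hn⟩ with hi
  set κ : ℝ := Real.pi ^ n * ((1 / 8) ^ 2 * (1 / (4 * n)) ^ (n - 1)) with hκ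
  have hκ0 : 0 < κ := by positivity
  refine ⟨2 * C / κ.toNNReal, fun p hp F hF hFm a ha => ?_⟩
  have ha1 : ‖a‖ < 1 := by simpa [Bn] using ha
  wlog haρ : a = EuclideanSpace.single i (‖a‖ : ℂ) generalizing F a
  · rcases eq_or_ne a 0 with rfl | ha0
    · exact absurd (by ext j; simp [PiLp.single_apply]) haρ
    have hna : ‖a‖ ≠ 0 := norm_ne_zero_iff.2 ha0
    obtain ⟨U, hU⟩ := exists_unitary (n := n) (ζ := EuclideanSpace.single i (1 : ℂ))
      (η := ((‖a‖ : ℂ)⁻¹) • a) (by simp) (by simp [norm_smul, hna])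
    have hUa : U (EuclideanSpace.single i (‖a‖ : ℂ)) = a := by
      have : EuclideanSpace.single i (‖a‖ : ℂ) = (‖a‖ : ℂ) • EuclideanSpace.single i (1 : ℂ) := by
        ext j
        simp [PiLp.single_apply]
      rw [this, map_smul, hU, smul_smul, mul_inv_cancel₀ (by exact_mod_cast hna), one_smul]
    have hb : ‖EuclideanSpace.single i (‖a‖ : ℂ)‖ = ‖a‖ := by simp
    have := this (F ∘ U) (hF.comp U) (hFm.comp U.continuous.measurable)
      (EuclideanSpace.single i (‖a‖ : ℂ)) (by simpa [Bn] using ha1) (by rw [hb]; exact ha1)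
      (by rw [hb])
    rwa [hPow_comp hFm, Function.comp, hUa, hb] at this
  set ρ := ‖a‖ with hρ
  have hρ0 : 0 ≤ ρ := norm_nonneg a
  set δ := 1 - ρ with hδ
  have hδ0 : 0 < δ := by linarith
  have hδ1 : δ ≤ 1 := by linarith
  set W := aPoly i (1 / 8) (1 / (4 * n)) δ with hW
  have hWm : MeasurableSet W := measurableSet_aPoly _ _ _ _
  have hball : ∀ w ∈ W, ∀ l ∈ ball (0 : ℂ) (5 / 4), a + l • w ∈ Bn n := by
    intro w hw l hl
    rcases eq_or_ne l 0 with rfl | hl0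
    · simpa using ha
    have hl1 : ‖l‖ < 5 / 4 := by simpa using hl
    have hlw : l • w ∈ aPoly i (1 / 4) (1 / (2 * n)) δ := by
      refine smul_mem_aPoly hδ0 hw (by linarith) ?_ hl0
      have : ‖l‖ ^ 2 ≤ 2 := by nlinarith [norm_nonneg l]
      calc ‖l‖ ^ 2 * (1 / (4 * n)) ≤ 2 * (1 / (4 * (n : ℝ))) := by gcongr
        _ = _ := by field_simp; norm_num
    have h := norm_sq_le_of_mem_aPoly i hρ0 (by positivity) hδ0.le hlw
    rw [← haρ] at h
    have h2 : (n : ℝ) * (1 / (2 * n) * δ) = δ / 2 := by field_simp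
    rw [h2] at h
    have h3 : ‖a + l • w‖ ^ 2 < 1 := by nlinarith
    simpa [Bn] using (sq_lt_one_iff₀ (norm_nonneg _)).1 h3
  have hshell : ∀ z ∈ (fun z => -a + z) ⁻¹' W, 1 - 2 * δ < ‖z‖ ∧ ‖z‖ < 1 := by
    intro z hz
    have hz' : -a + z ∈ W := hz
    constructor
    · have h1 : ‖z i - ρ‖ < 1 / 8 * δ := by
        have := hz'.1
        rw [haρ] at this
        simpa [neg_add_eq_sub] using this
      have h2 : ‖z i‖ ≤ ‖z‖ := PiLp.norm_apply_le z i
      have h3 : ρ - ‖z i‖ ≤ ‖z i - ρ‖ := by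
        have := norm_sub_norm_le (ρ : ℂ) (z i)
        rw [norm_sub_rev] at this
        rwa [Complex.norm_real, Real.norm_of_nonneg hρ0] at this
      linarith
    · have := hball _ hz' 1 (by norm_num)
      simpa [Bn] using this
  have hmain := enorm_rpow_mul_le_setLIntegral hp hF hFm a hWm (aPoly_rot _ _ _ _)
    (by norm_num) hball
  have htrans : ∫⁻ w in W, ‖F (a + w)‖ₑ ^ p ∂mE n =
      ∫⁻ z in (fun z => -a + z) ⁻¹' W, ‖F z‖ₑ ^ p ∂mE n := by
    have hmp := measurePreserving_add_left (mE n) (-a)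
    have hm : Measurable fun w : En n => ‖F (a + w)‖ₑ ^ p :=
      (hFm.comp (by fun_prop)).enorm.pow_const _
    rw [← hmp.setLIntegral_comp_preimage hWm hm]
    simp only [add_neg_cancel_left]
  rw [htrans] at hmain
  have h2 := hmain.trans (hC p F hFm (2 * δ) (by positivity) _
    (hWm.preimage (by fun_prop)) hshell)
  rw [hW, mE_aPoly i (by positivity) (by positivity) hδ0.le, ← hκ] at h2
  have hκ' : (κ.toNNReal : ℝ≥0∞) = ENNReal.ofReal κ := rfl
  have hκne : ENNReal.ofReal κ ≠ 0 := by simpa using hκ0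
  have hδne : ENNReal.ofReal δ ≠ 0 := by simpa using hδ0
  clear_value κ
  rw [pow_succ, ← mul_assoc, ENNReal.ofReal_mul (by positivity), ENNReal.ofReal_mul (by positivity),
    ENNReal.ofReal_mul (by norm_num)] at h2
  have hKD : ENNReal.ofReal κ * ENNReal.ofReal δ ≠ 0 := mul_ne_zero hκne hδne
  have hKD' : ENNReal.ofReal κ * ENNReal.ofReal δ ≠ ⊤ :=
    ENNReal.mul_ne_top ENNReal.ofReal_ne_top ENNReal.ofReal_ne_top
  rw [← ENNReal.mul_le_mul_iff_left hKD hKD', ENNReal.coe_div (by simpa using hκ0), hκ']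
  calc _ = ‖F a‖ₑ ^ p * (ENNReal.ofReal κ * ENNReal.ofReal (δ ^ n) * ENNReal.ofReal δ) := by ring
    _ ≤ _ := h2
    _ = ((2 * C : ℝ≥0) : ℝ≥0∞) * ENNReal.ofReal δ * hPow n p F := by
      push_cast
      rw [ENNReal.ofReal_ofNat]
      ring
    _ = ((2 * C : ℝ≥0) : ℝ≥0∞) / ENNReal.ofReal κ * ENNReal.ofReal κ * ENNReal.ofReal δ *
        hPow n p F := by
      rw [ENNReal.div_mul_cancel hκne ENNReal.ofReal_ne_top]
    _ = _ := by ring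

/-- The surface measure of nonisotropic caps centred at a basis vector. -/
theorem exists_sigmaS_cap_le {n : ℕ} (hn : 1 ≤ n) : ∃ C : ℝ≥0, ∀ (i : Fin n) (δ : ℝ), 0 < δ →
    sigmaS n {ζ | ‖1 - ζ i‖ < δ} ≤ C * ENNReal.ofReal (δ ^ n) := by
  have := isProbabilityMeasure_sigmaS hn
  obtain ⟨c, hc0, hct, hc⟩ := exists_polar hn
  lift c to ℝ≥0 using hct
  have hc0' : c ≠ 0 := by simpa using hc0
  set κ : ℝ := Real.pi ^ n * (2 ^ 2 * 5 ^ (n - 1)) with hκ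
  have hκ0 : 0 < κ := by positivity
  refine ⟨2 ^ n + 2 ^ (2 * n - 1) * κ.toNNReal / c, fun i δ hδ => ?_⟩
  rcases lt_or_ge (1 / 2) δ with h | hδ2
  · calc sigmaS n {ζ | ‖1 - ζ i‖ < δ} ≤ 1 := prob_le_one
      _ ≤ ENNReal.ofReal ((2 * δ) ^ n) := by
        rw [ENNReal.one_le_ofReal]
        exact one_le_pow₀ (by linarith)
      _ = ((2 ^ n : ℝ≥0) : ℝ≥0∞) * ENNReal.ofReal (δ ^ n) := by
        rw [mul_pow, ENNReal.ofReal_mul (by positivity), ENNReal.ofReal_pow (by norm_num)]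
        simp
      _ ≤ _ := by
        gcongr
        exact le_self_add
  set e : En n := EuclideanSpace.single i (1 : ℂ) with he
  set A : Set (En n) := (fun z => -e + z) ⁻¹' aPoly i 2 5 δ with hA
  have hAm : MeasurableSet A := (measurableSet_aPoly _ _ _ _).preimage (by fun_prop)
  have hAv : mE n A = ENNReal.ofReal (κ * δ ^ (n + 1)) := by
    rw [hA, measure_preimage_add, mE_aPoly i (by norm_num) (by norm_num) hδ.le]
  set S : Set (En n) := {ζ | ‖1 - ζ i‖ < δ} with hS
  have hSm : MeasurableSet S := measurableSet_lt (by fun_prop) (by fun_prop)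
  have hmem : ∀ r ∈ Ioo (1 - δ) 1, ∀ ζ ∈ S, ‖ζ‖ = 1 → r • ζ ∈ A := by
    intro r hr ζ hζ hζ1
    have hζ' : ‖1 - ζ i‖ < δ := hζ
    have hr0 : 0 < r := by linarith [hr.1]
    have hsq := norm_sq_eq_add i ζ
    rw [hζ1] at hsq
    have hlow : 1 - δ < ‖ζ i‖ := by
      have := norm_sub_norm_le (1 : ℂ) (ζ i)
      rw [norm_one] at this
      linarith
    refine ⟨?_, fun j hj => ?_⟩
    · have h1 : (-e + r • ζ) i = -(((1 - r : ℝ) : ℂ) + (r : ℂ) * (1 - ζ i)) := by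
        simp [he]
        ring
      rw [h1, norm_neg]
      calc _ ≤ ‖((1 - r : ℝ) : ℂ)‖ + ‖(r : ℂ) * (1 - ζ i)‖ := norm_add_le _ _
        _ = (1 - r) + r * ‖1 - ζ i‖ := by
          rw [norm_mul, Complex.norm_real, Complex.norm_real, Real.norm_of_nonneg hr0.le,
            Real.norm_of_nonneg (by linarith [hr.2])]
        _ < _ := by nlinarith [hr.1, hr.2, norm_nonneg (1 - ζ i)]
    · have h1 : (-e + r • ζ) j = (r : ℂ) * ζ j := by
        simp [he, hj]
      have h2 : ‖ζ j‖ ^ 2 ≤ ∑ j ∈ Finset.univ.erase i, ‖ζ j‖ ^ 2 :=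
        Finset.single_le_sum (f := fun j => ‖ζ j‖ ^ 2) (fun _ _ => sq_nonneg _)
          (Finset.mem_erase.2 ⟨hj, Finset.mem_univ j⟩)
      rw [h1, norm_mul, Complex.norm_real, Real.norm_of_nonneg hr0.le, mul_pow]
      have h3 : r ^ 2 ≤ 1 := pow_le_one₀ hr0.le hr.2.le
      have h4 : r ^ 2 * ‖ζ j‖ ^ 2 ≤ ‖ζ j‖ ^ 2 := by
        nlinarith [sq_nonneg ‖ζ j‖]
      nlinarith
  have hkey : (c : ℝ≥0∞) * (ENNReal.ofReal ((1 / 2) ^ (2 * n - 1) * δ) * sigmaS n S) ≤ mE n A := by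
    have h1 : mE n A = ∫⁻ z, A.indicator 1 z ∂mE n := (lintegral_indicator_one hAm).symm
    rw [h1, hc _ (measurable_one.indicator hAm)]
    gcongr
    calc ENNReal.ofReal ((1 / 2) ^ (2 * n - 1) * δ) * sigmaS n S
        = ∫⁻ r in Ioo (1 - δ) 1, ENNReal.ofReal ((1 / 2) ^ (2 * n - 1)) * sigmaS n S := by
          rw [setLIntegral_const, Real.volume_Ioo, ENNReal.ofReal_mul (by positivity)]
          have : 1 - (1 - δ) = δ := by ring
          rw [this]
          ring
      _ ≤ ∫⁻ r in Ioo (1 - δ) 1, ENNReal.ofReal (r ^ (2 * n - 1)) *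
            ∫⁻ ζ, A.indicator 1 (r • ζ) ∂sigmaS n := by
          refine setLIntegral_mono_ae' measurableSet_Ioo (Eventually.of_forall fun r hr => ?_)
          have hr2 : 1 / 2 ≤ r := by linarith [hr.1]
          rw [← lintegral_indicator_one hSm]
          refine mul_le_mul' (ENNReal.ofReal_le_ofReal (pow_le_pow_left₀ (by norm_num) hr2 _))
            (lintegral_mono_ae ((sigmaS_ae_mem n).mono fun ζ hζ => ?_))
          have hζ1 : ‖ζ‖ = 1 := by simpa [Sn] using hζ
          by_cases hζS : ζ ∈ S
          · rw [indicator_of_mem hζS, indicator_of_mem (hmem r hr ζ hζS hζ1)]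
            rfl
          · rw [indicator_of_notMem hζS]
            exact zero_le
      _ ≤ _ := lintegral_mono_set fun r hr => by
          have := hr.1
          simp only [mem_Ioi]
          linarith
  rw [hAv] at hkey
  have hD : ENNReal.ofReal δ ≠ 0 := by simpa using hδ
  clear_value κ
  have hX : (c : ℝ≥0∞) * ENNReal.ofReal ((1 / 2) ^ (2 * n - 1)) * ENNReal.ofReal δ ≠ 0 :=
    mul_ne_zero (mul_ne_zero (by simpa using hc0') (by simp)) hD
  have hX' : (c : ℝ≥0∞) * ENNReal.ofReal ((1 / 2) ^ (2 * n - 1)) * ENNReal.ofReal δ ≠ ⊤ :=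
    ENNReal.mul_ne_top (ENNReal.mul_ne_top ENNReal.coe_ne_top ENNReal.ofReal_ne_top)
      ENNReal.ofReal_ne_top
  rw [pow_succ, ← mul_assoc, ENNReal.ofReal_mul (by positivity), ENNReal.ofReal_mul (by positivity),
    ENNReal.ofReal_mul (by positivity)] at hkey
  have hκ' : (κ.toNNReal : ℝ≥0∞) = ENNReal.ofReal κ := rfl
  refine le_trans ?_ (mul_le_mul_left (ENNReal.coe_le_coe.2 (le_add_self :
    2 ^ (2 * n - 1) * κ.toNNReal / c ≤ 2 ^ n + 2 ^ (2 * n - 1) * κ.toNNReal / c)) _)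
  rw [← ENNReal.mul_le_mul_iff_left hX hX', ENNReal.coe_div hc0', ENNReal.coe_mul, hκ']
  have h2 : ((2 ^ (2 * n - 1) : ℝ≥0) : ℝ≥0∞) * ENNReal.ofReal ((1 / 2) ^ (2 * n - 1)) = 1 := by
    have : ((2 ^ (2 * n - 1) : ℝ≥0) : ℝ≥0∞) = ENNReal.ofReal (2 ^ (2 * n - 1)) := by
      rw [ENNReal.ofReal_pow (by norm_num)]; simp
    rw [this, ← ENNReal.ofReal_mul (by positivity), ← mul_pow]
    norm_num
  calc _ = (c : ℝ≥0∞) * (ENNReal.ofReal ((1 / 2) ^ (2 * n - 1)) * ENNReal.ofReal δ *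
        sigmaS n S) := by ring
    _ ≤ ENNReal.ofReal κ * ENNReal.ofReal (δ ^ n) * ENNReal.ofReal δ := by
      simpa only [mul_assoc] using hkey
    _ = (((2 ^ (2 * n - 1) : ℝ≥0) : ℝ≥0∞) * ENNReal.ofReal ((1 / 2) ^ (2 * n - 1))) *
        (ENNReal.ofReal κ * ENNReal.ofReal (δ ^ n) * ENNReal.ofReal δ) := by rw [h2, one_mul]
    _ = ((((2 ^ (2 * n - 1) : ℝ≥0) : ℝ≥0∞) * ENNReal.ofReal κ) / (c : ℝ≥0∞) * c) *
        (ENNReal.ofReal ((1 / 2) ^ (2 * n - 1)) * ENNReal.ofReal (δ ^ n) * ENNReal.ofReal δ) := by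
      rw [ENNReal.div_mul_cancel (by simpa using hc0') ENNReal.coe_ne_top]
      ring
    _ = _ := by ring

theorem exists_lintegral_coord_kernel_le {n : ℕ} (hn : 1 ≤ n) : ∃ C : ℝ≥0, ∀ (i : Fin n) (t : ℝ),
    0 ≤ t → t < 1 →
    ∫⁻ ζ, ENNReal.ofReal ((1 - t) ^ n / ‖1 - (t : ℂ) * ζ i‖ ^ (2 * n)) ∂sigmaS n ≤ C := by
  obtain ⟨C, hC⟩ := exists_sigmaS_cap_le hn
  refine ⟨8 ^ n * C * 2, fun i t ht ht1 => ?_⟩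
  set ε := 1 - t with hε
  have hε0 : 0 < ε := by linarith
  set E : ℕ → Set (En n) := fun k => {ζ | ‖1 - ζ i‖ < 2 ^ (k + 1) * ε} with hE
  have hEm : ∀ k, MeasurableSet (E k) := fun k => measurableSet_lt (by fun_prop) (by fun_prop)
  set b : ℕ → ℝ := fun k => ε ^ n / (2 ^ k * ε / 2) ^ (2 * n) with hb
  have hb0 : ∀ k, 0 ≤ b k := fun k => by positivity
  have hpt : ∀ ζ : En n, ‖ζ‖ = 1 →
      ENNReal.ofReal (ε ^ n / ‖1 - (t : ℂ) * ζ i‖ ^ (2 * n)) ≤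
        ∑' k, (E k).indicator (fun _ => ENNReal.ofReal (b k)) ζ := by
    intro ζ hζ
    have hζi : ‖ζ i‖ ≤ 1 := hζ ▸ PiLp.norm_apply_le ζ i
    have hlow1 : ε ≤ ‖1 - (t : ℂ) * ζ i‖ := by
      have := norm_sub_norm_le (1 : ℂ) ((t : ℂ) * ζ i)
      rw [norm_one, norm_mul, Complex.norm_real, Real.norm_of_nonneg ht] at this
      nlinarith
    have hlow2 : ‖1 - ζ i‖ / 2 ≤ ‖1 - (t : ℂ) * ζ i‖ := by
      have h1 : 1 - ζ i = (1 - (t : ℂ) * ζ i) - ((1 - t : ℝ) : ℂ) * ζ i := by push_cast; ring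
      have h2 : ‖1 - ζ i‖ ≤ ‖1 - (t : ℂ) * ζ i‖ + ε * ‖ζ i‖ := by
        rw [h1]
        refine (norm_sub_le _ _).trans ?_
        rw [norm_mul (((1 - t : ℝ) : ℂ)), Complex.norm_real, Real.norm_of_nonneg hε0.le]
      nlinarith
    have hex : ∃ k, ζ ∈ E k := by
      obtain ⟨k, hk⟩ := pow_unbounded_of_one_lt (‖1 - ζ i‖ / ε) (one_lt_two)
      refine ⟨k, ?_⟩
      rw [div_lt_iff₀ hε0] at hk
      refine hk.trans_le ?_
      gcongr
      · norm_num
      · omega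
    classical
    set k := Nat.find hex with hk
    have hmem : ζ ∈ E k := Nat.find_spec hex
    have hlow : 2 ^ k * ε / 2 ≤ ‖1 - (t : ℂ) * ζ i‖ := by
      rcases Nat.eq_zero_or_pos k with h0 | hpos
      · rw [h0]; linarith
      · have h1 : ζ ∉ E (k - 1) := Nat.find_min hex (by omega)
        have h2 : 2 ^ (k - 1 + 1) * ε ≤ ‖1 - ζ i‖ := not_lt.1 h1
        rw [Nat.sub_add_cancel hpos] at h2
        linarith
    calc _ ≤ ENNReal.ofReal (b k) := ENNReal.ofReal_le_ofReal (by
          show _ ≤ ε ^ n / (2 ^ k * ε / 2) ^ (2 * n)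
          gcongr)
      _ = (E k).indicator (fun _ => ENNReal.ofReal (b k)) ζ := 
          (indicator_of_mem hmem fun _ => ENNReal.ofReal (b k)).symm
      _ ≤ _ := ENNReal.le_tsum (f := fun k => (E k).indicator (fun _ => ENNReal.ofReal (b k)) ζ) k
  calc _ ≤ ∫⁻ ζ, ∑' k, (E k).indicator (fun _ => ENNReal.ofReal (b k)) ζ ∂sigmaS n :=
        lintegral_mono_ae ((sigmaS_ae_mem n).mono fun ζ hζ => hpt ζ (by simpa [Sn] using hζ))
    _ = ∑' k, ENNReal.ofReal (b k) * sigmaS n (E k) := by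
        rw [lintegral_tsum fun k => (measurable_const.indicator (hEm k)).aemeasurable]
        refine tsum_congr fun k => ?_
        rw [lintegral_indicator (hEm k), setLIntegral_const]
    _ ≤ ∑' k, ENNReal.ofReal (8 ^ n) * C * (2⁻¹ : ℝ≥0∞) ^ k := by
        refine ENNReal.tsum_le_tsum fun k => ?_
        calc _ ≤ ENNReal.ofReal (b k) * (C * ENNReal.ofReal ((2 ^ (k + 1) * ε) ^ n)) := by
              gcongr
              exact hC i _ (by positivity)
          _ = C * ENNReal.ofReal (b k * (2 ^ (k + 1) * ε) ^ n) := by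
              rw [ENNReal.ofReal_mul (hb0 k)]; ring
          _ ≤ C * ENNReal.ofReal (8 ^ n * (1 / 2) ^ k) := by
              have h1 : b k * (2 ^ (k + 1) * ε) ^ n = 8 ^ n * ((1 / 2) ^ n) ^ k := by
                rw [hb]
                have e1 : (2 ^ k * ε / 2 : ℝ) ^ (2 * n) = ((2 ^ k * ε / 2) ^ n) ^ 2 := by
                  rw [pow_mul']
                have e2 : ((1 / 2 : ℝ) ^ n) ^ k = 1 / (2 ^ k) ^ n := by
                  rw [← pow_mul, mul_comm, pow_mul, one_div_pow, one_div_pow]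
                have e3 : (8 : ℝ) ^ n = 2 ^ n * 2 ^ n * 2 ^ n := by
                  rw [← mul_pow, ← mul_pow]; norm_num
                rw [e2]
                simp only [e1, e3, div_pow, mul_pow, pow_succ]
                field_simp
              refine mul_le_mul' le_rfl (ENNReal.ofReal_le_ofReal (h1.trans_le ?_))
              gcongr
              exact pow_le_of_le_one (by norm_num) (by norm_num) (by omega)
          _ = _ := by
              rw [ENNReal.ofReal_mul (by positivity), ENNReal.ofReal_pow (p := 1 / 2) (by norm_num),
                one_div, ENNReal.ofReal_inv_of_pos (by norm_num), ENNReal.ofReal_ofNat]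
              ring
    _ = _ := by
        rw [ENNReal.tsum_mul_left, ENNReal.tsum_geometric, ENNReal.one_sub_inv_two, inv_inv,
          ENNReal.ofReal_pow (by norm_num), ENNReal.ofReal_ofNat]
        push_cast
        rfl

theorem herm_eq_inner {n : ℕ} (z w : En n) : herm z w = inner ℂ w z := by
  simp [herm, PiLp.inner_apply]

theorem exists_lintegral_kernel_le {n : ℕ} (hn : 1 ≤ n) : ∃ C : ℝ≥0, ∀ a ∈ Bn n,
    ∀ r ∈ Ioo (0 : ℝ) 1,
    ∫⁻ ζ, ENNReal.ofReal ((1 - ‖a‖ ^ 2) ^ n / ‖1 - herm (r • ζ) a‖ ^ (2 * n)) ∂sigmaS n ≤ C := by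
  obtain ⟨C, hC⟩ := exists_lintegral_coord_kernel_le hn
  refine ⟨2 ^ n * C, fun a ha r hr => ?_⟩
  have ha1 : ‖a‖ < 1 := mem_ball_zero_iff.1 ha
  set i : Fin n := ⟨0, hn⟩
  obtain ⟨η, hη, haη⟩ : ∃ η : En n, ‖η‖ = 1 ∧ a = (‖a‖ : ℂ) • η := by
    rcases eq_or_ne a 0 with rfl | ha0
    · exact ⟨EuclideanSpace.single i 1, by simp, by simp⟩
    · have hna : (‖a‖ : ℂ) ≠ 0 := by simpa using ha0
      exact ⟨(‖a‖ : ℂ)⁻¹ • a, by simp [norm_smul, ha0],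
        by rw [smul_smul, mul_inv_cancel₀ hna, one_smul]⟩
  obtain ⟨U, hU⟩ := exists_unitary (n := n) (ζ := EuclideanSpace.single i (1 : ℂ))
    (η := η) (by simp) hη
  have hherm : ∀ ζ : En n, herm (r • U ζ) a = ((r * ‖a‖ : ℝ) : ℂ) * ζ i := by
    intro ζ
    have h1 : r • U ζ = (r : ℂ) • U ζ := rfl
    rw [h1, herm_eq_inner, haη, ← hU, inner_smul_left, inner_smul_right, U.inner_map_map,
      EuclideanSpace.inner_single_left]
    simp [norm_smul]
    ring
  have hm : Measurable fun ζ : En n =>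
      ENNReal.ofReal ((1 - ‖a‖ ^ 2) ^ n / ‖1 - herm (r • ζ) a‖ ^ (2 * n)) := by
    unfold herm
    fun_prop
  rw [← (measurePreserving_sigmaS U).lintegral_comp hm]
  have ht1 : r * ‖a‖ < 1 := by nlinarith [hr.1, hr.2, norm_nonneg a]
  have ht0 : 0 ≤ r * ‖a‖ := mul_nonneg hr.1.le (norm_nonneg a)
  have hta : 1 - ‖a‖ ^ 2 ≤ 2 * (1 - r * ‖a‖) := by nlinarith [hr.1, hr.2, norm_nonneg a]
  have hta0 : 0 ≤ 1 - ‖a‖ ^ 2 := by nlinarith [norm_nonneg a]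
  calc _ ≤ ∫⁻ ζ, ENNReal.ofReal (2 ^ n) * ENNReal.ofReal ((1 - r * ‖a‖) ^ n /
        ‖1 - ((r * ‖a‖ : ℝ) : ℂ) * ζ i‖ ^ (2 * n)) ∂sigmaS n := by
        refine lintegral_mono fun ζ => ?_
        rw [hherm, ← ENNReal.ofReal_mul (by positivity)]
        refine ENNReal.ofReal_le_ofReal ?_
        rw [← mul_div_assoc, ← mul_pow]
        gcongr
    _ = ENNReal.ofReal (2 ^ n) * ∫⁻ ζ, ENNReal.ofReal ((1 - r * ‖a‖) ^ n /
        ‖1 - ((r * ‖a‖ : ℝ) : ℂ) * ζ i‖ ^ (2 * n)) ∂sigmaS n :=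
        lintegral_const_mul _ (by fun_prop)
    _ ≤ ENNReal.ofReal (2 ^ n) * C := by
        gcongr
        exact hC i _ ht0 ht1
    _ = _ := by
        rw [ENNReal.ofReal_pow (by norm_num), ENNReal.ofReal_ofNat]
        push_cast
        rfl

/-- The normalized reproducing-kernel test functions. -/
def testF (n : ℕ) (p : ℝ) (a z : En n) : ℂ :=
  (((1 - ‖a‖ ^ 2) ^ (n / p) : ℝ) : ℂ) * (1 - herm z a) ^ ((-(2 * n / p) : ℝ) : ℂ)

theorem norm_herm_le {n : ℕ} (z w : En n) : ‖herm z w‖ ≤ ‖w‖ * ‖z‖ := by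
  rw [herm_eq_inner]
  exact norm_inner_le_norm w z

theorem norm_testF {n : ℕ} {p : ℝ} {a : En n} (ha : ‖a‖ < 1) (z : En n) :
    ‖testF n p a z‖ = (1 - ‖a‖ ^ 2) ^ (n / p) * ‖1 - herm z a‖ ^ (-(2 * n / p)) := by
  have h : 0 ≤ 1 - ‖a‖ ^ 2 := by nlinarith [norm_nonneg a]
  rw [testF, norm_mul, Complex.norm_real, Complex.norm_cpow_real,
    Real.norm_of_nonneg (Real.rpow_nonneg h _)]

theorem norm_testF_self {n : ℕ} {p : ℝ} {a : En n} (ha : ‖a‖ < 1) :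
    ‖testF n p a a‖ = (1 - ‖a‖ ^ 2) ^ (-(n / p)) := by
  have h : 0 < 1 - ‖a‖ ^ 2 := by nlinarith [norm_nonneg a]
  have h1 : 1 - herm a a = ((1 - ‖a‖ ^ 2 : ℝ) : ℂ) := by
    rw [herm_eq_inner, inner_self_eq_norm_sq_to_K]
    push_cast
    rfl
  rw [norm_testF ha, h1, Complex.norm_real, Real.norm_of_nonneg h.le, ← Real.rpow_add h]
  congr 1
  ring

theorem one_sub_herm_lower {n : ℕ} {a z : En n} (ha : ‖a‖ < 1) : 1 - ‖z‖ ≤ ‖1 - herm z a‖ := by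
  have h1 := norm_sub_norm_le (1 : ℂ) (herm z a)
  rw [norm_one] at h1
  have := norm_herm_le z a
  nlinarith [norm_nonneg z]

theorem norm_testF_le {n : ℕ} {p : ℝ} (hp : 0 < p) {a z : En n} (ha : ‖a‖ < 1) {ρ : ℝ}
    (hz : ‖z‖ ≤ ρ) (hρ : ρ < 1) :
    ‖testF n p a z‖ ≤ (1 - ‖a‖ ^ 2) ^ (n / p) * (1 - ρ) ^ (-(2 * n / p)) := by
  rw [norm_testF ha]
  have h : 0 ≤ 1 - ‖a‖ ^ 2 := by nlinarith [norm_nonneg a]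
  have h2 := one_sub_herm_lower (z := z) ha
  refine mul_le_mul_of_nonneg_left ?_ (Real.rpow_nonneg h _)
  exact Real.rpow_le_rpow_of_nonpos (by linarith) (by linarith) (by
    have : 0 ≤ 2 * n / p := by positivity
    linarith)

theorem differentiableOn_testF {n : ℕ} {p : ℝ} {a : En n} (ha : ‖a‖ < 1) :
    DifferentiableOn ℂ (testF n p a) (Bn n) := by
  intro z hz
  have hz1 : ‖z‖ < 1 := mem_ball_zero_iff.1 hz
  have hh : DifferentiableAt ℂ (fun z : En n => 1 - herm z a) z := by
    unfold herm
    fun_prop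
  refine DifferentiableAt.differentiableWithinAt ?_
  refine (hh.cpow_const (Or.inl ?_)).const_mul _
  have h1 : ‖herm z a‖ < 1 := by
    have := norm_herm_le z a
    nlinarith [norm_nonneg z]
  have h2 := (Complex.re_le_norm (herm z a))
  simp only [Complex.sub_re, Complex.one_re]
  linarith

theorem exists_hPow_testF_le {n : ℕ} (hn : 1 ≤ n) {p : ℝ} (hp : 0 < p) : ∃ C : ℝ≥0, ∀ a ∈ Bn n,
    hPow n p (testF n p a) ≤ C := by
  obtain ⟨C, hC⟩ := exists_lintegral_kernel_le hn
  refine ⟨C, fun a ha => iSup₂_le fun r hr => le_trans (lintegral_mono_ae ?_) (hC a ha r hr)⟩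
  have ha1 : ‖a‖ < 1 := mem_ball_zero_iff.1 ha
  refine (sigmaS_ae_mem n).mono fun ζ hζ => ?_
  have hζ1 : ‖ζ‖ = 1 := by simpa [Sn] using hζ
  have h : 0 ≤ 1 - ‖a‖ ^ 2 := by nlinarith [norm_nonneg a]
  have h2 := one_sub_herm_lower (z := r • ζ) ha1
  rw [norm_smul, hζ1, mul_one, Real.norm_of_nonneg hr.1.le] at h2
  have h3 : 0 < ‖1 - herm (r • ζ) a‖ := by linarith [hr.2]
  rw [← ofReal_norm, norm_testF ha1, ENNReal.ofReal_rpow_of_nonneg (by positivity) hp.le,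
    Real.mul_rpow (by positivity) (by positivity), ← Real.rpow_mul h, ← Real.rpow_mul h3.le,
    div_mul_cancel₀ _ hp.ne', Real.rpow_natCast, neg_mul, div_mul_cancel₀ _ hp.ne',
    Real.rpow_neg h3.le, div_eq_mul_inv]
  norm_cast

/-- A bounded holomorphic family integrates to a holomorphic function. -/
theorem differentiableAt_integral_of_bounded {X : Type*} [MeasurableSpace X] {μ : Measure X}
    [IsFiniteMeasure μ] {ψ : ℂ → X → ℂ} {l₀ : ℂ} {R B : ℝ} (hR : 0 < R)
    (hm : ∀ l ∈ ball l₀ R, AEStronglyMeasurable (ψ l) μ)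
    (hd : ∀ᵐ x ∂μ, DifferentiableOn ℂ (fun l => ψ l x) (ball l₀ R))
    (hb : ∀ᵐ x ∂μ, ∀ l ∈ ball l₀ R, ‖ψ l x‖ ≤ B) :
    DifferentiableAt ℂ (fun l => ∫ x, ψ l x ∂μ) l₀ := by
  have hl₀ : l₀ ∈ ball l₀ R := mem_ball_self hR
  have hm' : AEStronglyMeasurable (fun x => deriv (fun l => ψ l x) l₀) μ := by
    set h : ℕ → ℂ := fun k => ((R / (k + 2) : ℝ) : ℂ) with hh
    have hpos : ∀ k : ℕ, (0 : ℝ) < R / (k + 2) := fun k => by positivity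
    have hlt : ∀ k : ℕ, R / ((k : ℝ) + 2) < R := fun k => by
      rw [div_lt_iff₀ (by positivity)]
      nlinarith [(Nat.cast_nonneg k : (0 : ℝ) ≤ k)]
    have hmem : ∀ k, l₀ + h k ∈ ball l₀ R := fun k => by
      simp only [mem_ball, dist_self_add_left, hh, Complex.norm_real,
        Real.norm_of_nonneg (hpos k).le, hlt k]
    have htend : Tendsto h atTop (𝓝[≠] 0) := by
      refine tendsto_nhdsWithin_iff.2 ⟨?_, Eventually.of_forall fun k => ?_⟩
      · have h1 : Tendsto (fun k : ℕ => R / ((k : ℝ) + 2)) atTop (𝓝 0) :=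
          tendsto_const_nhds.div_atTop
            (tendsto_atTop_add_const_right _ _ tendsto_natCast_atTop_atTop)
        have := (Complex.continuous_ofReal.tendsto 0).comp h1
        simpa [hh, Function.comp_def] using this
      · simpa [hh, -Complex.ofReal_div] using (hpos k).ne'
    refine aestronglyMeasurable_of_tendsto_ae atTop
      (f := fun k x => (h k)⁻¹ * (ψ (l₀ + h k) x - ψ l₀ x)) (fun k => ?_) ?_
    · exact ((hm _ (hmem k)).sub (hm _ hl₀)).const_mul _
    · filter_upwards [hd] with x hx
      have := ((hx l₀ hl₀).differentiableAt (ball_mem_nhds _ hR)).hasDerivAt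
      exact (hasDerivAt_iff_tendsto_slope_zero.1 this).comp htend
  refine (hasDerivAt_integral_of_dominated_loc_of_deriv_le (𝕜 := ℂ) (μ := μ)
    (F := ψ) (F' := fun l x => deriv (fun l => ψ l x) l) (bound := fun _ => B / (R / 3))
    (s := ball l₀ (R / 2)) (ball_mem_nhds _ (by positivity)) ?_ ?_ hm' ?_ (integrable_const _)
    ?_).2.differentiableAt
  · exact Filter.eventually_of_mem (ball_mem_nhds _ hR) hm
  · exact Integrable.of_bound (hm _ hl₀) B (hb.mono fun x hx => hx _ hl₀)
  · filter_upwards [hd, hb] with x hx hbx l hl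
    have hsub : closedBall l (R / 3) ⊆ ball l₀ R := fun y hy => by
      have h1 : dist y l ≤ R / 3 := hy
      have h2 : dist l l₀ < R / 2 := hl
      have := dist_triangle y l l₀
      rw [mem_ball]
      linarith
    refine Complex.norm_deriv_le_of_forall_mem_sphere_norm_le (by positivity) ?_ ?_
    · exact ((hx.mono hsub).diffContOnCl_ball subset_rfl)
    · exact fun z hz => hbx _ (hsub (sphere_subset_closedBall hz))
  · filter_upwards [hd] with x hx l hl
    exact ((hx l (ball_subset_ball (by linarith) hl)).differentiableAt
      (isOpen_ball.mem_nhds (ball_subset_ball (by linarith) hl))).hasDerivAt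

/-- Cauchy's formula for the derivative as a circle mean. -/
theorem integral_muT_div_eq_deriv {φ : ℂ → ℂ} {δ R : ℝ} (hδ : 0 < δ) (hδR : δ < R)
    (hφ : DifferentiableOn ℂ φ (ball 0 R)) :
    ∫ x, φ (δ * eT x) / (δ * eT x) ∂muT = deriv φ 0 := by
  rw [integral_muT_eq (fun z => φ z / z) δ, Real.circleAverage_eq_circleIntegral hδ.ne',
    ← Complex.two_pi_I_inv_smul_circleIntegral_sub_sq_inv_smul_of_differentiable isOpen_ball
      (closedBall_subset_ball hδR) hφ (mem_ball_self hδ)]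
  congr 1
  refine circleIntegral.integral_congr hδ.le fun z hz => ?_
  simp only [sub_zero, smul_eq_mul]
  rw [div_eq_inv_mul, ← mul_assoc, sq, mul_inv]

section

variable {n : ℕ} {g f : En n → ℂ}

theorem exists_bound_closedBall (hf : DifferentiableOn ℂ f (Bn n)) {ρ : ℝ} (hρ : ρ < 1) :
    ∃ M, 0 ≤ M ∧ ∀ z, ‖z‖ ≤ ρ → ‖f z‖ ≤ M := by
  obtain ⟨M, hM⟩ := (isCompact_closedBall (0 : En n) ρ).exists_bound_of_continuousOn
    (hf.continuousOn.mono (closedBall_subset_ball hρ))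
  exact ⟨max M 0, le_max_right _ _, fun z hz =>
    (hM z (mem_closedBall_zero_iff.2 hz)).trans (le_max_left _ _)⟩

theorem hasDerivAt_line (hg : DifferentiableOn ℂ g (Bn n)) {y : En n} (hy : ‖y‖ < 1) (v : En n) :
    HasDerivAt (fun l : ℂ => g (y + l • v)) (fderiv ℂ g y v) 0 := by
  have h1 : HasFDerivAt g (fderiv ℂ g y) (y + (0 : ℂ) • v) := by
    rw [zero_smul, add_zero]
    exact (hg.differentiableAt (isOpen_ball.mem_nhds (mem_ball_zero_iff.2 hy))).hasFDerivAt
  have h2 : HasDerivAt (fun l : ℂ => y + l • v) v 0 := by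
    simpa using ((hasDerivAt_id (0 : ℂ)).smul_const v).const_add y
  exact h1.comp_hasDerivAt 0 h2

theorem exists_fderiv_bound (hg : DifferentiableOn ℂ g (Bn n)) {ρ : ℝ} (hρ : ρ < 1) :
    ∃ B, 0 ≤ B ∧ ∀ y, ‖y‖ ≤ ρ → ∀ v, ‖fderiv ℂ g y v‖ ≤ B * ‖v‖ := by
  obtain ⟨M, hM0, hM⟩ := exists_bound_closedBall hg (ρ := (1 + ρ) / 2) (by linarith)
  refine ⟨M / ((1 - ρ) / 2), div_nonneg hM0 (by linarith), fun y hy v => ?_⟩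
  rcases eq_or_ne v 0 with rfl | hv
  · simp
  have hv0 : 0 < ‖v‖ := norm_pos_iff.2 hv
  set R := (1 - ρ) / 2 / ‖v‖ with hR
  have hR0 : 0 < R := div_pos (by linarith) hv0
  have hin : ∀ l ∈ closedBall (0 : ℂ) R, ‖y + l • v‖ ≤ (1 + ρ) / 2 := by
    intro l hl
    have h1 : ‖l‖ * ‖v‖ ≤ (1 - ρ) / 2 := by
      rw [← le_div_iff₀ hv0]
      exact mem_closedBall_zero_iff.1 hl
    calc ‖y + l • v‖ ≤ ‖y‖ + ‖l‖ * ‖v‖ := (norm_add_le _ _).trans_eq (by rw [norm_smul])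
      _ ≤ _ := by linarith
  rw [← (hasDerivAt_line hg (by linarith) v).deriv]
  refine (Complex.norm_deriv_le_of_forall_mem_sphere_norm_le (C := M) hR0 ?_ fun l hl =>
    hM _ (hin l (sphere_subset_closedBall hl))).trans_eq ?_
  · refine DifferentiableOn.diffContOnCl_ball (U := closedBall 0 R) ?_ subset_rfl
    exact (lineHol_of_differentiableOn hg y v).mono fun l hl =>
      mem_ball_zero_iff.2 ((hin l hl).trans_lt (by linarith))
  · rw [hR, div_div_eq_mul_div]
    ring

/-- Directional derivatives of holomorphic functions are holomorphic along lines. -/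
theorem differentiableAt_fderiv_line (hg : DifferentiableOn ℂ g (Bn n)) (a w v : En n) {l₀ : ℂ}
    (h : ‖a + l₀ • w‖ < 1) :
    DifferentiableAt ℂ (fun l : ℂ => fderiv ℂ g (a + l • w) v) l₀ := by
  set ρ := ‖a + l₀ • w‖ with hρ
  set d := (1 - ρ) / 4 with hd
  have hd0 : 0 < d := by linarith
  set δ := d / (‖v‖ + 1) with hδ
  have hδ0 : 0 < δ := by positivity
  set R := d / (‖w‖ + 1) with hR
  have hR0 : 0 < R := by positivity
  have hδv : δ * ‖v‖ ≤ d := by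
    rw [hδ, div_mul_eq_mul_div, div_le_iff₀ (by positivity)]
    nlinarith
  have hRw : R * ‖w‖ ≤ d := by
    rw [hR, div_mul_eq_mul_div, div_le_iff₀ (by positivity)]
    nlinarith
  have hin : ∀ l ∈ ball l₀ R, ∀ m ∈ ball (0 : ℂ) (2 * δ), ‖a + l • w + m • v‖ ≤ ρ + 3 * d := by
    intro l hl m hm
    have e : a + l • w + m • v = (a + l₀ • w) + ((l - l₀) • w + m • v) := by
      rw [sub_smul]; abel
    have hl' : ‖l - l₀‖ ≤ R := by
      rw [← dist_eq_norm]; exact (mem_ball.1 hl).le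
    have hm' : ‖m‖ ≤ 2 * δ := (mem_ball_zero_iff.1 hm).le
    rw [e]
    calc _ ≤ ‖a + l₀ • w‖ + (‖(l - l₀) • w‖ + ‖m • v‖) :=
          (norm_add_le _ _).trans (add_le_add_right (norm_add_le _ _) _)
      _ = ρ + (‖l - l₀‖ * ‖w‖ + ‖m‖ * ‖v‖) := by rw [norm_smul, norm_smul]
      _ ≤ ρ + (R * ‖w‖ + 2 * δ * ‖v‖) := by gcongr
      _ ≤ _ := by linarith
  have hlt : ρ + 3 * d < 1 := by rw [hd]; linarith
  obtain ⟨M, hM0, hM⟩ := exists_bound_closedBall hg hlt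
  have hmem : ∀ x : TT, (δ : ℂ) * eT x ∈ ball (0 : ℂ) (2 * δ) := fun x => by
    rw [mem_ball_zero_iff, norm_mul, norm_eT, Complex.norm_real, Real.norm_of_nonneg hδ0.le]
    linarith
  have heq : (fun l : ℂ => fderiv ℂ g (a + l • w) v) =ᶠ[𝓝 l₀] fun l =>
      ∫ x, g (a + l • w + ((δ : ℂ) * eT x) • v) / (δ * eT x) ∂muT := by
    refine Filter.eventually_of_mem (ball_mem_nhds l₀ hR0) fun l hl => ?_
    have h1 : ‖a + l • w‖ < 1 := by
      have := hin l hl 0 (mem_ball_self (by positivity))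
      rw [zero_smul, add_zero] at this
      linarith
    beta_reduce
    rw [← (hasDerivAt_line hg h1 v).deriv]
    refine (integral_muT_div_eq_deriv (φ := fun m => g (a + l • w + m • v)) hδ0
      (R := 2 * δ) (by linarith) ?_).symm
    exact (lineHol_of_differentiableOn hg _ v).mono fun m hm =>
      mem_ball_zero_iff.2 ((hin l hl m hm).trans_lt hlt)
  refine DifferentiableAt.congr_of_eventuallyEq ?_ heq
  refine differentiableAt_integral_of_bounded (B := M / δ) hR0 (fun l hl => ?_)
    (Eventually.of_forall fun x l hl => ?_) (Eventually.of_forall fun x l hl => ?_)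
  · refine Continuous.aestronglyMeasurable ?_
    have hc := continuous_eT
    refine Continuous.div ?_ (by fun_prop) fun x => ?_
    · refine hg.continuousOn.comp_continuous (by fun_prop) fun x => ?_
      exact mem_ball_zero_iff.2 ((hin l hl _ (hmem x)).trans_lt hlt)
    · exact norm_ne_zero_iff.1 (by simp [norm_eT, hδ0.ne'])
  · refine DifferentiableAt.differentiableWithinAt (DifferentiableAt.div_const ?_ _)
    have h1 : ‖a + l • w + ((δ : ℂ) * eT x) • v‖ < 1 := (hin l hl _ (hmem x)).trans_lt hlt
    have h2 := hg.differentiableAt (isOpen_ball.mem_nhds (mem_ball_zero_iff.2 h1))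
    exact DifferentiableAt.comp l h2 (by fun_prop)
  · rw [norm_div, norm_mul, norm_eT, mul_one, Complex.norm_real, Real.norm_of_nonneg hδ0.le]
    gcongr
    exact hM _ (hin l hl _ (hmem x))

end

section

variable {n : ℕ} {g f : En n → ℂ}

theorem radD_smul_div (g : En n → ℂ) (z : En n) {t : ℝ} (ht : t ≠ 0) :
    radD g (t • z) / (t : ℂ) = fderiv ℂ g (t • z) z := by
  have h : t • z = (t : ℂ) • z := rfl
  have ht' : (t : ℂ) ≠ 0 := by exact_mod_cast ht
  rw [radD]
  conv_lhs => rw [h, map_smul, smul_eq_mul, mul_div_cancel_left₀ _ ht']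
  rfl

theorem J_eq (g f : En n → ℂ) (z : En n) :
    J g f z = ∫ t in Ioo (0 : ℝ) 1, f (t • z) * fderiv ℂ g (t • z) z := by
  refine setIntegral_congr_fun measurableSet_Ioo fun t ht => ?_
  beta_reduce
  rw [mul_div_assoc, radD_smul_div g z ht.1.ne']

theorem J_smul (g f : En n → ℂ) (z : En n) (s : ℝ) :
    J g f (s • z) = ∫ u in (0 : ℝ)..s, f (u • z) * fderiv ℂ g (u • z) z := by
  have h := intervalIntegral.smul_integral_comp_mul_left (a := 0) (b := 1)
    (fun u : ℝ => f (u • z) * fderiv ℂ g (u • z) z) s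
  rw [mul_zero, mul_one] at h
  rw [J_eq, ← h, ← intervalIntegral.integral_smul, intervalIntegral.integral_of_le zero_le_one,
    integral_Ioc_eq_integral_Ioo]
  refine setIntegral_congr_fun measurableSet_Ioo fun t _ => ?_
  beta_reduce
  have h1 : t • s • z = (s * t) • z := by rw [smul_smul, mul_comm]
  have h2 : ∀ L : En n →L[ℂ] ℂ, L (s • z) = (s : ℂ) * L z := fun L => by
    have : s • z = (s : ℂ) • z := rfl
    rw [this, map_smul, smul_eq_mul]
  rw [h1, h2, Complex.real_smul]
  ring

theorem measurable_fderiv_smul (g : En n → ℂ) :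
    Measurable fun y : En n × ℝ => fderiv ℂ g (y.2 • y.1) y.1 := by
  have h : ∀ y : En n × ℝ, fderiv ℂ g (y.2 • y.1) y.1 =
      ∑ i, y.1 i * fderiv ℂ g (y.2 • y.1) (EuclideanSpace.single i 1) := by
    intro y
    have h1 : y.1 = ∑ i, y.1 i • EuclideanSpace.single i (1 : ℂ) := by
      ext j
      simp [Pi.single_apply]
    generalize fderiv ℂ g (y.2 • y.1) = L
    conv_lhs => rw [h1, map_sum]
    simp only [map_smul, smul_eq_mul]
  simp_rw [h]
  refine Finset.measurable_sum _ fun i _ => ?_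
  exact Measurable.mul (by fun_prop) ((measurable_fderiv_apply_const ℂ g _).comp (by fun_prop))

theorem measurable_J (g : En n → ℂ) (hf : Measurable f) : Measurable (J g f) := by
  have : J g f = fun z => ∫ t in Ioo (0 : ℝ) 1, f (t • z) * fderiv ℂ g (t • z) z := by
    ext z; exact J_eq g f z
  rw [this]
  have hm : Measurable fun y : En n × ℝ => f (y.2 • y.1) * fderiv ℂ g (y.2 • y.1) y.1 :=
    (hf.comp (by fun_prop)).mul (measurable_fderiv_smul g)
  exact (hm.stronglyMeasurable.integral_prod_right (ν := volume.restrict (Ioo 0 1))).measurable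

theorem lineHol_J (hg : DifferentiableOn ℂ g (Bn n)) (hf : DifferentiableOn ℂ f (Bn n)) :
    LineHol (J g f) := by
  intro a w l₀ hl₀
  have hl : ‖a + l₀ • w‖ < 1 := mem_ball_zero_iff.1 hl₀
  set ρ := ‖a + l₀ • w‖ with hρ
  set d := (1 - ρ) / 2 with hd
  have hd0 : 0 < d := by linarith
  set R := d / (‖w‖ + 1) with hR
  have hR0 : 0 < R := by positivity
  have hRw : R * ‖w‖ ≤ d := by
    rw [hR, div_mul_eq_mul_div, div_le_iff₀ (by positivity)]
    nlinarith
  have hlt : ρ + d < 1 := by rw [hd]; linarith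
  have hin : ∀ l ∈ ball l₀ R, ‖a + l • w‖ ≤ ρ + d := by
    intro l hl
    have e : a + l • w = (a + l₀ • w) + (l - l₀) • w := by
      rw [sub_smul]; abel
    have hl' : ‖l - l₀‖ ≤ R := by
      rw [← dist_eq_norm]; exact (mem_ball.1 hl).le
    rw [e]
    calc _ ≤ ‖a + l₀ • w‖ + ‖l - l₀‖ * ‖w‖ := (norm_add_le _ _).trans_eq (by rw [norm_smul])
      _ ≤ ρ + R * ‖w‖ := by gcongr
      _ ≤ _ := by linarith
  have hint : ∀ t ∈ Ioo (0 : ℝ) 1, ∀ z : En n, ‖z‖ ≤ ρ + d → ‖t • z‖ ≤ ρ + d := by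
    intro t ht z hz
    rw [norm_smul, Real.norm_of_nonneg ht.1.le]
    nlinarith [ht.1, ht.2, norm_nonneg z]
  obtain ⟨M, hM0, hM⟩ := exists_bound_closedBall hf hlt
  obtain ⟨B, hB0, hB⟩ := exists_fderiv_bound hg hlt
  refine DifferentiableAt.differentiableWithinAt ?_
  have hJ : (fun l : ℂ => J g f (a + l • w)) = fun l : ℂ => ∫ t in Ioo (0 : ℝ) 1,
      f (t • (a + l • w)) * fderiv ℂ g (t • (a + l • w)) (a + l • w) := by
    ext l; exact J_eq g f _
  rw [hJ]
  refine differentiableAt_integral_of_bounded (B := M * (B * 1)) hR0 (fun l hl => ?_)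
    ((ae_restrict_mem measurableSet_Ioo).mono fun t ht l hl => ?_)
    ((ae_restrict_mem measurableSet_Ioo).mono fun t ht l hl => ?_)
  · refine AEStronglyMeasurable.mul ?_ ?_
    · refine ContinuousOn.aestronglyMeasurable ?_ measurableSet_Ioo
      refine hf.continuousOn.comp (by fun_prop) fun t ht => ?_
      exact mem_ball_zero_iff.2 ((hint t ht _ (hin l hl)).trans_lt hlt)
    · exact ((measurable_fderiv_smul g).comp
        (measurable_const.prodMk measurable_id)).aestronglyMeasurable
  · have e : ∀ l : ℂ, t • (a + l • w) = t • a + l • (t • w) := fun l => by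
      rw [smul_add, smul_comm]
    have h1 : ‖t • a + l • (t • w)‖ < 1 := by
      rw [← e]; exact (hint t ht _ (hin l hl)).trans_lt hlt
    refine DifferentiableAt.differentiableWithinAt ?_
    simp only [map_add, map_smul, e]
    refine DifferentiableAt.fun_mul ?_ (DifferentiableAt.fun_add ?_
      (DifferentiableAt.fun_smul ?_ ?_))
    · have h2 := hf.differentiableAt (isOpen_ball.mem_nhds (mem_ball_zero_iff.2 h1))
      exact DifferentiableAt.comp l h2 (by fun_prop)
    · exact differentiableAt_fderiv_line hg _ _ _ h1
    · fun_prop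
    · exact differentiableAt_fderiv_line hg _ _ _ h1
  · have h1 := hint t ht _ (hin l hl)
    rw [norm_mul]
    have h2 : ‖a + l • w‖ ≤ 1 := (hin l hl).trans hlt.le
    gcongr
    · exact hM _ h1
    · exact (hB _ h1 _).trans (by gcongr)

/-- The derivative of `J_g f` along a radius. -/
theorem deriv_J_radial (hg : DifferentiableOn ℂ g (Bn n)) (hf : DifferentiableOn ℂ f (Bn n))
    {a : En n} (ha : ‖a‖ < 1) :
    HasDerivAt (fun l : ℂ => J g f (a + l • a)) (f a * radD g a) 0 := by
  set h : ℝ → ℂ := fun u => f (u • a) * fderiv ℂ g (u • a) a with hh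
  have hcont : ∀ u : ℝ, ‖u • a‖ < 1 → ContinuousAt h u := by
    intro u hu
    have h1 : ‖(0 : En n) + (u : ℂ) • a‖ < 1 := by
      rw [zero_add]; exact hu
    have h2 := (differentiableAt_fderiv_line hg 0 a a h1).continuousAt
    have h3 : ContinuousAt (fun l : ℂ => f (0 + l • a)) (u : ℂ) := by
      have h2 := hf.differentiableAt (isOpen_ball.mem_nhds (mem_ball_zero_iff.2 h1))
      exact (DifferentiableAt.comp (u : ℂ) h2 (by fun_prop)).continuousAt
    have h4 := ContinuousAt.comp (f := fun u : ℝ => (u : ℂ)) (x := u) (h3.mul h2)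
      Complex.continuous_ofReal.continuousAt
    refine h4.congr (Eventually.of_forall fun s => ?_)
    simp only [Function.comp, zero_add, hh, Pi.mul_apply]
    rfl
  have hd : DifferentiableAt ℂ (fun l : ℂ => J g f (a + l • a)) 0 :=
    (lineHol_J hg hf a a).differentiableAt (by
      refine (isOpen_ball.preimage (by fun_prop : Continuous fun l : ℂ => a + l • a)).mem_nhds ?_
      simpa [Bn] using ha)
  have hreal : HasDerivAt (fun s : ℝ => J g f (a + (s : ℂ) • a)) (h 1) 0 := by
    have h1 : HasDerivAt (fun s : ℝ => ∫ u in (0 : ℝ)..s, h u) (h 1) 1 := by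
      refine intervalIntegral.integral_hasDerivAt_right ?_ ?_ (hcont 1 (by simpa using ha))
      · exact ContinuousOn.intervalIntegrable_of_Icc zero_le_one
          fun u hu => (hcont u (by
            rw [norm_smul, Real.norm_of_nonneg hu.1]
            nlinarith [hu.1, hu.2, norm_nonneg a])).continuousWithinAt
      · have ho : IsOpen {u : ℝ | ‖u • a‖ < 1} := isOpen_lt (by fun_prop) continuous_const
        exact ContinuousOn.stronglyMeasurableAtFilter ho
          (fun u hu => (hcont u hu).continuousWithinAt) 1 (by simpa using ha)
    have h2 : HasDerivAt (fun s : ℝ => ∫ u in (0 : ℝ)..(1 + s), h u) (h 1) 0 :=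
      HasDerivAt.comp_const_add (1 : ℝ) 0 (by simpa using h1)
    refine h2.congr_of_eventuallyEq ?_
    refine Eventually.of_forall fun s => ?_
    beta_reduce
    have h3 : a + (s : ℂ) • a = (1 + s) • a := by
      rw [add_smul, one_smul]; rfl
    rw [h3, J_smul g f a]
  have h5 := HasDerivAt.unique (hd.hasDerivAt.comp_ofReal (z := 0)) hreal
  have h6 : h 1 = f a * radD g a := by simp [hh, radD]
  rw [← h6, ← h5]
  simpa using hd.hasDerivAt

end

section

variable {n : ℕ} {g : En n → ℂ}

theorem exists_cauchy_J (hn : 1 ≤ n) {q : ℝ} (hq : 0 < q) (hg : DifferentiableOn ℂ g (Bn n)) :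
    ∃ C : ℝ, 0 ≤ C ∧ ∀ f : En n → ℂ, DifferentiableOn ℂ f (Bn n) → Measurable f →
      hNorm n q (J g f) ≠ ⊤ → ∀ a ∈ Bn n,
        ‖f a * radD g a‖ * ((1 - ‖a‖) / 2) ^ (1 + n / q) ≤ C * (hNorm n q (J g f)).toReal := by
  obtain ⟨C, hC⟩ := exists_growth hn
  refine ⟨(C : ℝ) ^ (1 / q), by positivity, fun f hf hfm hH a ha => ?_⟩
  have ha1 : ‖a‖ < 1 := mem_ball_zero_iff.1 ha
  set N := (hNorm n q (J g f)).toReal with hN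
  have hN0 : 0 ≤ N := ENNReal.toReal_nonneg
  have hHN : hPow n q (J g f) = ENNReal.ofReal (N ^ q) := by
    rw [hPow_eq hq, ← ENNReal.ofReal_rpow_of_nonneg hN0 hq.le, hN, ENNReal.ofReal_toReal hH]
  set δ := (1 - ‖a‖) / 2 with hδ
  have hδ0 : 0 < δ := by linarith
  have hin : ∀ l ∈ closedBall (0 : ℂ) δ, ‖a + l • a‖ ≤ 1 - δ := by
    intro l hl
    have hl' : ‖l‖ ≤ δ := mem_closedBall_zero_iff.1 hl
    calc _ ≤ ‖a‖ + ‖l‖ * ‖a‖ := (norm_add_le _ _).trans_eq (by rw [norm_smul])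
      _ ≤ _ := by nlinarith [norm_nonneg a, norm_nonneg l]
  have hbd : ∀ l ∈ sphere (0 : ℂ) δ,
      ‖J g f (a + l • a)‖ ≤ (C : ℝ) ^ (1 / q) * N * δ ^ (-(n / q)) := by
    intro l hl
    have h1 := hin l (sphere_subset_closedBall hl)
    have h2 := hC q hq _ (lineHol_J hg hf) (measurable_J g hfm) (a + l • a)
      (mem_ball_zero_iff.2 (by linarith))
    rw [hHN, ← ofReal_norm, ENNReal.ofReal_rpow_of_nonneg (norm_nonneg _) hq.le,
      ← ENNReal.ofReal_mul (by positivity), ← ENNReal.ofReal_coe_nnreal,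
      ← ENNReal.ofReal_mul (by positivity), ENNReal.ofReal_le_ofReal_iff (by positivity)] at h2
    have h3 : ‖J g f (a + l • a)‖ ^ q * δ ^ n ≤ C * N ^ q := by
      refine le_trans ?_ h2
      gcongr
      linarith
    have h4 : ‖J g f (a + l • a)‖ ^ q ≤ ((C : ℝ) ^ (1 / q) * N * δ ^ (-(n / q))) ^ q := by
      rw [Real.mul_rpow (by positivity) (by positivity), Real.mul_rpow (by positivity) hN0,
        ← Real.rpow_mul (by positivity), ← Real.rpow_mul hδ0.le, one_div_mul_cancel hq.ne',
        Real.rpow_one, neg_mul, div_mul_cancel₀ _ hq.ne', Real.rpow_neg hδ0.le, Real.rpow_natCast,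
        ← div_eq_mul_inv, le_div_iff₀ (by positivity)]
      exact h3
    exact (Real.rpow_le_rpow_iff (norm_nonneg _) (by positivity) hq).1 h4
  have hder := deriv_J_radial hg hf ha1
  rw [← hder.deriv]
  have hc := Complex.norm_deriv_le_of_forall_mem_sphere_norm_le hδ0
    (DifferentiableOn.diffContOnCl_ball (U := closedBall 0 δ)
      ((lineHol_J hg hf a a).mono fun l hl =>
        mem_ball_zero_iff.2 ((hin l hl).trans_lt (by linarith)))
      subset_rfl) hbd
  calc _ ≤ (C : ℝ) ^ (1 / q) * N * δ ^ (-(n / q)) / δ * δ ^ (1 + n / q) := by gcongr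
    _ = (C : ℝ) ^ (1 / q) * N * (δ ^ (-(n / q)) * δ ^ (n / q)) := by
      rw [Real.rpow_add hδ0, Real.rpow_one]
      field_simp
    _ = _ := by
      rw [← Real.rpow_add hδ0]
      simp

theorem measurable_testF (n : ℕ) (p : ℝ) (a : En n) : Measurable (testF n p a) := by
  unfold testF herm
  fun_prop

theorem tendstoUniformlyOn_testF {p : ℝ} (hn : 1 ≤ n) (hp : 0 < p) {a : ℕ → En n}
    (ha : ∀ k, a k ∈ Bn n)
    (h : Tendsto (fun k => 1 - ‖a k‖ ^ 2) atTop (𝓝 0)) {K : Set (En n)} (hK : K ⊆ Bn n)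
    (hKc : IsCompact K) : TendstoUniformlyOn (fun k => testF n p (a k)) 0 atTop K := by
  have hn0 : (0 : ℝ) < n := by exact_mod_cast hn
  obtain ⟨ρ, hρ1, hρ⟩ : ∃ ρ < 1, ∀ z ∈ K, ‖z‖ ≤ ρ := by
    rcases K.eq_empty_or_nonempty with rfl | hne
    · exact ⟨0, by norm_num, by simp⟩
    · obtain ⟨z, hz, hmax⟩ := hKc.exists_isMaxOn hne continuous_norm.continuousOn
      exact ⟨‖z‖, mem_ball_zero_iff.1 (hK hz), fun w hw => hmax hw⟩
  rw [Metric.tendstoUniformlyOn_iff]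
  intro ε hε
  have h2 : Tendsto (fun k => (1 - ‖a k‖ ^ 2) ^ (n / p) * (1 - ρ) ^ (-(2 * n / p)))
      atTop (𝓝 0) := by
    have h3 := (h.rpow_const (p := n / p) (Or.inr (by positivity))).mul_const
      ((1 - ρ) ^ (-(2 * n / p)))
    rwa [Real.zero_rpow (by positivity), zero_mul] at h3
  filter_upwards [h2.eventually_lt_const hε] with k hk z hz
  rw [Pi.zero_apply, dist_zero_left]
  exact (norm_testF_le hp (mem_ball_zero_iff.1 (ha k)) (hρ z hz) hρ1).trans_lt hk

theorem little_lipschitz_of_compact (hn : 1 ≤ n) {p q α : ℝ} (hp : 0 < p) (hpq : p < q)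
    (hα : α = n * (1 / p - 1 / q)) (hg : DifferentiableOn ℂ g (Bn n))
    (H : ∀ f : ℕ → En n → ℂ, (∀ k, MemHp n p (f k)) →
      (∃ M : ℝ≥0∞, M < ⊤ ∧ ∀ k, hNorm n p (f k) ≤ M) →
      (∀ K ⊆ Bn n, IsCompact K → TendstoUniformlyOn (fun k => f k) 0 atTop K) →
      Tendsto (fun k => hNorm n q (J g (f k))) atTop (𝓝 0)) :
    ∀ ε > 0, ∃ r ∈ Ioo (0 : ℝ) 1, ∀ z ∈ Bn n, r < ‖z‖ →
      (1 - ‖z‖ ^ 2) ^ (1 - α) * ‖radD g z‖ < ε := by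
  have hq : 0 < q := hp.trans hpq
  by_contra! hcon
  obtain ⟨ε, hε, hcon⟩ := hcon
  have hr : ∀ k : ℕ, (1 : ℝ) - 1 / (k + 2) ∈ Ioo (0 : ℝ) 1 := fun k => by
    have h2 : (0 : ℝ) < 1 / (k + 2) := by positivity
    have h3 : (1 : ℝ) / (k + 2) < 1 := by
      rw [div_lt_one (by positivity)]
      linarith [(Nat.cast_nonneg k : (0 : ℝ) ≤ k)]
    exact ⟨by linarith, by linarith⟩
  choose a ha har hae using fun k : ℕ => hcon _ (hr k)
  have ha1 : ∀ k, ‖a k‖ < 1 := fun k => mem_ball_zero_iff.1 (ha k)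
  have hs0 : ∀ k, 0 < 1 - ‖a k‖ ^ 2 := fun k => by nlinarith [ha1 k, norm_nonneg (a k)]
  have hs : Tendsto (fun k => 1 - ‖a k‖ ^ 2) atTop (𝓝 0) := by
    have h1 : Tendsto (fun k : ℕ => 2 / ((k : ℝ) + 2)) atTop (𝓝 0) :=
      tendsto_const_nhds.div_atTop
        (tendsto_atTop_add_const_right _ _ tendsto_natCast_atTop_atTop)
    refine squeeze_zero (fun k => (hs0 k).le) (fun k => ?_) h1
    have h2 : (2 : ℝ) / (k + 2) = 2 * (1 / (k + 2)) := by ring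
    nlinarith [ha1 k, norm_nonneg (a k), har k]
  obtain ⟨C, hC⟩ := exists_hPow_testF_le hn hp
  obtain ⟨D, hD0, hD⟩ := exists_cauchy_J hn hq hg
  have hdiff : ∀ k, DifferentiableOn ℂ (testF n p (a k)) (Bn n) := fun k =>
    differentiableOn_testF (ha1 k)
  have hbound : ∀ k, hNorm n p (testF n p (a k)) ≤ (C : ℝ≥0∞) ^ (1 / p) := fun k =>
    ENNReal.rpow_le_rpow (hC _ (ha k)) (by positivity)
  have hfin : (C : ℝ≥0∞) ^ (1 / p) < ⊤ :=
    ENNReal.rpow_lt_top_of_nonneg (by positivity) ENNReal.coe_ne_top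
  have hT := H (fun k => testF n p (a k)) (fun k => ⟨hdiff k, (hbound k).trans_lt hfin⟩)
    ⟨_, hfin, hbound⟩ fun K hK hKc => tendstoUniformlyOn_testF hn hp ha hs hK hKc
  have hT2 : Tendsto (fun k => 4 ^ (1 + n / q) * (D * (hNorm n q (J g (testF n p (a k)))).toReal))
      atTop (𝓝 0) := by
    have := (((ENNReal.tendsto_toReal ENNReal.zero_ne_top).comp hT).const_mul D).const_mul
      ((4 : ℝ) ^ (1 + n / q))
    simpa using this
  obtain ⟨k, hk1, hk2⟩ := ((hT.eventually_lt_const ENNReal.zero_lt_top).and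
    (hT2.eventually_lt_const hε)).exists
  have h1 := hD _ (hdiff k) (measurable_testF n p (a k)) hk1.ne (a k) (ha k)
  set s := 1 - ‖a k‖ ^ 2 with hsdef
  have hsk : 0 < s := hs0 k
  have h2 : (s / 4) ^ (1 + n / q) ≤ ((1 - ‖a k‖) / 2) ^ (1 + n / q) :=
    Real.rpow_le_rpow (by positivity) (by nlinarith [ha1 k, norm_nonneg (a k)]) (by positivity)
  have h3 : s ^ (1 - α) * ‖radD g (a k)‖ =
      4 ^ (1 + n / q) * (‖testF n p (a k) (a k) * radD g (a k)‖ * (s / 4) ^ (1 + n / q)) := by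
    rw [norm_mul, norm_testF_self (ha1 k), Real.div_rpow hsk.le (by norm_num)]
    have h4 : s ^ (1 - α) = s ^ (-(n / p)) * s ^ (1 + n / q) := by
      rw [← Real.rpow_add hsk, hα]
      congr 1
      ring
    rw [h4, hsdef]
    field_simp
  have h5 := hae k
  rw [← hsdef, h3] at h5
  refine absurd (h5.trans ?_) (not_le.2 hk2)
  exact mul_le_mul_of_nonneg_left ((mul_le_mul_of_nonneg_left h2 (norm_nonneg _)).trans h1)
    (by positivity)

end

theorem setLIntegral_Ioc_rpow {b x₀ : ℝ} (hb : 0 < b) (hx : 0 < x₀) :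
    ∫⁻ x in Ioc 0 x₀, ENNReal.ofReal (x ^ (b - 1)) = ENNReal.ofReal (x₀ ^ b / b) := by
  have hi : IntervalIntegrable (fun x : ℝ => x ^ (b - 1)) volume 0 x₀ :=
    intervalIntegral.intervalIntegrable_rpow' (by linarith)
  rw [← ofReal_integral_eq_lintegral_ofReal
    ((intervalIntegrable_iff_integrableOn_Ioc_of_le hx.le).1 hi)
    ((ae_restrict_mem measurableSet_Ioc).mono fun x hx => Real.rpow_nonneg hx.1.le _),
    ← intervalIntegral.integral_of_le hx.le, integral_rpow (Or.inl (by linarith))]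
  simp [Real.zero_rpow hb.ne']

theorem setLIntegral_Ioi_rpow {b x₀ : ℝ} (hb : 0 < b) (hx : 0 < x₀) :
    ∫⁻ x in Ioi x₀, ENNReal.ofReal (x ^ (-b - 1)) = ENNReal.ofReal (x₀ ^ (-b) / b) := by
  rw [← ofReal_integral_eq_lintegral_ofReal (integrableOn_Ioi_rpow_of_lt (by linarith) hx)
    ((ae_restrict_mem measurableSet_Ioi).mono fun x hx' =>
      Real.rpow_nonneg (hx.trans hx').le _), integral_Ioi_rpow_of_lt (by linarith) hx]
  simp [div_neg, neg_div]

/-- Hedberg's interpolation between a maximal function and a growth bound. -/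
theorem hedberg_real {α β A L : ℝ} (hα : 0 < α) (hβ : 0 < β) (hA : 0 < A) (hL : 0 < L) :
    ∫⁻ x in Ioi (0 : ℝ), ENNReal.ofReal (min A (L * x ^ (-(α + β))) * x ^ (α - 1)) ≤
      ENNReal.ofReal ((1 / α + 1 / β) * (A ^ (β / (α + β)) * L ^ (α / (α + β)))) := by
  have hs : 0 < α + β := by linarith
  set x₀ := (L / A) ^ (1 / (α + β)) with hx₀
  have hx0 : 0 < x₀ := by positivity
  rw [← Ioc_union_Ioi_eq_Ioi hx0.le, add_mul,
    ENNReal.ofReal_add (by positivity) (by positivity)]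
  refine (lintegral_union_le _ _ _).trans (add_le_add ?_ ?_)
  · calc _ ≤ ∫⁻ x in Ioc 0 x₀, ENNReal.ofReal A * ENNReal.ofReal (x ^ (α - 1)) := by
          refine setLIntegral_mono_ae' measurableSet_Ioc (Eventually.of_forall fun x hx => ?_)
          rw [← ENNReal.ofReal_mul hA.le]
          have := hx.1
          gcongr
          exact min_le_left _ _
      _ = ENNReal.ofReal (A * (x₀ ^ α / α)) := by
          rw [lintegral_const_mul _ (by fun_prop), setLIntegral_Ioc_rpow hα hx0,
            ENNReal.ofReal_mul hA.le]
      _ ≤ _ := by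
          refine ENNReal.ofReal_le_ofReal (le_of_eq ?_)
          have h1 : A = A ^ (β / (α + β)) * A ^ (α / (α + β)) := by
            rw [← Real.rpow_add hA, ← add_div, add_comm β, div_self hs.ne', Real.rpow_one]
          have h2 : x₀ ^ α = L ^ (α / (α + β)) / A ^ (α / (α + β)) := by
            rw [hx₀, ← Real.rpow_mul (by positivity), Real.div_rpow hL.le hA.le]
            congr 2 <;> ring
          rw [h2]
          nth_rewrite 1 [h1]
          have : A ^ (α / (α + β)) ≠ 0 := by positivity
          field_simp
  · calc _ ≤ ∫⁻ x in Ioi x₀, ENNReal.ofReal L * ENNReal.ofReal (x ^ (-β - 1)) := by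
          refine setLIntegral_mono_ae' measurableSet_Ioi (Eventually.of_forall fun x hx => ?_)
          have hx1 : 0 < x := hx0.trans hx
          rw [← ENNReal.ofReal_mul hL.le]
          refine ENNReal.ofReal_le_ofReal ?_
          have e : x ^ (-β - 1) = x ^ (-(α + β)) * x ^ (α - 1) := by
            rw [← Real.rpow_add hx1]; congr 1; ring
          rw [e, ← mul_assoc]
          gcongr
          exact min_le_right _ _
      _ = ENNReal.ofReal (L * (x₀ ^ (-β) / β)) := by
          rw [lintegral_const_mul _ (by fun_prop), setLIntegral_Ioi_rpow hβ hx0,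
            ENNReal.ofReal_mul hL.le]
      _ ≤ _ := by
          refine ENNReal.ofReal_le_ofReal (le_of_eq ?_)
          have h1 : L = L ^ (β / (α + β)) * L ^ (α / (α + β)) := by
            rw [← Real.rpow_add hL, ← add_div, add_comm β, div_self hs.ne', Real.rpow_one]
          have h2 : x₀ ^ (-β) = A ^ (β / (α + β)) / L ^ (β / (α + β)) := by
            rw [Real.rpow_neg hx0.le, hx₀, ← Real.rpow_mul (by positivity),
              Real.div_rpow hL.le hA.le, inv_div]
            congr 2 <;> ring
          rw [h2]
          nth_rewrite 1 [h1]
          have : L ^ (β / (α + β)) ≠ 0 := by positivity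
          field_simp

theorem hedberg {α β L : ℝ} {A : ℝ≥0∞} (hα : 0 < α) (hβ : 0 < β) (hL : 0 < L) {h : ℝ → ℂ}
    (h1 : ∀ u ∈ Ioo (0 : ℝ) 1, ‖h u‖ₑ ≤ A)
    (h2 : ∀ u ∈ Ioo (0 : ℝ) 1, ‖h u‖ ≤ L * (1 - u) ^ (-(α + β))) :
    ∫⁻ u in Ioo (0 : ℝ) 1, ‖h u‖ₑ * ENNReal.ofReal ((1 - u) ^ (α - 1)) ≤
      ENNReal.ofReal ((1 / α + 1 / β) * L ^ (α / (α + β))) * A ^ (β / (α + β)) := by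
  have hc : 0 < (1 / α + 1 / β) * L ^ (α / (α + β)) := by positivity
  have he : 0 < β / (α + β) := by positivity
  rcases eq_or_ne A ⊤ with rfl | hAt
  · rw [ENNReal.top_rpow_of_pos he, ENNReal.mul_top (by simpa using hc)]
    exact le_top
  rcases eq_or_ne A 0 with rfl | hA0
  · refine le_trans (le_of_eq ?_) zero_le
    rw [← lintegral_zero (μ := volume.restrict (Ioo (0 : ℝ) 1))]
    refine setLIntegral_congr_fun measurableSet_Ioo fun u hu => ?_
    rw [le_antisymm (h1 u hu) zero_le, zero_mul]
  have hA : 0 < A.toReal := ENNReal.toReal_pos hA0 hAt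
  set φ : ℝ → ℝ≥0∞ := (Ioi (0 : ℝ)).indicator fun x =>
    ENNReal.ofReal (min A.toReal (L * x ^ (-(α + β))) * x ^ (α - 1)) with hφ
  calc _ ≤ ∫⁻ u in Ioo (0 : ℝ) 1, φ (1 - u) := by
        refine setLIntegral_mono_ae' measurableSet_Ioo (Eventually.of_forall fun u hu => ?_)
        have hu1 : 0 < 1 - u := by linarith [hu.2]
        rw [hφ, indicator_of_mem (mem_Ioi.2 hu1), ← ofReal_norm,
          ← ENNReal.ofReal_mul (norm_nonneg _)]
        gcongr
        refine le_min ?_ (h2 u hu)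
        rw [← toReal_enorm]
        exact ENNReal.toReal_mono hAt (h1 u hu)
    _ ≤ ∫⁻ u, φ (1 - u) := setLIntegral_le_lintegral _ _
    _ = ∫⁻ x, φ x := lintegral_sub_left_eq_self φ 1
    _ ≤ ENNReal.ofReal ((1 / α + 1 / β) *
          (A.toReal ^ (β / (α + β)) * L ^ (α / (α + β)))) := by
        rw [hφ, lintegral_indicator measurableSet_Ioi]
        exact hedberg_real hα hβ hA hL
    _ = _ := by
        rw [mul_comm (A.toReal ^ _), ← mul_assoc, ENNReal.ofReal_mul hc.le,
          ← ENNReal.ofReal_rpow_of_nonneg hA.le he.le, ENNReal.ofReal_toReal hAt]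

section

variable {n : ℕ} {g f : En n → ℂ}

theorem enorm_J_smul_le {α B η τ r₀ r : ℝ} (hα1 : α < 1) (hr₀ : 1 / 2 ≤ r₀)
    (hη0 : 0 ≤ η) (hB : ∀ y, ‖y‖ ≤ r₀ → ∀ v, ‖fderiv ℂ g y v‖ ≤ B * ‖v‖)
    (hη : ∀ z ∈ Bn n, r₀ < ‖z‖ → (1 - ‖z‖ ^ 2) ^ (1 - α) * ‖radD g z‖ < η)
    (hτ : ∀ z, ‖z‖ ≤ r₀ → ‖f z‖ ≤ τ) {ζ : En n} (hζ : ‖ζ‖ = 1) (hr : r ∈ Ioo (0 : ℝ) 1) :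
    ‖J g f (r • ζ)‖ₑ ≤ ENNReal.ofReal (τ * B) + ENNReal.ofReal (2 * η) *
      ∫⁻ u in Ioo (0 : ℝ) 1, ‖f (u • ζ)‖ₑ * ENNReal.ofReal ((1 - u) ^ (α - 1)) := by
  have hpt : ∀ u ∈ Ioo (0 : ℝ) 1, ‖f (u • ζ) * fderiv ℂ g (u • ζ) ζ‖ₑ ≤
      ENNReal.ofReal (τ * B) +
        ENNReal.ofReal (2 * η) * (‖f (u • ζ)‖ₑ * ENNReal.ofReal ((1 - u) ^ (α - 1))) := by
    intro u hu
    have hnu : ‖u • ζ‖ = u := by rw [norm_smul, hζ, mul_one, Real.norm_of_nonneg hu.1.le]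
    have hu1 : 0 < 1 - u := by linarith [hu.2]
    rcases le_or_gt u r₀ with hur | hur
    · refine le_trans ?_ le_self_add
      rw [← ofReal_norm, norm_mul]
      refine ENNReal.ofReal_le_ofReal ?_
      have h1 := hB (u • ζ) (hnu.trans_le hur) ζ
      rw [hζ, mul_one] at h1
      exact mul_le_mul (hτ _ (hnu.trans_le hur)) h1 (norm_nonneg _)
        ((norm_nonneg _).trans (hτ _ (hnu.trans_le hur)))
    · refine le_trans ?_ le_add_self
      rw [enorm_mul, mul_left_comm, ← ENNReal.ofReal_mul (by positivity)]
      refine mul_le_mul' le_rfl ?_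
      rw [← ofReal_norm]
      refine ENNReal.ofReal_le_ofReal ?_
      have h1 := hη (u • ζ) (mem_ball_zero_iff.2 (hnu.trans_lt hu.2)) (by rwa [hnu])
      rw [hnu] at h1
      have h2 : (1 - u) ^ (1 - α) ≤ (1 - u ^ 2) ^ (1 - α) :=
        Real.rpow_le_rpow hu1.le (by nlinarith [hu.1]) (by linarith)
      have h3 : (1 - u) ^ (1 - α) * ‖radD g (u • ζ)‖ ≤ η :=
        (mul_le_mul_of_nonneg_right h2 (norm_nonneg _)).trans h1.le
      have h4 : (1 - u) ^ (α - 1) = ((1 - u) ^ (1 - α))⁻¹ := by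
        rw [← Real.rpow_neg hu1.le]; congr 1; ring
      have h5 : 0 < (1 - u) ^ (1 - α) := Real.rpow_pos_of_pos hu1 _
      rw [← radD_smul_div g ζ hu.1.ne', norm_div, Complex.norm_real,
        Real.norm_of_nonneg hu.1.le, h4, ← div_eq_mul_inv, div_le_div_iff₀ hu.1 h5]
      nlinarith [hr₀.trans hur.le]
  rw [J_smul, intervalIntegral.integral_of_le hr.1.le]
  calc _ ≤ ∫⁻ u in Ioc 0 r, ‖f (u • ζ) * fderiv ℂ g (u • ζ) ζ‖ₑ :=
        enorm_integral_le_lintegral_enorm _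
    _ ≤ ∫⁻ u in Ioo (0 : ℝ) 1, ‖f (u • ζ) * fderiv ℂ g (u • ζ) ζ‖ₑ :=
        lintegral_mono_set fun u hu => ⟨hu.1, hu.2.trans_lt hr.2⟩
    _ ≤ ∫⁻ u in Ioo (0 : ℝ) 1, (ENNReal.ofReal (τ * B) +
        ENNReal.ofReal (2 * η) * (‖f (u • ζ)‖ₑ * ENNReal.ofReal ((1 - u) ^ (α - 1)))) :=
        setLIntegral_mono_ae' measurableSet_Ioo (Eventually.of_forall hpt)
    _ = _ := by
        rw [lintegral_add_left measurable_const, lintegral_const_mul' _ _ ENNReal.ofReal_ne_top]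
        simp

theorem ENNReal.add_rpow_le {a b : ℝ≥0∞} {q : ℝ} (hq : 0 < q) :
    (a + b) ^ q ≤ 2 ^ q * (a ^ q + b ^ q) := by
  have h : a + b ≤ 2 * max a b := by
    rw [two_mul]; exact add_le_add (le_max_left _ _) (le_max_right _ _)
  refine (ENNReal.rpow_le_rpow h hq.le).trans ?_
  rw [ENNReal.mul_rpow_of_nonneg _ _ hq.le]
  refine mul_le_mul' le_rfl ?_
  rcases max_cases a b with ⟨e, _⟩ | ⟨e, _⟩ <;> rw [e]
  exacts [le_self_add, le_add_self]

theorem norm_smul_le_growth {p u : ℝ} (hp : 0 < p) {K : ℝ≥0} {ζ : En n} (hζ : ‖ζ‖ = 1)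
    (hu : u ∈ Ioo (0 : ℝ) 1)
    (h : ‖f (u • ζ)‖ₑ ^ p * ENNReal.ofReal ((1 - ‖u • ζ‖) ^ n) ≤ K) :
    ‖f (u • ζ)‖ ≤ ((K : ℝ) ^ (1 / p) + 1) * (1 - u) ^ (-(n / p) : ℝ) := by
  have hnu : ‖u • ζ‖ = u := by rw [norm_smul, hζ, mul_one, Real.norm_of_nonneg hu.1.le]
  have hu1 : 0 < 1 - u := by linarith [hu.2]
  rw [hnu, ← ofReal_norm, ENNReal.ofReal_rpow_of_nonneg (norm_nonneg _) hp.le,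
    ← ENNReal.ofReal_mul (by positivity), ENNReal.ofReal_le_iff_le_toReal ENNReal.coe_ne_top,
    ENNReal.coe_toReal] at h
  have h1 : ‖f (u • ζ)‖ * (1 - u) ^ (n / p : ℝ) ≤ (K : ℝ) ^ (1 / p) := by
    have := Real.rpow_le_rpow (by positivity) h (by positivity : 0 ≤ 1 / p)
    rwa [Real.mul_rpow (by positivity) (by positivity), ← Real.rpow_mul (norm_nonneg _),
      mul_one_div_cancel hp.ne', Real.rpow_one, ← Real.rpow_natCast, ← Real.rpow_mul hu1.le,
      mul_one_div] at this
  rw [Real.rpow_neg hu1.le, ← div_eq_mul_inv, le_div_iff₀ (Real.rpow_pos_of_pos hu1 _)]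
  linarith

theorem exists_hPow_J_le (hn : 1 ≤ n) {p q α : ℝ} (hp : 0 < p) (hpq : p < q)
    (hα : α = (n : ℝ) * (1 / p - 1 / q)) (hα1 : α < 1) (P : ℝ≥0) :
    ∃ D : ℝ≥0, ∀ (g f : En n → ℂ) (B η τ r₀ : ℝ), 1 / 2 ≤ r₀ → 0 ≤ η →
      (∀ y, ‖y‖ ≤ r₀ → ∀ v, ‖fderiv ℂ g y v‖ ≤ B * ‖v‖) →
      (∀ z ∈ Bn n, r₀ < ‖z‖ → (1 - ‖z‖ ^ 2) ^ (1 - α) * ‖radD g z‖ < η) →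
      (∀ z, ‖z‖ ≤ r₀ → ‖f z‖ ≤ τ) → DifferentiableOn ℂ f (Bn n) → Measurable f →
      hPow n p f ≤ P →
      hPow n q (J g f) ≤
        2 ^ q * (ENNReal.ofReal (τ * B) ^ q + ENNReal.ofReal (2 * η) ^ q * D) := by
  obtain ⟨C, hC⟩ := exists_growth hn
  have hq : 0 < q := hp.trans hpq
  have hn0 : (0 : ℝ) < n := by exact_mod_cast hn
  have hα0 : 0 < α := by
    rw [hα]
    exact mul_pos hn0 (sub_pos.2 (one_div_lt_one_div_of_lt hp hpq))
  have hβ0 : 0 < n / q := by positivity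
  have hs : α + n / q = n / p := by rw [hα]; field_simp; ring
  have he : n / q / (α + n / q) * q = p := by rw [hs]; field_simp
  set L : ℝ := ((C * P : ℝ≥0) : ℝ) ^ (1 / p) + 1 with hL
  have hL0 : 0 < L := by positivity
  set c : ℝ := (1 / α + 1 / (n / q)) * L ^ (α / (α + n / q)) with hc
  refine ⟨(c.toNNReal ^ q) * (257 * P), fun g f B η τ r₀ hr₀ hη0 hB hη hτ hf hfm hP => ?_⟩
  have := isProbabilityMeasure_sigmaS hn
  refine iSup₂_le fun r hr => ?_
  have hpt : ∀ᵐ ζ ∂(sigmaS n), ‖J g f (r • ζ)‖ₑ ^ q ≤ 2 ^ q * (ENNReal.ofReal (τ * B) ^ q +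
      ENNReal.ofReal (2 * η) ^ q * (ENNReal.ofReal c ^ q * radMax f ζ ^ p)) := by
    filter_upwards [sigmaS_ae_mem n] with ζ hζ
    have hζ1 : ‖ζ‖ = 1 := by simpa [Sn] using hζ
    have h1 := enorm_J_smul_le hα1 hr₀ hη0 hB hη hτ hζ1 hr
    have h2 := hedberg (A := radMax f ζ) hα0 hβ0 hL0 (h := fun u => f (u • ζ))
      (fun u hu => le_iSup₂ (f := fun t (_ : t ∈ Ioo (0 : ℝ) 1) => ‖f (t • ζ)‖ₑ) u hu)
      (fun u hu => by
        rw [hs]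
        refine norm_smul_le_growth hp hζ1 hu ((hC p hp f (lineHol_of_differentiableOn hf) hfm _
          ?_).trans ?_)
        · rw [Bn, mem_ball_zero_iff, norm_smul, hζ1, mul_one, Real.norm_of_nonneg hu.1.le]
          exact hu.2
        · push_cast
          exact mul_le_mul' le_rfl hP)
    refine (ENNReal.rpow_le_rpow (h1.trans (add_le_add le_rfl (mul_le_mul' le_rfl h2)))
      hq.le).trans ((ENNReal.add_rpow_le hq).trans_eq ?_)
    rw [ENNReal.mul_rpow_of_nonneg _ _ hq.le, ENNReal.mul_rpow_of_nonneg _ _ hq.le,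
      ← ENNReal.rpow_mul, he]
  have hfin : ENNReal.ofReal (2 * η) ^ q * ENNReal.ofReal c ^ q ≠ ⊤ :=
    ENNReal.mul_ne_top (ENNReal.rpow_ne_top_of_nonneg hq.le ENNReal.ofReal_ne_top)
      (ENNReal.rpow_ne_top_of_nonneg hq.le ENNReal.ofReal_ne_top)
  have h2q : (2 : ℝ≥0∞) ^ q ≠ ⊤ := ENNReal.rpow_ne_top_of_nonneg hq.le (by norm_num)
  refine (lintegral_mono_ae hpt).trans ?_
  simp_rw [← mul_assoc (ENNReal.ofReal (2 * η) ^ q)]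
  rw [lintegral_const_mul' _ _ h2q, lintegral_add_left measurable_const,
    lintegral_const_mul' _ _ hfin, lintegral_const, measure_univ, mul_one, mul_assoc]
  refine mul_le_mul' le_rfl (add_le_add le_rfl (mul_le_mul' le_rfl ?_))
  rw [ENNReal.coe_mul, ENNReal.coe_mul, ENNReal.coe_rpow_of_nonneg _ hq.le]
  refine mul_le_mul' le_rfl ((lintegral_radMax_le hn hp hf hfm).trans ?_)
  exact mul_le_mul' (by norm_num) hP

theorem J_indicator_smul (g f : En n → ℂ) {ζ : En n} {r : ℝ} (hζ : ‖ζ‖ = 1)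
    (hr : r ∈ Ioo (0 : ℝ) 1) : J g ((Bn n).indicator f) (r • ζ) = J g f (r • ζ) := by
  rw [J_smul, J_smul]
  refine intervalIntegral.integral_congr fun u hu => ?_
  rw [uIcc_of_le hr.1.le] at hu
  beta_reduce
  rw [indicator_of_mem]
  rw [Bn, mem_ball_zero_iff, norm_smul, hζ, mul_one, Real.norm_of_nonneg hu.1]
  exact hu.2.trans_lt hr.2

theorem hPow_congr_sphere {p : ℝ} {F G : En n → ℂ}
    (h : ∀ ζ, ‖ζ‖ = 1 → ∀ r ∈ Ioo (0 : ℝ) 1, F (r • ζ) = G (r • ζ)) :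
    hPow n p F = hPow n p G := by
  refine iSup_congr fun r => iSup_congr fun hr => lintegral_congr_ae ?_
  filter_upwards [sigmaS_ae_mem n] with ζ hζ
  rw [h ζ (by simpa [Sn] using hζ) r hr]

theorem measurable_indicator_ball (hf : DifferentiableOn ℂ f (Bn n)) :
    Measurable ((Bn n).indicator f) := by
  classical
  rw [← piecewise_eq_indicator]
  exact hf.continuousOn.measurable_piecewise continuousOn_const isOpen_ball.measurableSet

theorem compact_of_little_lipschitz (hn : 1 ≤ n) {p q α : ℝ} (hp : 0 < p) (hpq : p < q)
    (hα : α = (n : ℝ) * (1 / p - 1 / q)) (hα1 : α < 1) (hg : DifferentiableOn ℂ g (Bn n))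
    (H : ∀ ε > (0 : ℝ), ∃ r ∈ Ioo (0 : ℝ) 1, ∀ z ∈ Bn n,
        r < ‖z‖ → (1 - ‖z‖ ^ 2) ^ (1 - α) * ‖radD g z‖ < ε)
    {f : ℕ → En n → ℂ} (hf : ∀ k, DifferentiableOn ℂ (f k) (Bn n))
    {M : ℝ≥0∞} (hM : M < ⊤) (hfM : ∀ k, hNorm n p (f k) ≤ M)
    (hf0 : ∀ K : Set (En n), K ⊆ Bn n → IsCompact K →
      TendstoUniformlyOn (fun k => f k) 0 atTop K) :
    Tendsto (fun k => hNorm n q (J g (f k))) atTop (𝓝 0) := by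
  have hq : 0 < q := hp.trans hpq
  obtain ⟨D, hD⟩ := exists_hPow_J_le hn hp hpq hα hα1 (M ^ p).toNNReal
  have hMp : ((M ^ p).toNNReal : ℝ≥0∞) = M ^ p :=
    ENNReal.coe_toNNReal (ENNReal.rpow_ne_top_of_nonneg hp.le hM.ne)
  have h2q : (2 : ℝ≥0∞) ^ q ≠ ⊤ := ENNReal.rpow_ne_top_of_nonneg hq.le (by norm_num)
  have hrp : Tendsto (fun x : ℝ≥0∞ => x ^ q) (𝓝 0) (𝓝 0) := by
    simpa [hq] using (ENNReal.continuous_rpow_const (y := q)).tendsto 0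
  suffices hT : Tendsto (fun k => hPow n q (J g (f k))) atTop (𝓝 0) by
    have h := ((ENNReal.continuous_rpow_const (y := 1 / q)).tendsto 0).comp hT
    rw [ENNReal.zero_rpow_of_pos (by positivity)] at h
    exact h
  have key : ∀ η > (0 : ℝ), ∀ σ > (0 : ℝ), ∀ᶠ k in atTop, hPow n q (J g (f k)) ≤
      2 ^ q * (ENNReal.ofReal σ ^ q + ENNReal.ofReal (2 * η) ^ q * D) := by
    intro η hη σ hσ
    obtain ⟨r₁, hr₁, hr₁g⟩ := H η hη
    set r₀ := max r₁ (1 / 2) with hr₀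
    have hr₀1 : r₀ < 1 := max_lt hr₁.2 (by norm_num)
    obtain ⟨B, hB0, hB⟩ := exists_fderiv_bound hg hr₀1
    have hu := Metric.tendstoUniformlyOn_iff.1 (hf0 (closedBall 0 r₀)
      (closedBall_subset_ball hr₀1) (isCompact_closedBall _ _)) (σ / (B + 1)) (by positivity)
    filter_upwards [hu] with k hk
    have h1 := hD g ((Bn n).indicator (f k)) B η (σ / (B + 1)) r₀ (le_max_right _ _) hη.le hB
      (fun z hz hzr => hr₁g z hz ((le_max_left _ _).trans_lt hzr))
      (fun z hz => by
        have h2 := hk z (mem_closedBall_zero_iff.2 hz)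
        rw [Pi.zero_apply, dist_zero_left] at h2
        exact (norm_indicator_le_norm_self _ _).trans h2.le)
      ((hf k).congr fun z hz => indicator_of_mem hz _)
      (measurable_indicator_ball (hf k))
      (by
        rw [hMp, hPow_congr_sphere (G := f k), hPow_eq hp]
        · exact ENNReal.rpow_le_rpow (hfM k) hp.le
        · intro ζ hζ r hr
          rw [indicator_of_mem]
          rw [Bn, mem_ball_zero_iff, norm_smul, hζ, mul_one, Real.norm_of_nonneg hr.1.le]
          exact hr.2)
    rw [hPow_congr_sphere (G := J g (f k))
      fun ζ hζ r hr => J_indicator_smul g (f k) hζ hr] at h1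
    refine h1.trans ?_
    gcongr
    rw [div_mul_eq_mul_div, div_le_iff₀ (by positivity)]
    nlinarith
  have hlim : Tendsto (fun η : ℝ => (2 : ℝ≥0∞) ^ q *
      (ENNReal.ofReal η ^ q + ENNReal.ofReal (2 * η) ^ q * D)) (𝓝 0) (𝓝 0) := by
    have h1 : Tendsto (fun η : ℝ => ENNReal.ofReal η ^ q) (𝓝 0) (𝓝 0) := by
      refine hrp.comp ?_
      simpa using ENNReal.continuous_ofReal.tendsto 0
    have h2 : Tendsto (fun η : ℝ => ENNReal.ofReal (2 * η) ^ q) (𝓝 0) (𝓝 0) := by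
      refine hrp.comp ?_
      have h := (ENNReal.continuous_ofReal.comp (continuous_const_mul (2 : ℝ))).tendsto 0
      rwa [Function.comp_apply, mul_zero, ENNReal.ofReal_zero] at h
    have h3 := ENNReal.Tendsto.const_mul (a := (2 : ℝ≥0∞) ^ q)
      (h1.add (ENNReal.Tendsto.mul_const (b := (D : ℝ≥0∞)) h2 (Or.inr ENNReal.coe_ne_top)))
      (Or.inr h2q)
    simpa using h3
  refine ENNReal.tendsto_nhds_zero.2 fun ε hε => ?_
  have h := (hlim.mono_left nhdsWithin_le_nhds : Tendsto _ (𝓝[>] (0 : ℝ)) _)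
  obtain ⟨η, h1, h2⟩ := ((h.eventually_le_const hε).and self_mem_nhdsWithin).exists
  exact (key η h2 η h2).mono fun k hk => hk.trans h1

end

/-- For `0 < p < q < ∞` with `α = n(1/p - 1/q) < 1` and `g` holomorphic
on `B_n`, the operator `J_g : H^p → H^q` is compact iff `g ∈ λ(α)`, i.e.
`(1-|z|²)^{1-α}|Rg(z)| → 0` as `|z| → 1⁻`. -/
theorem stmt13 (n : ℕ) (hn : 1 ≤ n) (p q α : ℝ) (hp : 0 < p) (hpq : p < q)
    (hα : α = (n : ℝ) * (1 / p - 1 / q)) (hα1 : α < 1)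
    (g : En n → ℂ) (hg : DifferentiableOn ℂ g (Bn n)) :
    (∀ f : ℕ → En n → ℂ, (∀ k, MemHp n p (f k)) →
        (∃ M : ℝ≥0∞, M < ⊤ ∧ ∀ k, hNorm n p (f k) ≤ M) →
        (∀ K : Set (En n), K ⊆ Bn n → IsCompact K →
          TendstoUniformlyOn (fun k => f k) 0 atTop K) →
        Tendsto (fun k => hNorm n q (J g (f k))) atTop (𝓝 0)) ↔
      ∀ ε > (0 : ℝ), ∃ r ∈ Set.Ioo (0 : ℝ) 1, ∀ z ∈ Bn n,
        r < ‖z‖ → (1 - ‖z‖ ^ 2) ^ (1 - α) * ‖radD g z‖ < ε := by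
  exact ⟨fun H => little_lipschitz_of_compact hn hp hpq hα hg H, fun H _ hf ⟨_, hM, hfM⟩ hf0 =>
    compact_of_little_lipschitz hn hp hpq hα hα1 hg H (fun k => (hf k).1) hM hfM hf0⟩

end
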